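/- Pontryagin's theorem on stable homotopy groups of spheres: for every n ≥ 3, the homotopy group π_{n+1}(S^n) is isomorphic to ℤ/2. -/

import Mathlib

/-!
STATEMENT 11 (Pontryagin's theorem on stable homotopy groups of spheres):
for every n ≥ 3, the homotopy group π_{n+1}(S^n) is isomorphic to ℤ/2.
-/

open Metric
open scoped Topology

namespace PontryaginStem

open Set
open scoped unitInterval Topology.Homotopy

set_option linter.unusedSectionVars false

section Functoriality

variable {N X Y : Type*} [TopologicalSpace X] [TopologicalSpace Y]

/-- Postcomposition of a generalized loop with a pointed map. -/
def postcomp (φ : C(X, Y)) {x : X} {y : Y} (h : φ x = y) (f : Ω^ N X x) : Ω^ N Y y :=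
  ⟨φ.comp f.1, fun t ht => by
    rw [ContinuousMap.comp_apply]
    exact (congrArg φ (f.2 t ht)).trans h⟩

theorem postcomp_homotopic (φ : C(X, Y)) {x : X} {y : Y} (h : φ x = y) {f g : Ω^ N X x}
    (H : GenLoop.Homotopic f g) :
    GenLoop.Homotopic (postcomp φ h f) (postcomp φ h g) :=
  ContinuousMap.HomotopicRel.comp_continuousMap H φ

variable [DecidableEq N] [Nonempty N]

/-- The homomorphism of homotopy groups induced by a pointed map. -/
noncomputable def inducedHom (φ : C(X, Y)) {x : X} {y : Y} (h : φ x = y) :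
    HomotopyGroup N X x →* HomotopyGroup N Y y :=
  MonoidHom.mk' (Quotient.map (postcomp φ h) fun _ _ H => postcomp_homotopic φ h H) (by
    intro a b
    induction a using Quotient.inductionOn with | _ f
    induction b using Quotient.inductionOn with | _ g
    let i : N := Classical.arbitrary N
    have h1 := HomotopyGroup.mul_spec (i := i) (p := f) (q := g)
    have h2 := HomotopyGroup.mul_spec (i := i) (p := postcomp φ h f) (q := postcomp φ h g)
    refine (congrArg _ h1).trans (Eq.trans ?_ h2.symm)
    refine congrArg (Quotient.mk _) ?_
    ext t
    simp only [postcomp, GenLoop.transAt, GenLoop.coe_copy, GenLoop.mk_apply,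
      ContinuousMap.comp_apply, GenLoop.coe_coe]
    split_ifs <;> rfl)

theorem inducedHom_mk (φ : C(X, Y)) {x : X} {y : Y} (h : φ x = y) (f : Ω^ N X x) :
    inducedHom φ h (⟦f⟧ : HomotopyGroup N X x) = (⟦postcomp φ h f⟧ : HomotopyGroup N Y y) := rfl

end Functoriality

section Loops

variable {k : ℕ} {E E' : Type*} [NormedAddCommGroup E] [NormedAddCommGroup E']

/-- The homotopy groups of the punctured space. -/
abbrev PG (k : ℕ) (E : Type*) [NormedAddCommGroup E] (x : {v : E // v ≠ 0}) : Type _ :=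
  HomotopyGroup (Fin k) {v : E // v ≠ 0} x

/-- A map on the real unit cube that represents a generalized loop in the punctured space. -/
structure IsLoop (x : E) (f : (Fin k → ℝ) → E) : Prop where
  cont : ContinuousOn f (Icc 0 1)
  ne : ∀ y ∈ Icc (0 : Fin k → ℝ) 1, f y ≠ 0
  bd : ∀ y ∈ Icc (0 : Fin k → ℝ) 1, ∀ i, (y i = 0 ∨ y i = 1) → f y = x

/-- The inclusion of the unit cube into Euclidean space. -/
def cubeVal (y : Fin k → I) : Fin k → ℝ := fun i => (y i : ℝ)

theorem cubeVal_mem (y : Fin k → I) : cubeVal y ∈ Icc (0 : Fin k → ℝ) 1 :=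
  ⟨fun i => (y i).2.1, fun i => (y i).2.2⟩

theorem continuous_cubeVal : Continuous (cubeVal : (Fin k → I) → Fin k → ℝ) := by
  unfold cubeVal; fun_prop

/-- The retraction of Euclidean space onto the unit cube. -/
noncomputable def cubeProj (y : Fin k → ℝ) : Fin k → I := fun i => projIcc 0 1 zero_le_one (y i)

theorem continuous_cubeProj : Continuous (cubeProj : (Fin k → ℝ) → Fin k → I) :=
  continuous_pi fun i => continuous_projIcc.comp (continuous_apply i)

theorem cubeProj_cubeVal (y : Fin k → I) : cubeProj (cubeVal y) = y := by
  funext i; exact projIcc_val _ _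

theorem cubeVal_cubeProj {y : Fin k → ℝ} (hy : y ∈ Icc (0 : Fin k → ℝ) 1) :
    cubeVal (cubeProj y) = y := by
  funext i
  exact congrArg Subtype.val (projIcc_of_mem (zero_le_one' ℝ) ⟨hy.1 i, hy.2 i⟩)

/-- The generalized loop represented by a map on the real cube. -/
def IsLoop.toGen {x : {v : E // v ≠ 0}} {f : (Fin k → ℝ) → E} (h : IsLoop x.1 f) :
    Ω^ (Fin k) {v : E // v ≠ 0} x :=
  ⟨⟨fun y => ⟨f (cubeVal y), h.ne _ (cubeVal_mem y)⟩,
    (h.cont.comp_continuous continuous_cubeVal cubeVal_mem).subtype_mk _⟩, by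
    rintro y ⟨i, hi⟩
    refine Subtype.ext (h.bd _ (cubeVal_mem y) i ?_)
    rcases hi with hi | hi <;> simp [cubeVal, hi]⟩

/-- The homotopy class of a loop. -/
def IsLoop.cls {x : {v : E // v ≠ 0}} {f : (Fin k → ℝ) → E} (h : IsLoop x.1 f) : PG k E x :=
  Quotient.mk _ h.toGen

theorem IsLoop.cls_congr {x : {v : E // v ≠ 0}} {f g : (Fin k → ℝ) → E} (hf : IsLoop x.1 f)
    (hg : IsLoop x.1 g) (H : ∀ y ∈ Icc (0 : Fin k → ℝ) 1, f y = g y) : hf.cls = hg.cls := by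
  refine congrArg (Quotient.mk _) ?_
  ext y
  exact H _ (cubeVal_mem y)

theorem IsLoop.congr {x : E} {f g : (Fin k → ℝ) → E} (hf : IsLoop x f)
    (H : ∀ y ∈ Icc (0 : Fin k → ℝ) 1, g y = f y) : IsLoop x g :=
  ⟨hf.cont.congr H, fun y hy => by rw [H y hy]; exact hf.ne y hy,
    fun y hy => by rw [H y hy]; exact hf.bd y hy⟩

theorem exists_loop {x : {v : E // v ≠ 0}} (a : PG k E x) :
    ∃ f : (Fin k → ℝ) → E, ∃ h : IsLoop x.1 f, h.cls = a ∧ Continuous f ∧ ∀ y, f y ≠ 0 := by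
  induction a using Quotient.inductionOn with | _ g
  have hc : Continuous fun y : Fin k → ℝ => (g (cubeProj y)).1 :=
    continuous_subtype_val.comp (g.1.continuous.comp continuous_cubeProj)
  refine ⟨fun y => (g (cubeProj y)).1, ⟨hc.continuousOn, fun y _ => (g (cubeProj y)).2, ?_⟩, ?_,
    hc, fun y => (g (cubeProj y)).2⟩
  · intro y hy i hi
    refine congrArg Subtype.val (g.2 _ ⟨i, ?_⟩)
    rcases hi with hi | hi
    · left; simp [cubeProj, hi]
    · right; simp [cubeProj, hi]
  · refine congrArg (Quotient.mk _) ?_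
    ext y
    change (g (cubeProj (cubeVal y))).1 = _
    rw [cubeProj_cubeVal]

/-- A homotopy of loops on the real cube. -/
structure IsHtpy (x : E) (f g : (Fin k → ℝ) → E) (H : ℝ → (Fin k → ℝ) → E) : Prop where
  cont : ContinuousOn (fun p : ℝ × (Fin k → ℝ) => H p.1 p.2) (Icc 0 1 ×ˢ Icc 0 1)
  ne : ∀ τ ∈ Icc (0 : ℝ) 1, ∀ y ∈ Icc (0 : Fin k → ℝ) 1, H τ y ≠ 0
  bd : ∀ τ ∈ Icc (0 : ℝ) 1, ∀ y ∈ Icc (0 : Fin k → ℝ) 1, ∀ i, (y i = 0 ∨ y i = 1) → H τ y = x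
  zero : ∀ y ∈ Icc (0 : Fin k → ℝ) 1, H 0 y = f y
  one : ∀ y ∈ Icc (0 : Fin k → ℝ) 1, H 1 y = g y

theorem IsHtpy.isLoop {x : E} {f g : (Fin k → ℝ) → E} {H : ℝ → (Fin k → ℝ) → E}
    (hH : IsHtpy x f g H) {τ : ℝ} (hτ : τ ∈ Icc (0 : ℝ) 1) : IsLoop x (H τ) :=
  ⟨hH.cont.comp (f := fun y => (τ, y)) (by fun_prop) fun _ hy => ⟨hτ, hy⟩, hH.ne τ hτ, hH.bd τ hτ⟩

theorem IsHtpy.isLoop_left {x : E} {f g : (Fin k → ℝ) → E} {H : ℝ → (Fin k → ℝ) → E}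
    (hH : IsHtpy x f g H) : IsLoop x f :=
  (hH.isLoop ⟨le_rfl, zero_le_one⟩).congr fun y hy => (hH.zero y hy).symm

theorem IsHtpy.isLoop_right {x : E} {f g : (Fin k → ℝ) → E} {H : ℝ → (Fin k → ℝ) → E}
    (hH : IsHtpy x f g H) : IsLoop x g :=
  (hH.isLoop ⟨zero_le_one, le_rfl⟩).congr fun y hy => (hH.one y hy).symm

theorem IsHtpy.cls_eq {x : {v : E // v ≠ 0}} {f g : (Fin k → ℝ) → E}
    {H : ℝ → (Fin k → ℝ) → E} (hH : IsHtpy x.1 f g H) (hf : IsLoop x.1 f) (hg : IsLoop x.1 g) :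
    hf.cls = hg.cls := by
  refine Quotient.sound ⟨⟨⟨⟨fun p => ⟨H p.1 (cubeVal p.2), hH.ne _ p.1.2 _ (cubeVal_mem _)⟩, ?_⟩,
    ?_, ?_⟩, ?_⟩⟩
  · refine Continuous.subtype_mk ?_ _
    exact hH.cont.comp_continuous (f := fun p : I × (Fin k → I) => ((p.1 : ℝ), cubeVal p.2))
      (by have := continuous_cubeVal (k := k); fun_prop) fun p => ⟨p.1.2, cubeVal_mem _⟩
  · intro y; exact Subtype.ext (hH.zero _ (cubeVal_mem y))
  · intro y; exact Subtype.ext (hH.one _ (cubeVal_mem y))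
  · rintro t y ⟨i, hi⟩
    refine Subtype.ext ?_
    have hb : cubeVal y i = 0 ∨ cubeVal y i = 1 := by
      rcases hi with hi | hi <;> simp [cubeVal, hi]
    exact (hH.bd _ t.2 _ (cubeVal_mem y) i hb).trans (hf.bd _ (cubeVal_mem y) i hb).symm

theorem exists_htpy {x : {v : E // v ≠ 0}} {f g : (Fin k → ℝ) → E} {hf : IsLoop x.1 f}
    {hg : IsLoop x.1 g} (h : hf.cls = hg.cls) :
    ∃ H : ℝ → (Fin k → ℝ) → E, IsHtpy x.1 f g H ∧
      (Continuous fun p : ℝ × (Fin k → ℝ) => H p.1 p.2) ∧ ∀ τ y, H τ y ≠ 0 := by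
  obtain ⟨G⟩ : GenLoop.Homotopic hf.toGen hg.toGen := Quotient.exact h
  have hc : Continuous fun p : ℝ × (Fin k → ℝ) =>
      (G (projIcc 0 1 zero_le_one p.1, cubeProj p.2)).1 := by
    have h1 := continuous_cubeProj (k := k)
    have h2 : Continuous (projIcc (0 : ℝ) 1 zero_le_one) := continuous_projIcc
    exact continuous_subtype_val.comp (G.continuous.comp (by fun_prop))
  refine ⟨fun τ y => (G (projIcc 0 1 zero_le_one τ, cubeProj y)).1,
    ⟨hc.continuousOn, fun τ _ y _ => (G _).2, ?_, ?_, ?_⟩, hc, fun τ y => (G _).2⟩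
  · intro τ hτ y hy i hi
    have hm : cubeProj y ∈ Cube.boundary (Fin k) := by
      refine ⟨i, ?_⟩
      rcases hi with hi | hi
      · left; simp [cubeProj, hi]
      · right; simp [cubeProj, hi]
    refine (congrArg Subtype.val (G.eq_fst _ hm)).trans ?_
    exact congrArg Subtype.val (hf.toGen.2 _ hm)
  · intro y hy
    simp only [projIcc_left]
    refine (congrArg Subtype.val (G.apply_zero (cubeProj y))).trans ?_
    change f (cubeVal (cubeProj y)) = _
    rw [cubeVal_cubeProj hy]
  · intro y hy
    simp only [projIcc_right]
    refine (congrArg Subtype.val (G.apply_one (cubeProj y))).trans ?_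
    change g (cubeVal (cubeProj y)) = _
    rw [cubeVal_cubeProj hy]

theorem isLoop_const {x : E} (hx : x ≠ 0) : IsLoop (k := k) x fun _ => x :=
  ⟨continuousOn_const, fun _ _ => hx, fun _ _ _ _ => rfl⟩

theorem cls_const (x : {v : E // v ≠ 0}) : (isLoop_const (k := k + 1) x.2).cls (x := x) = 1 :=
  HomotopyGroup.one_def.symm

/-- Concatenation of maps on the real cube in a coordinate direction. -/
noncomputable def cat (i : Fin k) (f g : (Fin k → ℝ) → E) (y : Fin k → ℝ) : E :=
  if y i ≤ 1 / 2 then f (Function.update y i (2 * y i)) else g (Function.update y i (2 * y i - 1))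

theorem cat_eq_toGen {x : {v : E // v ≠ 0}} (i : Fin k) {f g : (Fin k → ℝ) → E}
    (hf : IsLoop x.1 f) (hg : IsLoop x.1 g) (y : Fin k → I) :
    (GenLoop.transAt i hf.toGen hg.toGen y).1 = cat i f g (cubeVal y) := by
  simp only [GenLoop.transAt, GenLoop.coe_copy, cat]
  have h0 := (y i).2.1
  have h1 := (y i).2.2
  by_cases h : (y i : ℝ) ≤ 1 / 2
  · rw [if_pos h, if_pos (show cubeVal y i ≤ 1 / 2 from h)]
    change f (cubeVal _) = _
    congr 1
    funext j
    rcases eq_or_ne j i with rfl | hj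
    · simp only [cubeVal, Function.update_self]
      rw [projIcc_of_mem (zero_le_one' ℝ) ⟨by linarith, by linarith⟩]
    · simp [cubeVal, Function.update_of_ne hj]
  · rw [if_neg h, if_neg (show ¬ cubeVal y i ≤ 1 / 2 from h)]
    change g (cubeVal _) = _
    congr 1
    funext j
    rcases eq_or_ne j i with rfl | hj
    · simp only [cubeVal, Function.update_self]
      rw [projIcc_of_mem (zero_le_one' ℝ) ⟨by linarith, by linarith⟩]
    · simp [cubeVal, Function.update_of_ne hj]

theorem isLoop_of_gen {x : {v : E // v ≠ 0}} (p : Ω^ (Fin k) {v : E // v ≠ 0} x)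
    {f : (Fin k → ℝ) → E} (h : ∀ y, (p y).1 = f (cubeVal y)) : IsLoop x.1 f := by
  have hc : Continuous fun y : Fin k → ℝ => (p (cubeProj y)).1 :=
    continuous_subtype_val.comp (p.1.continuous.comp continuous_cubeProj)
  have hE : ∀ y ∈ Icc (0 : Fin k → ℝ) 1, f y = (p (cubeProj y)).1 := fun y hy => by
    rw [h, cubeVal_cubeProj hy]
  refine ⟨hc.continuousOn.congr hE, fun y hy => by rw [hE y hy]; exact (p _).2, ?_⟩
  intro y hy i hi
  rw [hE y hy]
  refine congrArg Subtype.val (p.2 _ ⟨i, ?_⟩)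
  rcases hi with hi | hi
  · left; simp [cubeProj, hi]
  · right; simp [cubeProj, hi]

theorem isLoop_cat {x : {v : E // v ≠ 0}} (i : Fin k) {f g : (Fin k → ℝ) → E}
    (hf : IsLoop x.1 f) (hg : IsLoop x.1 g) : IsLoop x.1 (cat i f g) :=
  isLoop_of_gen _ (cat_eq_toGen i hf hg)

theorem cls_cat {x : {v : E // v ≠ 0}} (i : Fin (k + 1)) {f g : (Fin (k + 1) → ℝ) → E}
    (hf : IsLoop x.1 f) (hg : IsLoop x.1 g) (h : IsLoop x.1 (cat i f g)) :
    h.cls = hg.cls * hf.cls := by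
  refine Eq.trans ?_ (HomotopyGroup.mul_spec (i := i)).symm
  refine congrArg (Quotient.mk _) ?_
  ext y
  exact (cat_eq_toGen i hf hg y).symm

theorem rev_eq_toGen {x : {v : E // v ≠ 0}} (i : Fin k) {f : (Fin k → ℝ) → E}
    (hf : IsLoop x.1 f) (y : Fin k → I) :
    (GenLoop.symmAt i hf.toGen y).1 =
      f (Function.update (cubeVal y) i (1 - cubeVal y i)) := by
  simp only [GenLoop.symmAt, GenLoop.coe_copy]
  change f (cubeVal _) = _
  congr 1
  funext j
  rcases eq_or_ne j i with rfl | hj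
  · simp [cubeVal]
  · simp [cubeVal, hj]

theorem isLoop_rev {x : {v : E // v ≠ 0}} (i : Fin k) {f : (Fin k → ℝ) → E}
    (hf : IsLoop x.1 f) : IsLoop x.1 fun y => f (Function.update y i (1 - y i)) :=
  isLoop_of_gen _ (rev_eq_toGen i hf)

theorem cls_rev {x : {v : E // v ≠ 0}} (i : Fin (k + 1)) {f : (Fin (k + 1) → ℝ) → E}
    (hf : IsLoop x.1 f) : (isLoop_rev i hf).cls = hf.cls⁻¹ := by
  refine Eq.trans ?_ (HomotopyGroup.inv_spec (i := i)).symm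
  refine congrArg (Quotient.mk _) ?_
  ext y
  exact (rev_eq_toGen i hf y).symm

theorem IsLoop.comp {x : E} {x' : E'} {f : (Fin k → ℝ) → E} (hf : IsLoop x f) {φ : E → E'}
    (hc : ContinuousOn φ {0}ᶜ) (hn : ∀ v, v ≠ 0 → φ v ≠ 0) (hx : φ x = x') :
    IsLoop x' fun y => φ (f y) :=
  ⟨hc.comp hf.cont fun y hy => hf.ne y hy, fun y hy => hn _ (hf.ne y hy),
    fun y hy i hi => by rw [hf.bd y hy i hi, hx]⟩

/-- The homomorphism induced by a map of punctured spaces. -/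
noncomputable def pmap {φ : E → E'} (hc : ContinuousOn φ {0}ᶜ) (hn : ∀ v, v ≠ 0 → φ v ≠ 0)
    {x : {v : E // v ≠ 0}} {x' : {v : E' // v ≠ 0}} (hx : φ x.1 = x'.1) :
    PG (k + 1) E x →* PG (k + 1) E' x' :=
  inducedHom ⟨fun v => ⟨φ v.1, hn _ v.2⟩,
    (hc.comp_continuous continuous_subtype_val fun v => v.2).subtype_mk _⟩ (Subtype.ext hx)

theorem pmap_cls {φ : E → E'} (hc : ContinuousOn φ {0}ᶜ) (hn : ∀ v, v ≠ 0 → φ v ≠ 0)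
    {x : {v : E // v ≠ 0}} {x' : {v : E' // v ≠ 0}} (hx : φ x.1 = x'.1)
    {f : (Fin (k + 1) → ℝ) → E} (hf : IsLoop x.1 f) :
    pmap hc hn hx hf.cls = (hf.comp hc hn hx).cls := rfl

/-- Pointed-homotopic maps of punctured spaces act identically on homotopy classes. -/
theorem cls_comp_eq_of_homotopy {x : {v : E // v ≠ 0}} {x' : {v : E' // v ≠ 0}}
    {f : (Fin k → ℝ) → E} (hf : IsLoop x.1 f) (Φ : ℝ → E → E')
    (hc : ContinuousOn (fun p : ℝ × E => Φ p.1 p.2) (Icc 0 1 ×ˢ {0}ᶜ))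
    (hn : ∀ τ ∈ Icc (0 : ℝ) 1, ∀ v, v ≠ 0 → Φ τ v ≠ 0)
    (hx : ∀ τ ∈ Icc (0 : ℝ) 1, Φ τ x.1 = x'.1)
    (h0 : IsLoop x'.1 fun y => Φ 0 (f y)) (h1 : IsLoop x'.1 fun y => Φ 1 (f y)) :
    h0.cls = h1.cls := by
  refine IsHtpy.cls_eq (H := fun τ y => Φ τ (f y)) ⟨?_, fun τ hτ y hy => hn τ hτ _ (hf.ne y hy),
    fun τ hτ y hy i hi => by rw [hf.bd y hy i hi, hx τ hτ], fun _ _ => rfl, fun _ _ => rfl⟩ h0 h1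
  refine hc.comp (f := fun p : ℝ × (Fin k → ℝ) => (p.1, f p.2)) ?_
    fun p hp => ⟨hp.1, hf.ne _ hp.2⟩
  exact continuousOn_fst.prodMk (hf.cont.comp continuousOn_snd fun p hp => hp.2)

end Loops

section Cut

variable {E P : Type*} [NormedAddCommGroup E] [NormedSpace ℝ E]
  [NormedAddCommGroup P] [NormedSpace ℝ P] [FiniteDimensional ℝ P]

theorem exists_contDiff_near (f : P → E) (hf : Continuous f) {ε : ℝ} (hε : 0 < ε) :
    ∃ g : P → E, ContDiff ℝ 1 g ∧ ∀ p, ‖g p - f p‖ < ε := by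
  obtain ⟨g, hg⟩ := exists_contMDiffMap_forall_mem_convex_of_local_const (n := ⊤)
    (modelWithCornersSelf ℝ P) (t := fun p => ball (f p) ε) (fun p => convex_ball _ _) (by
      intro p
      refine ⟨f p, ?_⟩
      have := (hf.tendsto p).eventually (ball_mem_nhds (f p) hε)
      filter_upwards [this] with y hy
      rwa [mem_ball_comm])
  refine ⟨g, ?_, fun p => ?_⟩
  · have h := g.contMDiff
    rw [contMDiff_iff_contDiff] at h
    exact h.of_le (by exact_mod_cast le_top)
  · have := hg p
    rwa [mem_ball_iff_norm] at this

/-- The complement of the closed lower ray. -/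
def Upper (v : E × ℝ) : Prop := v.1 ≠ 0 ∨ 0 < v.2

/-- The complement of the closed upper ray. -/
def Lower (v : E × ℝ) : Prop := v.1 ≠ 0 ∨ v.2 < 0

/-- The projection of the real line onto the unit interval. -/
noncomputable def clamp (s : ℝ) : ℝ := max 0 (min 1 s)

theorem clamp_mem (s : ℝ) : clamp s ∈ Icc (0 : ℝ) 1 :=
  ⟨le_max_left _ _, max_le zero_le_one (min_le_left _ _)⟩

theorem continuous_clamp : Continuous clamp := by unfold clamp; fun_prop

theorem clamp_of_one_le {s : ℝ} (h : 1 ≤ s) : clamp s = 1 := by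
  simp [clamp, h]

theorem clamp_of_nonpos {s : ℝ} (h : s ≤ 0) : clamp s = 0 := by
  unfold clamp; rw [min_eq_right (by linarith), max_eq_left h]

/-- General position: a map of a cylinder into a punctured space can be perturbed so that the
preimages of the two rays have disjoint projections, hence can be separated by a cut. -/
theorem exists_cut [FiniteDimensional ℝ E] (F : P × ℝ → E × ℝ) (hF : Continuous F)
    (K : Set P) (hK : IsCompact K)
    (hnz : ∀ p ∈ K ×ˢ Icc (0 : ℝ) 1, F p ≠ 0)
    (h0 : ∀ x ∈ K, (F (x, 0)).2 = 0) (h1 : ∀ x ∈ K, (F (x, 1)).2 = 0)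
    (hdim : Module.finrank ℝ P + 2 < 2 * Module.finrank ℝ E) :
    ∃ (F' : P × ℝ → E × ℝ) (τ : P → ℝ), Continuous F' ∧ Continuous τ ∧
      (∀ p, (F' p).2 = (F p).2) ∧
      (∀ p ∈ K ×ˢ Icc (0 : ℝ) 1, (F p).2 = 0 → F' p = F p) ∧
      (∀ x, τ x ∈ Icc (0 : ℝ) 1) ∧
      (∀ x ∈ K, ∀ t ∈ Icc (0 : ℝ) 1, t ≤ τ x → Upper (F' (x, t))) ∧
      (∀ x ∈ K, ∀ t ∈ Icc (0 : ℝ) 1, τ x ≤ t → Lower (F' (x, t))) := by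
  rcases K.eq_empty_or_nonempty with rfl | hKne
  · exact ⟨F, fun _ => 0, hF, continuous_const, by simp, by simp, by simp, by simp, by simp⟩
  have hKI : IsCompact (K ×ˢ Icc (0 : ℝ) 1) := hK.prod isCompact_Icc
  obtain ⟨p₀, hp₀, hmin⟩ := hKI.exists_isMinOn (hKne.prod ⟨0, by simp⟩) hF.norm.continuousOn
  set δ := ‖F p₀‖ with hδ
  have hδpos : 0 < δ := norm_pos_iff.2 (hnz _ hp₀)
  have hδle : ∀ p ∈ K ×ˢ Icc (0 : ℝ) 1, δ ≤ ‖(F p).1‖ ∨ δ ≤ |(F p).2| := fun p hp => by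
    have : δ ≤ ‖F p‖ := hmin hp
    rwa [Prod.norm_def, le_max_iff] at this
  obtain ⟨g, hg, hgF⟩ := exists_contDiff_near (fun p => (F p).1) (by fun_prop)
    (show 0 < δ / 12 by positivity)
  have hd : Dense (range fun q : P × ℝ × ℝ => (g (q.1, q.2.1), g (q.1, q.2.2)))ᶜ := by
    refine ContDiff.dense_compl_range_of_finrank_lt_finrank ?_ ?_
    · exact (hg.comp (contDiff_fst.prodMk (contDiff_fst.comp contDiff_snd))).prodMk
        (hg.comp (contDiff_fst.prodMk (contDiff_snd.comp contDiff_snd)))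
    · simp only [Module.finrank_prod, Module.finrank_self]; omega
  obtain ⟨⟨a, b⟩, hab, hab'⟩ := hd.exists_mem_open (isOpen_ball (x := (0 : E × E)) (ε := δ / 12))
    ⟨0, mem_ball_self (by positivity)⟩
  rw [mem_ball_zero_iff, Prod.norm_def, max_lt_iff] at hab'
  obtain ⟨ha, hb⟩ := hab'
  simp only at ha hb
  let c : ℝ → E := fun s => clamp ((s / δ + 1) / 2) • a + (1 - clamp ((s / δ + 1) / 2)) • b
  have hcc : Continuous c := by
    have := continuous_clamp
    fun_prop
  have hcn : ∀ s, ‖c s‖ < δ / 12 := fun s => by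
    have := clamp_mem ((s / δ + 1) / 2)
    have hcv : c s ∈ ball (0 : E) (δ / 12) := by
      refine (convex_ball (0 : E) (δ / 12)) (by simpa using ha) (by simpa using hb) this.1
        (by linarith [this.2]) (by ring)
    simpa using hcv
  let ψ : ℝ → ℝ := fun r => clamp ((δ / 2 - r) * (6 / δ))
  have hψc : Continuous ψ := continuous_clamp.comp (by fun_prop)
  let F' : P × ℝ → E × ℝ := fun p =>
    ((F p).1 + ψ ‖(F p).1‖ • (g p - c (F p).2 - (F p).1), (F p).2)
  have hF'c : Continuous F' := by
    have := hg.continuous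
    fun_prop
  have hF'N : ∀ p, (F' p).2 = (F p).2 := fun p => rfl
  have hF'0 : ∀ p ∈ K ×ˢ Icc (0 : ℝ) 1, (F p).2 = 0 → F' p = F p := by
    intro p hp h
    have hge : δ ≤ ‖(F p).1‖ := by
      rcases hδle p hp with h' | h'
      · exact h'
      · rw [h, abs_zero] at h'; linarith
    have : ψ ‖(F p).1‖ = 0 := clamp_of_nonpos (mul_nonpos_of_nonpos_of_nonneg (by linarith)
      (by positivity))
    ext1
    · simp [F', this]
    · rfl
  have hray : ∀ p ∈ K ×ˢ Icc (0 : ℝ) 1, (F' p).1 = 0 → δ ≤ |(F p).2| ∧ g p = c (F p).2 := by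
    intro p hp h
    have hsm : ‖(F p).1‖ ≤ δ / 3 := by
      have e1 : (F p).1 = -(ψ ‖(F p).1‖ • (g p - c (F p).2 - (F p).1)) := by
        rw [eq_neg_iff_add_eq_zero]; exact h
      have e2 : ‖(F p).1‖ = |ψ ‖(F p).1‖| * ‖g p - c (F p).2 - (F p).1‖ := by
        conv_lhs => rw [e1, norm_neg, norm_smul, Real.norm_eq_abs]
      have hψ := clamp_mem ((δ / 2 - ‖(F p).1‖) * (6 / δ))
      have e3 : |ψ ‖(F p).1‖| ≤ 1 := abs_le.2 ⟨by linarith [hψ.1], hψ.2⟩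
      have e4 : ‖g p - c (F p).2 - (F p).1‖ ≤ δ / 12 + δ / 12 := by
        calc _ = ‖(g p - (F p).1) - c (F p).2‖ := by congr 1; abel
          _ ≤ _ := norm_sub_le _ _
          _ ≤ _ := add_le_add (hgF p).le (hcn _).le
      nlinarith [norm_nonneg (g p - c (F p).2 - (F p).1)]
    have hψ1 : ψ ‖(F p).1‖ = 1 := by
      refine clamp_of_one_le ?_
      rw [← mul_div_assoc, le_div_iff₀ hδpos]; linarith
    constructor
    · rcases hδle p hp with h' | h'
      · linarith
      · exact h'
    · have h2 : (F p).1 + ψ ‖(F p).1‖ • (g p - c (F p).2 - (F p).1) = 0 := h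
      rw [hψ1, one_smul, add_sub_cancel] at h2
      exact sub_eq_zero.1 h2
  let A : Set P := Prod.fst '' (K ×ˢ Icc (0 : ℝ) 1 ∩ {p | (F' p).1 = 0 ∧ (F' p).2 ≤ 0})
  let B : Set P := Prod.fst '' (K ×ˢ Icc (0 : ℝ) 1 ∩ {p | (F' p).1 = 0 ∧ 0 ≤ (F' p).2})
  have hA : IsClosed A := by
    refine ((hKI.inter_right ?_).image continuous_fst).isClosed
    exact (isClosed_eq hF'c.fst continuous_const).inter (isClosed_le hF'c.snd continuous_const)
  have hB : IsClosed B := by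
    refine ((hKI.inter_right ?_).image continuous_fst).isClosed
    exact (isClosed_eq hF'c.fst continuous_const).inter (isClosed_le continuous_const hF'c.snd)
  have hAB : Disjoint A B := by
    rw [Set.disjoint_left]
    rintro _ ⟨⟨x, t⟩, ⟨hp, hp1, hp2⟩, rfl⟩ ⟨⟨x', t'⟩, ⟨hq, hq1, hq2⟩, hxx⟩
    simp only at hxx
    subst hxx
    obtain ⟨e1, e2⟩ := hray _ hp hp1
    obtain ⟨e3, e4⟩ := hray _ hq hq1
    rw [hF'N] at hp2 hq2
    rw [abs_of_nonpos hp2] at e1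
    rw [abs_of_nonneg hq2] at e3
    have cb : c (F (x', t)).2 = b := by
      have : clamp (((F (x', t)).2 / δ + 1) / 2) = 0 := by
        refine clamp_of_nonpos ?_
        have : (F (x', t)).2 / δ ≤ -1 := by rw [div_le_iff₀ hδpos]; linarith
        linarith
      simp [c, this]
    have ca : c (F (x', t')).2 = a := by
      have : clamp (((F (x', t')).2 / δ + 1) / 2) = 1 := by
        refine clamp_of_one_le ?_
        have : 1 ≤ (F (x', t')).2 / δ := by rw [le_div_iff₀ hδpos]; linarith
        linarith
      simp [c, this]
    exact hab ⟨(x', t', t), by simp only; rw [e2, e4, ca, cb]⟩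
  obtain ⟨τ, hτA, hτB, hτ⟩ := exists_continuous_zero_one_of_isClosed hA hB hAB
  have hF'ne : ∀ p ∈ K ×ˢ Icc (0 : ℝ) 1, (F' p).1 = 0 → (F p).2 ≠ 0 := by
    intro p hp h h'
    have := (hray p hp h).1
    rw [h', abs_zero] at this
    linarith
  refine ⟨F', τ, hF'c, τ.continuous, hF'N, hF'0, hτ, ?_, ?_⟩
  · intro x hx t ht hle
    by_contra hcon
    simp only [Upper, not_or, not_not, not_lt] at hcon
    have hτ0 : τ x = 0 := hτA ⟨(x, t), ⟨⟨hx, ht⟩, hcon⟩, rfl⟩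
    have ht0 : t = 0 := le_antisymm (hτ0 ▸ hle) ht.1
    subst ht0
    exact hF'ne (x, 0) ⟨hx, ht⟩ hcon.1 (h0 x hx)
  · intro x hx t ht hle
    by_contra hcon
    simp only [Lower, not_or, not_not, not_lt] at hcon
    have hτ1 : τ x = 1 := hτB ⟨(x, t), ⟨⟨hx, ht⟩, hcon⟩, rfl⟩
    have ht1 : t = 1 := le_antisymm ht.2 (hτ1 ▸ hle)
    subst ht1
    exact hF'ne (x, 1) ⟨hx, ht⟩ hcon.1 (h1 x hx)

end Cut

theorem continuousOn_ite_le {X Y : Type*} [TopologicalSpace X] [TopologicalSpace Y] {f g : X → Y}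
    {S : Set X} {φ : X → ℝ} {c : ℝ} (hφ : Continuous φ)
    (hf : ContinuousOn f (S ∩ {x | φ x ≤ c})) (hg : ContinuousOn g (S ∩ {x | c ≤ φ x}))
    (heq : ∀ x ∈ S, φ x = c → f x = g x) :
    ContinuousOn (fun x => if φ x ≤ c then f x else g x) S := by
  refine ContinuousOn.if ?_ ?_ ?_
  · rintro x ⟨hx, hx'⟩
    exact heq x hx (frontier_le_subset_eq hφ continuous_const hx')
  · refine hf.mono (inter_subset_inter_right _ ?_)
    exact (isClosed_le hφ continuous_const).closure_subset
  · refine hg.mono (inter_subset_inter_right _ ?_)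
    refine closure_minimal (fun x hx => ?_) (isClosed_le continuous_const hφ)
    exact le_of_lt (not_le.1 hx)

section Ladder

variable {E : Type*} [NormedAddCommGroup E] [NormedSpace ℝ E]

/-- The positive height coordinate on the complement of the lower ray. -/
noncomputable def height (v : E × ℝ) : ℝ := v.2 + √(‖v.1‖ ^ 2 + v.2 ^ 2)

theorem continuous_height : Continuous (height : E × ℝ → ℝ) := by unfold height; fun_prop

theorem height_pos {v : E × ℝ} (h : Upper v) : 0 < height v := by
  unfold height
  rcases le_or_gt v.2 0 with h2 | h2
  · have hn : 0 < ‖v.1‖ := norm_pos_iff.2 (h.resolve_right (not_lt.2 h2))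
    have : -v.2 < √(‖v.1‖ ^ 2 + v.2 ^ 2) := Real.lt_sqrt_of_sq_lt (by nlinarith)
    linarith
  · positivity

/-- The inverse of the chart given by the first component and the height. -/
noncomputable def unchart (w : E) (p : ℝ) : E × ℝ := (w, (p - ‖w‖ ^ 2 / p) / 2)

theorem unchart_height {v : E × ℝ} (h : Upper v) : unchart v.1 (height v) = v := by
  have hp := height_pos h
  refine Prod.ext rfl ?_
  simp only [unchart]
  have hs : √(‖v.1‖ ^ 2 + v.2 ^ 2) ^ 2 = ‖v.1‖ ^ 2 + v.2 ^ 2 := Real.sq_sqrt (by positivity)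
  have : ‖v.1‖ ^ 2 / height v = √(‖v.1‖ ^ 2 + v.2 ^ 2) - v.2 := by
    rw [div_eq_iff hp.ne']
    unfold height
    nlinarith
  rw [this, height]; ring

theorem unchart_ne_zero (w : E) {p : ℝ} (hp : 0 < p) : unchart w p ≠ 0 := by
  intro h
  have h1 : w = 0 := congrArg Prod.fst h
  have h2 : (p - ‖w‖ ^ 2 / p) / 2 = 0 := congrArg Prod.snd h
  rw [h1] at h2
  simp at h2
  exact hp.ne' h2

/-- Interpolation of two points in the chart, corrected so as to have a prescribed value at the
end of the interval. -/
noncomputable def interp (τ s : ℝ) (v₀ v₁ m₀ m₁ h : E × ℝ) : E × ℝ :=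
  unchart ((1 - τ) • v₀.1 + τ • v₁.1 + s • (h.1 - ((1 - τ) • m₀.1 + τ • m₁.1)))
    (((1 - τ) * height v₀ + τ * height v₁) *
      ((1 - s) + s * (height h / ((1 - τ) * height m₀ + τ * height m₁))))

theorem convex_comb_pos {τ a b : ℝ} (hτ : τ ∈ Icc (0 : ℝ) 1) (ha : 0 < a) (hb : 0 < b) :
    0 < (1 - τ) * a + τ * b := by
  rcases hτ.1.eq_or_lt with h | h
  · subst h; simpa using ha
  · have := mul_nonneg (sub_nonneg.2 hτ.2) ha.le
    have := mul_pos h hb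
    linarith

theorem interp_ne_zero {τ s : ℝ} {v₀ v₁ m₀ m₁ h : E × ℝ} (hτ : τ ∈ Icc (0 : ℝ) 1)
    (hs : s ∈ Icc (0 : ℝ) 1) (h₀ : Upper v₀) (h₁ : Upper v₁) (h₂ : Upper m₀) (h₃ : Upper m₁)
    (hh : Upper h) : interp τ s v₀ v₁ m₀ m₁ h ≠ 0 := by
  refine unchart_ne_zero _ (mul_pos (convex_comb_pos hτ (height_pos h₀) (height_pos h₁)) ?_)
  have := convex_comb_pos hs one_pos
    (div_pos (height_pos hh) (convex_comb_pos hτ (height_pos h₂) (height_pos h₃)))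
  simpa using this

theorem interp_zero {s : ℝ} {v₀ v₁ m₀ m₁ : E × ℝ} (h₀ : Upper v₀) (h₂ : Upper m₀) :
    interp 0 s v₀ v₁ m₀ m₁ m₀ = v₀ := by
  have := (height_pos h₂).ne'
  simp [interp, this, unchart_height h₀]

theorem interp_one {s : ℝ} {v₀ v₁ m₀ m₁ : E × ℝ} (h₀ : Upper v₁) (h₂ : Upper m₁) :
    interp 1 s v₀ v₁ m₀ m₁ m₁ = v₁ := by
  have := (height_pos h₂).ne'
  simp [interp, this, unchart_height h₀]

theorem interp_end {τ : ℝ} (hτ : τ ∈ Icc (0 : ℝ) 1) {m₀ m₁ h : E × ℝ} (h₀ : Upper m₀)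
    (h₁ : Upper m₁) (hh : Upper h) : interp τ 1 m₀ m₁ m₀ m₁ h = h := by
  have := (convex_comb_pos hτ (height_pos h₀) (height_pos h₁)).ne'
  simp only [interp, one_smul, add_sub_cancel, sub_self, zero_add, one_mul]
  rw [mul_div_cancel₀ _ this, unchart_height hh]

theorem interp_start {τ : ℝ} {b m₀ m₁ h : E × ℝ} (hb : Upper b) :
    interp τ 0 b b m₀ m₁ h = b := by
  simp only [interp, zero_smul, add_zero, sub_zero, zero_mul, mul_one]
  rw [← add_smul, ← add_mul, sub_add_cancel, one_smul, one_mul, unchart_height hb]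

theorem interp_self {τ s : ℝ} {b : E × ℝ} (hb : Upper b) :
    interp τ s b b b b b = b := by
  have := (height_pos hb).ne'
  simp only [interp]
  rw [← add_smul, ← add_mul, sub_add_cancel, one_smul, one_mul, sub_self, smul_zero, add_zero,
    div_self this, mul_one, sub_add_cancel, mul_one, unchart_height hb]

theorem continuousOn_interp {X : Type*} [TopologicalSpace X] {S : Set X} {τ s : X → ℝ}
    {v₀ v₁ m₀ m₁ h : X → E × ℝ} (hτ : ContinuousOn τ S) (hs : ContinuousOn s S)
    (c₀ : ContinuousOn v₀ S) (c₁ : ContinuousOn v₁ S) (c₂ : ContinuousOn m₀ S)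
    (c₃ : ContinuousOn m₁ S) (ch : ContinuousOn h S)
    (uτ : ∀ x ∈ S, τ x ∈ Icc (0 : ℝ) 1) (us : ∀ x ∈ S, s x ∈ Icc (0 : ℝ) 1)
    (u₀ : ∀ x ∈ S, Upper (v₀ x)) (u₁ : ∀ x ∈ S, Upper (v₁ x)) (u₂ : ∀ x ∈ S, Upper (m₀ x))
    (u₃ : ∀ x ∈ S, Upper (m₁ x)) (uh : ∀ x ∈ S, Upper (h x)) :
    ContinuousOn (fun x => interp (τ x) (s x) (v₀ x) (v₁ x) (m₀ x) (m₁ x) (h x)) S := by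
  have k₀ := continuous_height.comp_continuousOn c₀
  have k₁ := continuous_height.comp_continuousOn c₁
  have k₂ := continuous_height.comp_continuousOn c₂
  have k₃ := continuous_height.comp_continuousOn c₃
  have kh := continuous_height.comp_continuousOn ch
  simp only [Function.comp_def] at k₀ k₁ k₂ k₃ kh
  have pm : ∀ x ∈ S, (1 - τ x) * height (m₀ x) + τ x * height (m₁ x) ≠ 0 := fun x hx =>
    (convex_comb_pos (uτ x hx) (height_pos (u₂ x hx)) (height_pos (u₃ x hx))).ne'
  have kd : ContinuousOn (fun x => (1 - τ x) * height (m₀ x) + τ x * height (m₁ x)) S := by fun_prop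
  have kq := kh.div kd pm
  have kp : ContinuousOn (fun x => ((1 - τ x) * height (v₀ x) + τ x * height (v₁ x)) *
      ((1 - s x) + s x * (height (h x) / ((1 - τ x) * height (m₀ x) + τ x * height (m₁ x))))) S :=
    (((continuousOn_const.sub hτ).mul k₀).add (hτ.mul k₁)).mul
      ((continuousOn_const.sub hs).add (hs.mul kq))
  have pp : ∀ x ∈ S, ((1 - τ x) * height (v₀ x) + τ x * height (v₁ x)) *
      ((1 - s x) + s x * (height (h x) / ((1 - τ x) * height (m₀ x) + τ x * height (m₁ x)))) ≠ 0 :=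
    fun x hx => by
      refine (mul_pos (convex_comb_pos (uτ x hx) (height_pos (u₀ x hx)) (height_pos (u₁ x hx)))
        ?_).ne'
      have := convex_comb_pos (us x hx) one_pos (div_pos (height_pos (uh x hx))
        (convex_comb_pos (uτ x hx) (height_pos (u₂ x hx)) (height_pos (u₃ x hx))))
      simpa using this
  have kw : ContinuousOn (fun x => (1 - τ x) • (v₀ x).1 + τ x • (v₁ x).1 +
      s x • ((h x).1 - ((1 - τ x) • (m₀ x).1 + τ x • (m₁ x).1))) S := by fun_prop
  exact kw.prodMk ((kp.sub ((kw.norm.pow 2).div kp pp)).div_const 2)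

/-- Reflection in the last coordinate. -/
def mir (v : E × ℝ) : E × ℝ := (v.1, -v.2)

theorem continuous_mir : Continuous (mir : E × ℝ → E × ℝ) := by unfold mir; fun_prop

theorem mir_mir (v : E × ℝ) : mir (mir v) = v := by simp [mir]

theorem Lower.mir {v : E × ℝ} (h : Lower v) : Upper (mir v) := by
  simpa [Lower, Upper, PontryaginStem.mir] using h

theorem mir_ne_zero {v : E × ℝ} (h : v ≠ 0) : mir v ≠ 0 := by
  intro h'
  apply h
  rw [← mir_mir v, h']
  simp [mir]

/-- The point of the middle slice with the same tail. -/
noncomputable def midPt {k : ℕ} (y : Fin (k + 1) → ℝ) : Fin (k + 1) → ℝ :=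
  Fin.cons (1 / 2) (Fin.tail y)

theorem continuous_cons {k : ℕ} :
    Continuous fun p : ℝ × (Fin k → ℝ) => (Fin.cons p.1 p.2 : Fin (k + 1) → ℝ) := by
  refine continuous_pi fun i => ?_
  refine Fin.cases ?_ (fun j => ?_) i
  · simpa using continuous_fst
  · simp only [Fin.cons_succ]; fun_prop

theorem continuous_tail {k : ℕ} :
    Continuous fun y : Fin (k + 1) → ℝ => (Fin.tail y : Fin k → ℝ) :=
  continuous_pi fun i => continuous_apply i.succ

theorem continuous_midPt {k : ℕ} : Continuous (midPt : (Fin (k + 1) → ℝ) → _) :=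
  continuous_cons.comp (continuous_const.prodMk continuous_tail)

theorem cons_mem {k : ℕ} {t : ℝ} {z : Fin k → ℝ} (ht : t ∈ Icc (0 : ℝ) 1)
    (hz : z ∈ Icc (0 : Fin k → ℝ) 1) : (Fin.cons t z : Fin (k + 1) → ℝ) ∈ Icc 0 1 := by
  constructor
  · intro i; refine Fin.cases ?_ (fun j => ?_) i
    · simpa using ht.1
    · simpa using hz.1 j
  · intro i; refine Fin.cases ?_ (fun j => ?_) i
    · simpa using ht.2
    · simpa using hz.2 j

theorem tail_mem {k : ℕ} {y : Fin (k + 1) → ℝ} (hy : y ∈ Icc (0 : Fin (k + 1) → ℝ) 1) :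
    Fin.tail y ∈ Icc (0 : Fin k → ℝ) 1 :=
  ⟨fun i => hy.1 i.succ, fun i => hy.2 i.succ⟩

theorem head_mem {k : ℕ} {y : Fin (k + 1) → ℝ} (hy : y ∈ Icc (0 : Fin (k + 1) → ℝ) 1) :
    y 0 ∈ Icc (0 : ℝ) 1 := ⟨hy.1 0, hy.2 0⟩

theorem half_mem : (1 / 2 : ℝ) ∈ Icc (0 : ℝ) 1 := by constructor <;> norm_num

theorem midPt_mem {k : ℕ} {y : Fin (k + 1) → ℝ} (hy : y ∈ Icc (0 : Fin (k + 1) → ℝ) 1) :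
    midPt y ∈ Icc (0 : Fin (k + 1) → ℝ) 1 := cons_mem half_mem (tail_mem hy)

theorem midPt_eq {k : ℕ} {y : Fin (k + 1) → ℝ} (hy : y 0 = 1 / 2) : midPt y = y := by
  unfold midPt; rw [← hy]; exact Fin.cons_self_tail y

/-- A loop which is in the complement of the lower ray on the first half of the cube, and in the
complement of the upper ray on the second half. -/
structure IsSplit {k : ℕ} (F : (Fin (k + 1) → ℝ) → E × ℝ) : Prop where
  upper : ∀ y ∈ Icc (0 : Fin (k + 1) → ℝ) 1, y 0 ≤ 1 / 2 → Upper (F y)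
  lower : ∀ y ∈ Icc (0 : Fin (k + 1) → ℝ) 1, 1 / 2 ≤ y 0 → Lower (F y)

/-- Two split loops with homotopic middle slices are homotopic. -/
theorem cls_eq_of_isSplit {k : ℕ} {x : E} {b : {v : E × ℝ // v ≠ 0}} (hb : b.1 = (x, 0))
    {F₀ F₁ : (Fin (k + 1) → ℝ) → E × ℝ} (l₀ : IsLoop b.1 F₀) (l₁ : IsLoop b.1 F₁)
    (s₀ : IsSplit F₀) (s₁ : IsSplit F₁) {m : ℝ → (Fin k → ℝ) → E}
    (hm : IsHtpy x (fun z => (F₀ (Fin.cons (1 / 2) z)).1)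
      (fun z => (F₁ (Fin.cons (1 / 2) z)).1) m) :
    l₀.cls = l₁.cls := by
  have hx : x ≠ 0 := fun h => b.2 (by rw [hb, h]; rfl)
  let h : ℝ → (Fin (k + 1) → ℝ) → E × ℝ := fun τ y =>
    (m τ (Fin.tail y), (1 - τ) * (F₀ (midPt y)).2 + τ * (F₁ (midPt y)).2)
  have hne : ∀ τ ∈ Icc (0 : ℝ) 1, ∀ y ∈ Icc (0 : Fin (k + 1) → ℝ) 1, (h τ y).1 ≠ 0 :=
    fun τ hτ y hy => hm.ne τ hτ _ (tail_mem hy)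
  have mid0 : ∀ y : Fin (k + 1) → ℝ, midPt y 0 = 1 / 2 := fun y => rfl
  have hh0 : ∀ y ∈ Icc (0 : Fin (k + 1) → ℝ) 1, h 0 y = F₀ (midPt y) := fun y hy => by
    refine Prod.ext ?_ ?_
    · exact hm.zero _ (tail_mem hy)
    · simp [h]
  have hh1 : ∀ y ∈ Icc (0 : Fin (k + 1) → ℝ) 1, h 1 y = F₁ (midPt y) := fun y hy => by
    refine Prod.ext ?_ ?_
    · exact hm.one _ (tail_mem hy)
    · simp [h]
  let L : ℝ → (Fin (k + 1) → ℝ) → E × ℝ := fun τ y =>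
    interp τ (2 * y 0) (F₀ y) (F₁ y) (F₀ (midPt y)) (F₁ (midPt y)) (h τ y)
  let R : ℝ → (Fin (k + 1) → ℝ) → E × ℝ := fun τ y =>
    mir (interp τ (2 - 2 * y 0) (mir (F₀ y)) (mir (F₁ y)) (mir (F₀ (midPt y)))
      (mir (F₁ (midPt y))) (mir (h τ y)))
  have bup : Upper b.1 := by rw [hb]; exact Or.inl hx
  have blo : Lower b.1 := by rw [hb]; exact Or.inl hx
  have sbase : ∀ τ ∈ Icc (0 : ℝ) 1, ∀ y ∈ Icc (0 : Fin (k + 1) → ℝ) 1, ∀ j : Fin k,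
      (y j.succ = 0 ∨ y j.succ = 1) → F₀ (midPt y) = b.1 ∧ F₁ (midPt y) = b.1 ∧ h τ y = b.1 := by
    intro τ hτ y hy j hj
    have hj' : midPt y j.succ = 0 ∨ midPt y j.succ = 1 := by simpa [midPt, Fin.tail] using hj
    have e0 := l₀.bd _ (midPt_mem hy) j.succ hj'
    have e1 := l₁.bd _ (midPt_mem hy) j.succ hj'
    refine ⟨e0, e1, ?_⟩
    simp only [h, e0, e1, hm.bd τ hτ _ (tail_mem hy) j hj, hb]
    simp
  refine IsHtpy.cls_eq (H := fun τ y => if y 0 ≤ 1 / 2 then L τ y else R τ y)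
    ⟨?_, ?_, ?_, ?_, ?_⟩ l₀ l₁
  · have cF₀ : ContinuousOn (fun p : ℝ × (Fin (k + 1) → ℝ) => F₀ p.2) (Icc 0 1 ×ˢ Icc 0 1) :=
      l₀.cont.comp continuousOn_snd fun p hp => hp.2
    have cF₁ : ContinuousOn (fun p : ℝ × (Fin (k + 1) → ℝ) => F₁ p.2) (Icc 0 1 ×ˢ Icc 0 1) :=
      l₁.cont.comp continuousOn_snd fun p hp => hp.2
    have cm := continuous_midPt (k := k)
    have cM₀ : ContinuousOn (fun p : ℝ × (Fin (k + 1) → ℝ) => F₀ (midPt p.2))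
        (Icc 0 1 ×ˢ Icc 0 1) :=
      l₀.cont.comp (cm.comp continuous_snd).continuousOn fun p hp => midPt_mem hp.2
    have cM₁ : ContinuousOn (fun p : ℝ × (Fin (k + 1) → ℝ) => F₁ (midPt p.2))
        (Icc 0 1 ×ˢ Icc 0 1) :=
      l₁.cont.comp (cm.comp continuous_snd).continuousOn fun p hp => midPt_mem hp.2
    have ch : ContinuousOn (fun p : ℝ × (Fin (k + 1) → ℝ) => h p.1 p.2) (Icc 0 1 ×ˢ Icc 0 1) := by
      refine ContinuousOn.prodMk ?_ ?_
      · exact hm.cont.comp (f := fun p : ℝ × (Fin (k + 1) → ℝ) => (p.1, Fin.tail p.2))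
          (continuous_fst.prodMk (continuous_tail.comp continuous_snd)).continuousOn
          fun p hp => ⟨hp.1, tail_mem hp.2⟩
      · exact ((continuousOn_const.sub continuousOn_fst).mul cM₀.snd).add
          (continuousOn_fst.mul cM₁.snd)
    have i1 : Icc (0 : ℝ) 1 ×ˢ Icc (0 : Fin (k + 1) → ℝ) 1 ∩ {p | p.2 0 ≤ 1 / 2} ⊆
      Icc (0 : ℝ) 1 ×ˢ Icc (0 : Fin (k + 1) → ℝ) 1 := inter_subset_left
    have i2 : Icc (0 : ℝ) 1 ×ˢ Icc (0 : Fin (k + 1) → ℝ) 1 ∩ {p | 1 / 2 ≤ p.2 0} ⊆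
      Icc (0 : ℝ) 1 ×ˢ Icc (0 : Fin (k + 1) → ℝ) 1 := inter_subset_left
    refine continuousOn_ite_le (φ := fun p : ℝ × (Fin (k + 1) → ℝ) => p.2 0) (by fun_prop) ?_ ?_ ?_
    · refine continuousOn_interp (by fun_prop) (by fun_prop) (cF₀.mono i1) (cF₁.mono i1)
        (cM₀.mono i1) (cM₁.mono i1) (ch.mono i1) (fun p hp => hp.1.1) (fun p hp => ?_)
        (fun p hp => s₀.upper _ hp.1.2 hp.2) (fun p hp => s₁.upper _ hp.1.2 hp.2)
        (fun p hp => s₀.upper _ (midPt_mem hp.1.2) (mid0 _).le)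
        (fun p hp => s₁.upper _ (midPt_mem hp.1.2) (mid0 _).le)
        (fun p hp => Or.inl (hne _ hp.1.1 _ hp.1.2))
      have h1 := (head_mem hp.1.2).1
      have h2 : p.2 0 ≤ 1 / 2 := hp.2
      exact ⟨by linarith, by linarith⟩
    · have cr := continuous_mir (E := E)
      refine cr.comp_continuousOn (continuousOn_interp (by fun_prop) (by fun_prop)
        (cr.comp_continuousOn (cF₀.mono i2)) (cr.comp_continuousOn (cF₁.mono i2))
        (cr.comp_continuousOn (cM₀.mono i2)) (cr.comp_continuousOn (cM₁.mono i2))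
        (cr.comp_continuousOn (ch.mono i2)) (fun p hp => hp.1.1) (fun p hp => ?_)
        (fun p hp => (s₀.lower _ hp.1.2 hp.2).mir) (fun p hp => (s₁.lower _ hp.1.2 hp.2).mir)
        (fun p hp => (s₀.lower _ (midPt_mem hp.1.2) (mid0 _).ge).mir)
        (fun p hp => (s₁.lower _ (midPt_mem hp.1.2) (mid0 _).ge).mir)
        (fun p hp => Or.inl (hne _ hp.1.1 _ hp.1.2)))
      have h1 := (head_mem hp.1.2).2
      have h2 : 1 / 2 ≤ p.2 0 := hp.2
      exact ⟨by linarith, by linarith⟩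
    · rintro ⟨τ, y⟩ ⟨hτ, hy⟩ hc
      simp only at hc hτ hy
      simp only [L, R, midPt_eq hc]
      have e1 : 2 * y 0 = 1 := by rw [hc]; norm_num
      have e2 : 2 - 2 * y 0 = 1 := by rw [hc]; norm_num
      rw [e2, e1, interp_end hτ (s₀.upper _ hy hc.le) (s₁.upper _ hy hc.le)
        (Or.inl (hne _ hτ _ hy)), interp_end hτ (s₀.lower _ hy hc.ge).mir
        (s₁.lower _ hy hc.ge).mir (show Upper (mir (h τ y)) from Or.inl (hne _ hτ _ hy)), mir_mir]
  · intro τ hτ y hy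
    have hy0 := head_mem hy
    split_ifs with hc
    · exact interp_ne_zero hτ ⟨by linarith [hy0.1], by linarith⟩ (s₀.upper _ hy hc)
        (s₁.upper _ hy hc) (s₀.upper _ (midPt_mem hy) (mid0 _).le)
        (s₁.upper _ (midPt_mem hy) (mid0 _).le) (Or.inl (hne _ hτ _ hy))
    · have hc := (not_le.1 hc).le
      exact mir_ne_zero (interp_ne_zero hτ ⟨by linarith [hy0.2], by linarith⟩
        (s₀.lower _ hy hc).mir (s₁.lower _ hy hc).mir (s₀.lower _ (midPt_mem hy) (mid0 _).ge).mir
        (s₁.lower _ (midPt_mem hy) (mid0 _).ge).mir (Or.inl (hne _ hτ _ hy)))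
  · intro τ hτ y hy i hi
    have e0 := l₀.bd y hy i hi
    have e1 := l₁.bd y hy i hi
    simp only [L, R, e0, e1]
    revert hi
    refine Fin.cases (fun hi => ?_) (fun j hj => ?_) i
    · rcases hi with hi | hi
      · rw [if_pos (by rw [hi]; norm_num), hi, mul_zero, interp_start bup]
      · rw [if_neg (by rw [hi]; norm_num), hi, mul_one, sub_self, interp_start blo.mir, mir_mir]
    · obtain ⟨a1, a2, a3⟩ := sbase τ hτ y hy j hj
      rw [a1, a2, a3, interp_self bup, interp_self blo.mir, mir_mir, ite_self]
  · intro y hy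
    split_ifs with hc
    · simp only [L, hh0 y hy]
      exact interp_zero (s₀.upper _ hy hc) (s₀.upper _ (midPt_mem hy) (mid0 _).le)
    · have hc := (not_le.1 hc).le
      simp only [R, hh0 y hy]
      rw [interp_zero (s₀.lower _ hy hc).mir (s₀.lower _ (midPt_mem hy) (mid0 _).ge).mir, mir_mir]
  · intro y hy
    split_ifs with hc
    · simp only [L, hh1 y hy]
      exact interp_one (s₁.upper _ hy hc) (s₁.upper _ (midPt_mem hy) (mid0 _).le)
    · have hc := (not_le.1 hc).le
      simp only [R, hh1 y hy]
      rw [interp_one (s₁.lower _ hy hc).mir (s₁.lower _ (midPt_mem hy) (mid0 _).ge).mir, mir_mir]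

end Ladder

section Suspension

variable {E : Type*} [NormedAddCommGroup E] [NormedSpace ℝ E] {k : ℕ}

/-- The reduced suspension coordinate: at time `t` the point `v` is moved along a path from the
base point through `v` to the base point. -/
noncomputable def suspPt (x : E) (t : ℝ) (v : E) : E × ℝ :=
  (|1 - 2 * t| • x + (1 - |1 - 2 * t|) • v, (1 - |1 - 2 * t|) * (1 - 2 * t) * ‖v - x‖)

theorem continuous_suspPt (x : E) : Continuous fun p : ℝ × E => suspPt x p.1 p.2 := by
  unfold suspPt; fun_prop

theorem suspPt_zero (x v : E) : suspPt x 0 v = (x, 0) := by simp [suspPt]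

theorem suspPt_one (x v : E) : suspPt x 1 v = (x, 0) := by norm_num [suspPt]

theorem suspPt_base (x : E) (t : ℝ) : suspPt x t x = (x, 0) := by
  simp [suspPt, ← add_smul]

theorem suspPt_half (x v : E) : suspPt x (1 / 2) v = (v, 0) := by simp [suspPt]

theorem abs_coord_le {t : ℝ} (ht : t ∈ Icc (0 : ℝ) 1) : |1 - 2 * t| ≤ 1 :=
  abs_le.2 ⟨by linarith [ht.2], by linarith [ht.1]⟩

theorem suspPt_fst_ne_zero {x v : E} {t : ℝ} (hx : x ≠ 0) (hv : v ≠ 0)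
    (h : (suspPt x t v).2 = 0) : (suspPt x t v).1 ≠ 0 := by
  simp only [suspPt] at h ⊢
  rcases mul_eq_zero.1 h with h | h
  · rcases mul_eq_zero.1 h with h | h
    · rw [h, show |1 - 2 * t| = 1 by linarith]; simpa using hx
    · rw [h]; simpa using hv
  · have : v = x := sub_eq_zero.1 (norm_eq_zero.1 h)
    rw [this, ← add_smul]; simpa using hx

theorem suspPt_ne_zero {x v : E} {t : ℝ} (hx : x ≠ 0) (hv : v ≠ 0) :
    suspPt x t v ≠ 0 := fun h =>
  suspPt_fst_ne_zero hx hv (congrArg Prod.snd h) (congrArg Prod.fst h)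

theorem suspPt_snd_nonneg (x v : E) {t : ℝ} (ht : t ∈ Icc (0 : ℝ) 1) (h : t ≤ 1 / 2) :
    0 ≤ (suspPt x t v).2 :=
  mul_nonneg (mul_nonneg (by linarith [abs_coord_le ht]) (by linarith)) (norm_nonneg _)

theorem suspPt_snd_nonpos (x v : E) {t : ℝ} (ht : t ∈ Icc (0 : ℝ) 1) (h : 1 / 2 ≤ t) :
    (suspPt x t v).2 ≤ 0 :=
  mul_nonpos_of_nonpos_of_nonneg
    (mul_nonpos_of_nonneg_of_nonpos (by linarith [abs_coord_le ht]) (by linarith)) (norm_nonneg _)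

theorem suspPt_upper {x v : E} {t : ℝ} (hx : x ≠ 0) (hv : v ≠ 0) (ht : t ∈ Icc (0 : ℝ) 1)
    (h : t ≤ 1 / 2) : Upper (suspPt x t v) := by
  rcases (suspPt_snd_nonneg x v ht h).eq_or_lt with h' | h'
  · exact Or.inl (suspPt_fst_ne_zero hx hv h'.symm)
  · exact Or.inr h'

theorem suspPt_lower {x v : E} {t : ℝ} (hx : x ≠ 0) (hv : v ≠ 0) (ht : t ∈ Icc (0 : ℝ) 1)
    (h : 1 / 2 ≤ t) : Lower (suspPt x t v) := by
  rcases (suspPt_snd_nonpos x v ht h).eq_or_lt with h' | h'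
  · exact Or.inl (suspPt_fst_ne_zero hx hv h')
  · exact Or.inr h'

/-- The suspension of a map on the real cube. -/
noncomputable def susp (x : E) (f : (Fin k → ℝ) → E) (y : Fin (k + 1) → ℝ) : E × ℝ :=
  suspPt x (y 0) (f (Fin.tail y))

/-- The base point of the suspension. -/
def suspBase (x : {v : E // v ≠ 0}) : {v : E × ℝ // v ≠ 0} :=
  ⟨(x.1, 0), fun h => x.2 (congrArg Prod.fst h)⟩

theorem IsHtpy.susp {x : E} (hx : x ≠ 0) {f g : (Fin k → ℝ) → E} {H : ℝ → (Fin k → ℝ) → E}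
    (hH : IsHtpy x f g H) :
    IsHtpy (x, (0 : ℝ)) (susp x f) (susp x g) fun τ => PontryaginStem.susp x (H τ) := by
  refine ⟨?_, fun τ hτ y hy => suspPt_ne_zero hx (hH.ne τ hτ _ (tail_mem hy)), ?_,
    fun y hy => ?_, fun y hy => ?_⟩
  · refine (continuous_suspPt x).comp_continuousOn
      (f := fun p : ℝ × (Fin (k + 1) → ℝ) => (p.2 0, H p.1 (Fin.tail p.2))) ?_
    refine ContinuousOn.prodMk (by fun_prop) ?_
    exact hH.cont.comp (f := fun p : ℝ × (Fin (k + 1) → ℝ) => (p.1, Fin.tail p.2))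
          (continuous_fst.prodMk (continuous_tail.comp continuous_snd)).continuousOn
          fun p hp => ⟨hp.1, tail_mem hp.2⟩
  · intro τ hτ y hy i
    refine Fin.cases (fun hi => ?_) (fun j hj => ?_) i
    · rcases hi with hi | hi
      · simp only [PontryaginStem.susp, hi, suspPt_zero]
      · simp only [PontryaginStem.susp, hi, suspPt_one]
    · simp only [PontryaginStem.susp]
      rw [hH.bd τ hτ _ (tail_mem hy) j hj, suspPt_base]
  · simp only [PontryaginStem.susp]; rw [hH.zero _ (tail_mem hy)]
  · simp only [PontryaginStem.susp]; rw [hH.one _ (tail_mem hy)]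

theorem IsLoop.htpy_refl {x : E} {f : (Fin k → ℝ) → E} (hf : IsLoop x f) :
    IsHtpy x f f fun _ => f :=
  ⟨hf.cont.comp continuousOn_snd fun _ hp => hp.2, fun _ _ => hf.ne, fun _ _ => hf.bd,
    fun _ _ => rfl, fun _ _ => rfl⟩

theorem IsLoop.susp {x : {v : E // v ≠ 0}} {f : (Fin k → ℝ) → E} (hf : IsLoop x.1 f) :
    IsLoop (suspBase x).1 (susp x.1 f) :=
  (hf.htpy_refl.susp x.2).isLoop_left

theorem IsLoop.isSplit_susp {x : E} (hx : x ≠ 0) {f : (Fin k → ℝ) → E} (hf : IsLoop x f) :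
    IsSplit (PontryaginStem.susp x f) :=
  ⟨fun _ hy h => suspPt_upper hx (hf.ne _ (tail_mem hy)) (head_mem hy) h,
    fun _ hy h => suspPt_lower hx (hf.ne _ (tail_mem hy)) (head_mem hy) h⟩

theorem susp_cls_eq {x : {v : E // v ≠ 0}} {f g : (Fin k → ℝ) → E} {hf : IsLoop x.1 f}
    {hg : IsLoop x.1 g} (h : hf.cls = hg.cls) : hf.susp.cls = hg.susp.cls := by
  obtain ⟨H, hH, -⟩ := exists_htpy h
  exact (hH.susp x.2).cls_eq _ _

theorem susp_cat (x : E) (i : Fin k) (f g : (Fin k → ℝ) → E) :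
    susp x (cat i f g) = cat i.succ (susp x f) (susp x g) := by
  funext y
  simp only [susp, cat, Fin.tail_update_succ]
  rw [Function.update_of_ne (Fin.succ_ne_zero i).symm,
    Function.update_of_ne (Fin.succ_ne_zero i).symm]
  change suspPt x (y 0) (if y i.succ ≤ 1 / 2 then _ else _) = _
  split_ifs <;> rfl

/-- The suspension homomorphism. -/
noncomputable def suspHom (x : {v : E // v ≠ 0}) :
    PG (k + 1) E x →* PG (k + 2) (E × ℝ) (suspBase x) :=
  MonoidHom.mk' (fun a => (exists_loop a).choose_spec.choose.susp.cls) (by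
    intro a b
    have ha := (exists_loop a).choose_spec.choose_spec.1
    have hb := (exists_loop b).choose_spec.choose_spec.1
    have hab := (exists_loop (a * b)).choose_spec.choose_spec.1
    set la := (exists_loop a).choose_spec.choose
    set lb := (exists_loop b).choose_spec.choose
    have h2 := isLoop_cat 0 lb la
    have h1 : (exists_loop (a * b)).choose_spec.choose.cls = h2.cls := by
      rw [hab, cls_cat 0 lb la h2, ha, hb]
    rw [susp_cls_eq h1,
      ← cls_cat (Fin.succ 0) lb.susp la.susp (isLoop_cat (Fin.succ 0) lb.susp la.susp)]
    exact IsLoop.cls_congr _ _ fun y _ => by rw [susp_cat])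

theorem suspHom_cls {x : {v : E // v ≠ 0}} {f : (Fin (k + 1) → ℝ) → E} (hf : IsLoop x.1 f) :
    suspHom x hf.cls = hf.susp.cls :=
  susp_cls_eq (exists_loop hf.cls).choose_spec.choose_spec.1

/-- The piecewise linear reparametrization of the interval that moves the midpoint to `c`. -/
noncomputable def reparam (c t : ℝ) : ℝ := 2 * c * min t (1 / 2) + 2 * (1 - c) * max (t - 1 / 2) 0

theorem continuous_reparam : Continuous fun p : ℝ × ℝ => reparam p.1 p.2 := by
  unfold reparam; fun_prop

theorem reparam_of_le {c t : ℝ} (h : t ≤ 1 / 2) : reparam c t = 2 * c * t := by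
  unfold reparam; rw [min_eq_left h, max_eq_right (by linarith)]; ring

theorem reparam_of_ge {c t : ℝ} (h : 1 / 2 ≤ t) : reparam c t = c + (1 - c) * (2 * t - 1) := by
  unfold reparam; rw [min_eq_right h, max_eq_left (by linarith)]; ring

theorem reparam_le {c t : ℝ} (hc : c ∈ Icc (0 : ℝ) 1) (h : t ≤ 1 / 2) : reparam c t ≤ c := by
  rw [reparam_of_le h]; nlinarith [hc.1]

theorem le_reparam {c t : ℝ} (hc : c ∈ Icc (0 : ℝ) 1) (h : 1 / 2 ≤ t) : c ≤ reparam c t := by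
  rw [reparam_of_ge h]; nlinarith [hc.2]

theorem reparam_mem {c t : ℝ} (hc : c ∈ Icc (0 : ℝ) 1) (ht : t ∈ Icc (0 : ℝ) 1) :
    reparam c t ∈ Icc (0 : ℝ) 1 := by
  rcases le_total t (1 / 2) with h | h
  · exact ⟨by rw [reparam_of_le h]; nlinarith [hc.1, ht.1], (reparam_le hc h).trans hc.2⟩
  · exact ⟨hc.1.trans (le_reparam hc h), by rw [reparam_of_ge h]; nlinarith [hc.2, ht.2]⟩

theorem segment_mem {τ a b : ℝ} (hτ : τ ∈ Icc (0 : ℝ) 1) (ha : a ∈ Icc (0 : ℝ) 1)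
    (hb : b ∈ Icc (0 : ℝ) 1) : (1 - τ) * a + τ * b ∈ Icc (0 : ℝ) 1 := by
  obtain ⟨h1, h2⟩ := hτ
  obtain ⟨h3, h4⟩ := ha
  obtain ⟨h5, h6⟩ := hb
  have := sub_nonneg.2 h2
  constructor
  · positivity
  · nlinarith

theorem ne_zero_of_upper {v : E × ℝ} (h : Upper v) : v ≠ 0 := by
  rintro rfl; simp [Upper] at h

theorem ne_zero_of_lower {v : E × ℝ} (h : Lower v) : v ≠ 0 := by
  rintro rfl; simp [Lower] at h

variable [FiniteDimensional ℝ E]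

theorem suspHom_surjective (x : {v : E // v ≠ 0}) (hdim : k + 3 < 2 * Module.finrank ℝ E) :
    Function.Surjective (suspHom (k := k) x) := by
  intro a
  obtain ⟨F, lF, rfl, hFc, hFn⟩ := exists_loop a
  have base2 : (suspBase x).1.2 = 0 := rfl
  obtain ⟨F', τ, hF'c, hτc, hN, h0, hτ, hU, hL⟩ := exists_cut
    (fun p : (Fin (k + 1) → ℝ) × ℝ => F (Fin.cons p.2 p.1))
    (hFc.comp (continuous_cons.comp (continuous_snd.prodMk continuous_fst))) (Icc 0 1) isCompact_Icc
    (fun p _ => hFn _)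
    (fun z hz => by
      rw [lF.bd _ (cons_mem ⟨le_rfl, zero_le_one⟩ hz) 0 (Or.inl rfl), base2])
    (fun z hz => by
      rw [lF.bd _ (cons_mem ⟨zero_le_one, le_rfl⟩ hz) 0 (Or.inr rfl), base2])
    (by simpa using hdim)
  have hF'ne : ∀ z ∈ Icc (0 : Fin (k + 1) → ℝ) 1, ∀ t ∈ Icc (0 : ℝ) 1, F' (z, t) ≠ 0 := by
    intro z hz t ht
    rcases le_total t (τ z) with h | h
    · exact ne_zero_of_upper (hU z hz t ht h)
    · exact ne_zero_of_lower (hL z hz t ht h)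
  have hF'b : ∀ z ∈ Icc (0 : Fin (k + 1) → ℝ) 1, ∀ t ∈ Icc (0 : ℝ) 1,
      F (Fin.cons t z) = (suspBase x).1 → F' (z, t) = (suspBase x).1 := by
    intro z hz t ht h
    rw [h0 (z, t) ⟨hz, ht⟩ (by simp only [h, base2])]
    exact h
  have hF's : ∀ z ∈ Icc (0 : Fin (k + 1) → ℝ) 1, ∀ j, (z j = 0 ∨ z j = 1) →
      ∀ t ∈ Icc (0 : ℝ) 1, F' (z, t) = (suspBase x).1 := fun z hz j hj t ht =>
    hF'b z hz t ht (lF.bd _ (cons_mem ht hz) j.succ (by simpa using hj))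
  have hF'e : ∀ z ∈ Icc (0 : Fin (k + 1) → ℝ) 1, ∀ t ∈ Icc (0 : ℝ) 1, (t = 0 ∨ t = 1) →
      F' (z, t) = (suspBase x).1 := fun z hz t ht hj =>
    hF'b z hz t ht (lF.bd _ (cons_mem ht hz) 0 (by simpa using hj))
  -- the straight-line homotopy to the perturbed map
  have hA : IsHtpy (suspBase x).1 F (fun y => F' (Fin.tail y, y 0))
      fun s y => (1 - s) • F y + s • F' (Fin.tail y, y 0) := by
    refine ⟨?_, ?_, ?_, fun y _ => by simp, fun y _ => by simp⟩
    · have := continuous_tail (k := k + 1)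
      exact Continuous.continuousOn (by fun_prop)
    · intro s hs y hy hcon
      have e2 : ((1 - s) • F y + s • F' (Fin.tail y, y 0)).2 = (F y).2 := by
        simp only [Prod.snd_add, Prod.smul_snd, hN, Fin.cons_self_tail, smul_eq_mul]; ring
      rw [hcon] at e2
      have e3 := h0 (Fin.tail y, y 0) ⟨tail_mem hy, head_mem hy⟩
        (by simpa [Fin.cons_self_tail] using e2.symm)
      simp only [Fin.cons_self_tail] at e3
      rw [e3, ← add_smul, sub_add_cancel, one_smul] at hcon
      exact hFn y hcon
    · intro s hs y hy i hi
      have e1 := lF.bd y hy i hi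
      have e2 := hF'b _ (tail_mem hy) _ (head_mem hy) (by rw [Fin.cons_self_tail, e1])
      rw [e1, e2, ← add_smul, sub_add_cancel, one_smul]
  have hB : IsHtpy (suspBase x).1 (fun y : Fin (k + 2) → ℝ => F' (Fin.tail y, y 0))
      (fun y => F' (Fin.tail y, reparam (τ (Fin.tail y)) (y 0)))
      fun s y => F' (Fin.tail y, (1 - s) * y 0 + s * reparam (τ (Fin.tail y)) (y 0)) := by
    refine ⟨?_, ?_, ?_, fun y _ => by simp, fun y _ => by simp⟩
    · have := continuous_tail (k := k + 1)
      have := continuous_reparam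
      exact Continuous.continuousOn (by fun_prop)
    · exact fun s hs y hy => hF'ne _ (tail_mem hy) _
        (segment_mem hs (head_mem hy) (reparam_mem (hτ _) (head_mem hy)))
    · intro s hs y hy i
      have hm := segment_mem hs (head_mem hy) (reparam_mem (hτ (Fin.tail y)) (head_mem hy))
      refine Fin.cases (fun hi => ?_) (fun j hj => ?_) i
      · refine hF'e _ (tail_mem hy) _ hm ?_
        rcases hi with hi | hi
        · left; rw [hi, reparam_of_le (by norm_num)]; ring
        · right; rw [hi, reparam_of_ge (by norm_num)]; ring
      · exact hF's _ (tail_mem hy) j hj _ hm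
  let g : (Fin (k + 1) → ℝ) → E := fun z => (F' (z, τ z)).1
  have lg : IsLoop x.1 g := by
    refine ⟨Continuous.continuousOn (by fun_prop), fun z hz h => ?_, fun z hz j hj => ?_⟩
    · have u1 := (hU z hz _ (hτ z) le_rfl).resolve_left (not_not.2 h)
      have u2 := (hL z hz _ (hτ z) le_rfl).resolve_left (not_not.2 h)
      exact lt_asymm u1 u2
    · exact congrArg Prod.fst (hF's z hz j hj _ (hτ z))
  refine ⟨lg.cls, ?_⟩
  rw [suspHom_cls lg, hA.cls_eq lF hA.isLoop_right, hB.cls_eq hA.isLoop_right hB.isLoop_right]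
  symm
  refine cls_eq_of_isSplit (x := x.1) rfl hB.isLoop_right lg.susp
    ⟨fun y hy h => hU _ (tail_mem hy) _ (reparam_mem (hτ _) (head_mem hy)) (reparam_le (hτ _) h),
      fun y hy h => hL _ (tail_mem hy) _ (reparam_mem (hτ _) (head_mem hy)) (le_reparam (hτ _) h)⟩
    (lg.isSplit_susp x.2) (m := fun _ => g) ?_
  have hr := lg.htpy_refl
  refine ⟨hr.cont, hr.ne, hr.bd, fun z hz => ?_, fun z hz => ?_⟩
  · simp only [Fin.tail_cons, Fin.cons_zero, reparam_of_le le_rfl, g]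
    congr 3; ring
  · simp only [susp, Fin.tail_cons, Fin.cons_zero, suspPt_half]

theorem suspHom_injective (x : {v : E // v ≠ 0}) (hdim : k + 4 < 2 * Module.finrank ℝ E) :
    Function.Injective (suspHom (k := k) x) := by
  intro a b hab
  obtain ⟨f, lf, rfl, -⟩ := exists_loop a
  obtain ⟨g, lg, rfl, -⟩ := exists_loop b
  rw [suspHom_cls lf, suspHom_cls lg] at hab
  obtain ⟨F, hF, hFc, hFn⟩ := exists_htpy hab
  have base2 : (suspBase x).1.2 = 0 := rfl
  have hK : IsCompact (Icc (0 : ℝ) 1 ×ˢ Icc (0 : Fin (k + 1) → ℝ) 1) :=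
    isCompact_Icc.prod isCompact_Icc
  obtain ⟨F', τ, hF'c, hτc, hN, h0, hτ, hU, hL⟩ := exists_cut
    (fun p : (ℝ × (Fin (k + 1) → ℝ)) × ℝ => F p.1.1 (Fin.cons p.2 p.1.2))
    (hFc.comp ((continuous_fst.comp continuous_fst).prodMk
      (continuous_cons.comp (continuous_snd.prodMk (continuous_snd.comp continuous_fst))))) _ hK
    (fun p _ => hFn _ _)
    (fun z hz => by
      rw [hF.bd _ hz.1 _ (cons_mem ⟨le_rfl, zero_le_one⟩ hz.2) 0 (Or.inl rfl), base2])
    (fun z hz => by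
      rw [hF.bd _ hz.1 _ (cons_mem ⟨zero_le_one, le_rfl⟩ hz.2) 0 (Or.inr rfl), base2])
    (by simp; omega)
  have hF's : ∀ s ∈ Icc (0 : ℝ) 1, ∀ z ∈ Icc (0 : Fin (k + 1) → ℝ) 1, ∀ j, (z j = 0 ∨ z j = 1) →
      ∀ t ∈ Icc (0 : ℝ) 1, (F' ((s, z), t)).1 = x.1 := fun s hs z hz j hj t ht => by
    have e := hF.bd s hs _ (cons_mem ht hz) j.succ (by simpa using hj)
    rw [h0 ((s, z), t) ⟨⟨hs, hz⟩, ht⟩ (by simp only [e, base2])]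
    simp only [e]; rfl
  have cut : ∀ s ∈ Icc (0 : ℝ) 1, ∀ z ∈ Icc (0 : Fin (k + 1) → ℝ) 1,
      (F' ((s, z), τ (s, z))).1 ≠ 0 := fun s hs z hz h => by
    have u1 := (hU (s, z) ⟨hs, hz⟩ _ (hτ _) le_rfl).resolve_left (not_not.2 h)
    have u2 := (hL (s, z) ⟨hs, hz⟩ _ (hτ _) le_rfl).resolve_left (not_not.2 h)
    exact lt_asymm u1 u2
  -- at an end of the homotopy, the cut may be moved to the middle slice
  have ends : ∀ s ∈ Icc (0 : ℝ) 1, ∀ (φ : (Fin (k + 1) → ℝ) → E), IsLoop x.1 φ →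
      (∀ y ∈ Icc (0 : Fin (k + 2) → ℝ) 1, F s y = susp x.1 φ y) →
      IsHtpy x.1 φ (fun z => (F' ((s, z), τ (s, z))).1)
        fun r z => (F' ((s, z), (1 - r) * (1 / 2) + r * τ (s, z))).1 := by
    intro s hs φ lφ hφ
    refine ⟨?_, ?_, ?_, ?_, fun z _ => by simp⟩
    · exact Continuous.continuousOn (by fun_prop)
    · intro r hr z hz h
      have hm := segment_mem hr half_mem (hτ (s, z))
      set t := (1 - r) * (1 / 2) + r * τ (s, z) with ht
      have e2 : (F' ((s, z), t)).2 = (suspPt x.1 t (φ z)).2 := by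
        rw [hN, hφ _ (cons_mem hm hz)]; simp [susp]
      rcases le_total (τ (s, z)) (1 / 2) with h3 | h3
      · have h4 : τ (s, z) ≤ t := by rw [ht]; nlinarith [hr.1, hr.2]
        have h5 : t ≤ 1 / 2 := by rw [ht]; nlinarith [hr.1, hr.2]
        have := (hL (s, z) ⟨hs, hz⟩ _ hm h4).resolve_left (not_not.2 h)
        rw [e2] at this
        exact absurd this (not_lt.2 (suspPt_snd_nonneg _ _ hm h5))
      · have h4 : t ≤ τ (s, z) := by rw [ht]; nlinarith [hr.1, hr.2]
        have h5 : 1 / 2 ≤ t := by rw [ht]; nlinarith [hr.1, hr.2]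
        have := (hU (s, z) ⟨hs, hz⟩ _ hm h4).resolve_left (not_not.2 h)
        rw [e2] at this
        exact absurd this (not_lt.2 (suspPt_snd_nonpos _ _ hm h5))
    · exact fun r hr z hz j hj => hF's s hs z hz j hj _ (segment_mem hr half_mem (hτ _))
    · intro z hz
      have e := hφ _ (cons_mem half_mem hz)
      simp only [susp, Fin.tail_cons, Fin.cons_zero, suspPt_half] at e
      have e' := h0 ((s, z), 1 / 2) ⟨⟨hs, hz⟩, half_mem⟩ (by simp only [e])
      simp only [sub_zero, one_mul, zero_mul, add_zero, e', e]
  have z0 : (0 : ℝ) ∈ Icc (0 : ℝ) 1 := ⟨le_rfl, zero_le_one⟩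
  have z1 : (1 : ℝ) ∈ Icc (0 : ℝ) 1 := ⟨zero_le_one, le_rfl⟩
  have H0 := ends 0 z0 f lf hF.zero
  have H1 := ends 1 z1 g lg hF.one
  have HM : IsHtpy x.1 (fun z => (F' ((0, z), τ (0, z))).1) (fun z => (F' ((1, z), τ (1, z))).1)
      fun s z => (F' ((s, z), τ (s, z))).1 :=
    ⟨Continuous.continuousOn (by fun_prop), cut, fun s hs z hz j hj => hF's s hs z hz j hj _ (hτ _),
      fun _ _ => rfl, fun _ _ => rfl⟩
  rw [H0.cls_eq lf H0.isLoop_right, HM.cls_eq H0.isLoop_right H1.isLoop_right,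
    H1.cls_eq lg H1.isLoop_right]

end Suspension

section Lifting

/-- Homotopy lifting along a map with a local transport function. -/
theorem exists_lift {P Q B : Type*} [TopologicalSpace P] [PseudoMetricSpace Q]
    [NormedAddCommGroup B] (π : P → B) (T : P → B → P)
    (hTc : ContinuousOn (fun z : P × B => T z.1 z.2) {z | ‖z.2 - π z.1‖ < ‖π z.1‖})
    (hπT : ∀ p b, ‖b - π p‖ < ‖π p‖ → π (T p b) = b) (hTT : ∀ p, π p ≠ 0 → T p (π p) = p)
    {K : Set Q} (hK : IsCompact K) (F : ℝ → Q → B)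
    (hF : ContinuousOn (fun z : ℝ × Q => F z.1 z.2) (Icc 0 1 ×ˢ K))
    (hF0 : ∀ τ ∈ Icc (0 : ℝ) 1, ∀ q ∈ K, F τ q ≠ 0) (l₀ : Q → P) (hl₀ : ContinuousOn l₀ K)
    (hπl₀ : ∀ q ∈ K, π (l₀ q) = F 0 q) :
    ∃ l : ℝ → Q → P, ContinuousOn (fun z : ℝ × Q => l z.1 z.2) (Icc 0 1 ×ˢ K) ∧
      (∀ τ ∈ Icc (0 : ℝ) 1, ∀ q ∈ K, π (l τ q) = F τ q) ∧ (∀ q ∈ K, l 0 q = l₀ q) ∧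
      ∀ q ∈ K, (∀ τ ∈ Icc (0 : ℝ) 1, F τ q = F 0 q) → ∀ τ ∈ Icc (0 : ℝ) 1, l τ q = l₀ q := by
  have hC : IsCompact (Icc (0 : ℝ) 1 ×ˢ K) := isCompact_Icc.prod hK
  obtain ⟨ε, hε, hεF⟩ : ∃ ε > 0, ∀ τ ∈ Icc (0 : ℝ) 1, ∀ q ∈ K, ε ≤ ‖F τ q‖ := by
    rcases K.eq_empty_or_nonempty with rfl | ⟨q, hq⟩
    · exact ⟨1, one_pos, fun τ _ q hq => hq.elim⟩
    · obtain ⟨z, hz, hm⟩ := hC.exists_isMinOn ⟨(0, q), ⟨⟨le_rfl, zero_le_one⟩, hq⟩⟩ hF.norm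
      exact ⟨_, norm_pos_iff.2 (hF0 z.1 hz.1 z.2 hz.2), fun τ hτ q hq =>
        hm (a := (τ, q)) ⟨hτ, hq⟩⟩
  obtain ⟨δ, hδ, hδF⟩ := Metric.uniformContinuousOn_iff.1
    (hC.uniformContinuousOn_of_continuous hF) ε hε
  obtain ⟨N, hN⟩ := exists_nat_one_div_lt hδ
  let M : ℝ := N + 1
  have hM : 0 < M := by positivity
  have mem : ∀ {τ : ℝ}, τ ∈ Icc (0 : ℝ) 1 → ∀ j : ℕ, min τ (j / M) ∈ Icc (0 : ℝ) 1 :=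
    fun hτ j => ⟨le_min hτ.1 (by positivity), (min_le_left _ _).trans hτ.2⟩
  have key : ∀ j : ℕ, ∃ l : ℝ → Q → P,
      ContinuousOn (fun z : ℝ × Q => l z.1 z.2) (Icc 0 1 ×ˢ K) ∧
      (∀ τ ∈ Icc (0 : ℝ) 1, ∀ q ∈ K, π (l τ q) = F (min τ (j / M)) q) ∧
      (∀ q ∈ K, l 0 q = l₀ q) ∧
      ∀ q ∈ K, (∀ τ ∈ Icc (0 : ℝ) 1, F τ q = F 0 q) → ∀ τ ∈ Icc (0 : ℝ) 1, l τ q = l₀ q := by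
    intro j
    induction j with
    | zero =>
      refine ⟨fun _ => l₀, hl₀.comp continuousOn_snd fun z hz => hz.2, fun τ hτ q hq => ?_,
        fun _ _ => rfl, fun _ _ _ _ _ => rfl⟩
      rw [hπl₀ q hq, Nat.cast_zero, zero_div, min_eq_right hτ.1]
    | succ j ih =>
      obtain ⟨l, hl, hπ, h0, hs⟩ := ih
      have hD : ∀ τ ∈ Icc (0 : ℝ) 1, ∀ q ∈ K,
          ‖F (min τ ((j + 1 : ℕ) / M)) q - π (l τ q)‖ < ‖π (l τ q)‖ := by
        intro τ hτ q hq
        rw [hπ τ hτ q hq, ← dist_eq_norm]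
        refine (hδF (min τ ((j + 1 : ℕ) / M), q) ⟨mem hτ _, hq⟩ (min τ (j / M), q)
          ⟨mem hτ _, hq⟩ ?_).trans_le (hεF _ (mem hτ _) q hq)
        rw [dist_prod_same_right, Real.dist_eq]
        calc |min τ ((j + 1 : ℕ) / M) - min τ (j / M)| ≤
            max |τ - τ| |((j + 1 : ℕ) : ℝ) / M - j / M| := abs_min_sub_min_le_max _ _ _ _
          _ = 1 / M := by
            rw [sub_self, abs_zero, show ((j + 1 : ℕ) : ℝ) / M - j / M = 1 / M by
              push_cast; ring, abs_of_nonneg (by positivity), max_eq_right (by positivity)]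
          _ < δ := hN
      refine ⟨fun τ q => T (l τ q) (F (min τ ((j + 1 : ℕ) / M)) q), ?_,
        fun τ hτ q hq => hπT _ _ (hD τ hτ q hq), fun q hq => ?_, fun q hq hst τ hτ => ?_⟩
      · refine hTc.comp (f := fun z : ℝ × Q => (l z.1 z.2, F (min z.1 ((j + 1 : ℕ) / M)) z.2))
          (hl.prodMk (hF.comp (f := fun z : ℝ × Q => (min z.1 ((j + 1 : ℕ) / M), z.2))
            (by fun_prop) fun z hz => ⟨mem hz.1 _, hz.2⟩)) fun z hz => hD _ hz.1 _ hz.2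
      · have h00 : (0 : ℝ) ∈ Icc (0 : ℝ) 1 := ⟨le_rfl, zero_le_one⟩
        have e : F (min 0 ((j + 1 : ℕ) / M)) q = π (l 0 q) := by
          rw [hπ 0 h00 q hq, min_eq_left (by positivity), min_eq_left (by positivity)]
        change T (l 0 q) (F (min 0 ((j + 1 : ℕ) / M)) q) = _
        rw [e, hTT, h0 q hq]
        rw [← e]; exact hF0 _ (mem h00 _) q hq
      · have e : F (min τ ((j + 1 : ℕ) / M)) q = π (l τ q) := by
          rw [hπ τ hτ q hq, hst _ (mem hτ _), hst _ (mem hτ _)]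
        change T (l τ q) (F (min τ ((j + 1 : ℕ) / M)) q) = _
        rw [e, hTT, hs q hq hst τ hτ]
        rw [← e]; exact hF0 _ (mem hτ _) q hq
  obtain ⟨l, hl, hπ, h0, hs⟩ := key (N + 1)
  refine ⟨l, hl, fun τ hτ q hq => ?_, h0, hs⟩
  rw [hπ τ hτ q hq, min_eq_left]
  refine hτ.2.trans_eq ?_
  rw [eq_div_iff hM.ne']; simp [M]

/-- Transport for the complex exponential. -/
noncomputable def expTransport (θ b : ℂ) : ℂ := θ + Complex.log (b / Complex.exp θ)

theorem exists_exp_lift {Q : Type*} [PseudoMetricSpace Q]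
    {K : Set Q} (hK : IsCompact K) (F : ℝ → Q → ℂ)
    (hF : ContinuousOn (fun z : ℝ × Q => F z.1 z.2) (Icc 0 1 ×ˢ K))
    (hF0 : ∀ τ ∈ Icc (0 : ℝ) 1, ∀ q ∈ K, F τ q ≠ 0) (l₀ : Q → ℂ) (hl₀ : ContinuousOn l₀ K)
    (hπl₀ : ∀ q ∈ K, Complex.exp (l₀ q) = F 0 q) :
    ∃ l : ℝ → Q → ℂ, ContinuousOn (fun z : ℝ × Q => l z.1 z.2) (Icc 0 1 ×ˢ K) ∧
      (∀ τ ∈ Icc (0 : ℝ) 1, ∀ q ∈ K, Complex.exp (l τ q) = F τ q) ∧ (∀ q ∈ K, l 0 q = l₀ q) ∧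
      ∀ q ∈ K, (∀ τ ∈ Icc (0 : ℝ) 1, F τ q = F 0 q) → ∀ τ ∈ Icc (0 : ℝ) 1, l τ q = l₀ q := by
  have hs : ∀ θ b, ‖b - Complex.exp θ‖ < ‖Complex.exp θ‖ →
      b / Complex.exp θ ∈ Complex.slitPlane := fun θ b h => by
    have : ‖(b - Complex.exp θ) / Complex.exp θ‖ < 1 := by
      rw [norm_div, div_lt_one (norm_pos_iff.2 (Complex.exp_ne_zero θ))]; exact h
    have := Complex.mem_slitPlane_of_norm_lt_one this
    rwa [sub_div, div_self (Complex.exp_ne_zero θ), add_sub_cancel] at this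
  refine exists_lift Complex.exp expTransport ?_ ?_ ?_ hK F hF hF0 l₀ hl₀ hπl₀
  · unfold expTransport
    refine continuousOn_fst.add (ContinuousOn.clog ?_ fun z hz => hs _ _ hz)
    exact continuousOn_snd.div (Complex.continuous_exp.comp_continuousOn continuousOn_fst)
      fun z _ => Complex.exp_ne_zero _
  · intro θ b h
    unfold expTransport
    rw [Complex.exp_add, Complex.exp_log (Complex.slitPlane_ne_zero (hs _ _ h)),
      mul_div_cancel₀ _ (Complex.exp_ne_zero θ)]
  · intro θ _
    unfold expTransport
    rw [div_self (Complex.exp_ne_zero θ), Complex.log_one, add_zero]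

/-- The Hopf map. -/
noncomputable def hopf (v : ℂ × ℂ) : ℂ × ℝ :=
  (v.1 * (starRingEnd ℂ) v.2, (Complex.normSq v.1 - Complex.normSq v.2) / 2)

theorem continuous_hopf : Continuous hopf := by
  unfold hopf
  have := Complex.continuous_normSq
  have := Complex.continuous_conj
  fun_prop

/-- The Euclidean norm on the target of the Hopf map. -/
noncomputable def rad (b : ℂ × ℝ) : ℝ := √(Complex.normSq b.1 + b.2 ^ 2)

theorem continuous_rad : Continuous rad := by
  unfold rad
  have := Complex.continuous_normSq
  fun_prop

theorem rad_sq (b : ℂ × ℝ) : rad b ^ 2 = Complex.normSq b.1 + b.2 ^ 2 :=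
  Real.sq_sqrt (add_nonneg (Complex.normSq_nonneg _) (sq_nonneg _))

theorem rad_nonneg (b : ℂ × ℝ) : 0 ≤ rad b := Real.sqrt_nonneg _

theorem rad_hopf (v : ℂ × ℂ) : rad (hopf v) = (Complex.normSq v.1 + Complex.normSq v.2) / 2 := by
  have h1 := Complex.normSq_nonneg v.1
  have h2 := Complex.normSq_nonneg v.2
  rw [rad, Real.sqrt_eq_iff_mul_self_eq (add_nonneg (Complex.normSq_nonneg _) (sq_nonneg _))
    (by positivity)]
  simp only [hopf, map_mul, Complex.normSq_conj]
  ring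

theorem rad_pos {b : ℂ × ℝ} (hb : b ≠ 0) : 0 < rad b := by
  refine Real.sqrt_pos.2 ?_
  by_contra h
  have h1 := Complex.normSq_nonneg b.1
  have h2 := sq_nonneg b.2
  exact hb (Prod.ext (Complex.normSq_eq_zero.1 (by linarith))
    (pow_eq_zero_iff two_ne_zero |>.1 (by linarith)))

theorem hopf_ne_zero {v : ℂ × ℂ} (hv : v ≠ 0) : hopf v ≠ 0 := by
  intro h
  have h3 := rad_hopf v
  rw [h] at h3
  have h0 : rad 0 = 0 := by simp [rad]
  rw [h0] at h3
  have h1 := Complex.normSq_nonneg v.1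
  have h2 := Complex.normSq_nonneg v.2
  exact hv (Prod.ext (Complex.normSq_eq_zero.1 (by linarith))
    (Complex.normSq_eq_zero.1 (by linarith)))

/-- The squared length of the unnormalized transport for the Hopf map. -/
noncomputable def hopfWeight (p : ℂ × ℂ) (b : ℂ × ℝ) : ℝ :=
  (rad b + b.2) * Complex.normSq p.1 + (rad b - b.2) * Complex.normSq p.2 +
    2 * ((starRingEnd ℂ) p.1 * b.1 * p.2).re

/-- Transport for the Hopf map. -/
noncomputable def hopfTransport (p : ℂ × ℂ) (b : ℂ × ℝ) : ℂ × ℂ :=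
  (√(hopfWeight p b))⁻¹ • (((rad b + b.2 : ℝ) : ℂ) * p.1 + b.1 * p.2,
    (starRingEnd ℂ) b.1 * p.1 + ((rad b - b.2 : ℝ) : ℂ) * p.2)

theorem hopfWeight_pos {p : ℂ × ℂ} {b : ℂ × ℝ} (h : ‖b - hopf p‖ < ‖hopf p‖) :
    0 < hopfWeight p b := by
  by_contra hw
  have h0 : hopf p ≠ 0 := norm_pos_iff.1 ((norm_nonneg _).trans_lt h)
  have hr0 := rad_pos h0
  set r₀ := rad (hopf p)
  set r := rad b
  have hr : 0 ≤ r := rad_nonneg b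
  have e0 : r₀ = (Complex.normSq p.1 + Complex.normSq p.2) / 2 := rad_hopf p
  have e1 : r ^ 2 = _ := rad_sq b
  have e2 : r₀ ^ 2 = _ := rad_sq (hopf p)
  have hz : (r * (hopf p).1.re + r₀ * b.1.re) ^ 2 + (r * (hopf p).1.im + r₀ * b.1.im) ^ 2 +
      (r * (hopf p).2 + r₀ * b.2) ^ 2 = r * r₀ * hopfWeight p b := by
    have : hopfWeight p b = 2 * (r * r₀ + ((hopf p).1.re * b.1.re + (hopf p).1.im * b.1.im +
        (hopf p).2 * b.2)) := by
      rw [e0]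
      simp only [hopfWeight, hopf, Complex.mul_re, Complex.mul_im, Complex.conj_re,
        Complex.conj_im, r]
      ring
    rw [this]
    rw [Complex.normSq_apply] at e1 e2
    linear_combination (-r ^ 2) * e2 - r₀ ^ 2 * e1
  have hle : r * r₀ * hopfWeight p b ≤ 0 :=
    mul_nonpos_of_nonneg_of_nonpos (by positivity) (not_lt.1 hw)
  have z1 : r * (hopf p).1.re + r₀ * b.1.re = 0 := by
    refine pow_eq_zero_iff two_ne_zero |>.1 (le_antisymm ?_ (sq_nonneg _)); nlinarith
  have z2 : r * (hopf p).1.im + r₀ * b.1.im = 0 := by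
    refine pow_eq_zero_iff two_ne_zero |>.1 (le_antisymm ?_ (sq_nonneg _)); nlinarith
  have z3 : r * (hopf p).2 + r₀ * b.2 = 0 := by
    refine pow_eq_zero_iff two_ne_zero |>.1 (le_antisymm ?_ (sq_nonneg _)); nlinarith
  have hb : b = -(r / r₀) • hopf p := by
    refine Prod.ext (Complex.ext ?_ ?_) ?_
    · simp only [Prod.smul_fst, Complex.smul_re, smul_eq_mul]; field_simp; linarith
    · simp only [Prod.smul_fst, Complex.smul_im, smul_eq_mul]; field_simp; linarith
    · simp only [Prod.smul_snd, smul_eq_mul]; field_simp; linarith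
  have : b - hopf p = -((r / r₀ + 1) • hopf p) := by rw [hb]; module
  rw [this, norm_neg, norm_smul, Real.norm_of_nonneg (by positivity)] at h
  have := norm_nonneg (hopf p)
  have h4 : 0 ≤ r / r₀ := by positivity
  nlinarith

theorem hopf_hopfTransport {p : ℂ × ℂ} {b : ℂ × ℝ} (h : ‖b - hopf p‖ < ‖hopf p‖) :
    hopf (hopfTransport p b) = b := by
  have hw := hopfWeight_pos h
  have e1 := rad_sq b
  rw [Complex.normSq_apply] at e1
  have hs : (√(hopfWeight p b))⁻¹ * (√(hopfWeight p b))⁻¹ = (hopfWeight p b)⁻¹ := by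
    rw [← mul_inv, Real.mul_self_sqrt hw.le]
  set c := (√(hopfWeight p b))⁻¹
  set r := rad b
  have hw' : (hopfWeight p b)⁻¹ * hopfWeight p b = 1 := inv_mul_cancel₀ hw.ne'
  rw [← hs] at hw'
  simp only [hopfWeight, Complex.mul_re, Complex.mul_im, Complex.conj_re,
        Complex.conj_im, Complex.normSq_apply] at hw'
  refine Prod.ext (Complex.ext ?_ ?_) ?_
  all_goals
    simp only [hopfTransport, hopf, Complex.normSq_apply, Prod.smul_mk, Complex.mul_re,
      Complex.mul_im, Complex.conj_re,
        Complex.conj_im, Complex.add_re, Complex.add_im, Complex.smul_re, Complex.smul_im,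
        Complex.ofReal_re, Complex.ofReal_im, smul_eq_mul]
  · linear_combination c * c * (p.1.re * p.2.re + p.1.im * p.2.im) * e1 + b.1.re * hw'
  · linear_combination c * c * (p.1.im * p.2.re - p.1.re * p.2.im) * e1 + b.1.im * hw'
  · linear_combination c * c * (p.1.re * p.1.re + p.1.im * p.1.im - p.2.re * p.2.re -
      p.2.im * p.2.im) / 2 * e1 + b.2 * hw'

theorem hopfTransport_hopf {p : ℂ × ℂ} (h : hopf p ≠ 0) : hopfTransport p (hopf p) = p := by
  have hr := rad_pos h
  have e := rad_hopf p
  have hw : hopfWeight p (hopf p) = (2 * rad (hopf p)) ^ 2 := by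
    rw [hopfWeight, e]
    simp only [hopf, Complex.mul_re, Complex.mul_im, Complex.conj_re,
        Complex.conj_im, Complex.normSq_apply]
    ring
  rw [hopfTransport, hw, Real.sqrt_sq (by positivity), inv_smul_eq_iff₀ (by positivity), e]
  refine Prod.ext (Complex.ext ?_ ?_) (Complex.ext ?_ ?_)
  all_goals
    simp [hopf, Complex.normSq_apply]
    ring

theorem exists_hopf_lift {Q : Type*} [PseudoMetricSpace Q]
    {K : Set Q} (hK : IsCompact K) (F : ℝ → Q → ℂ × ℝ)
    (hF : ContinuousOn (fun z : ℝ × Q => F z.1 z.2) (Icc 0 1 ×ˢ K))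
    (hF0 : ∀ τ ∈ Icc (0 : ℝ) 1, ∀ q ∈ K, F τ q ≠ 0) (l₀ : Q → ℂ × ℂ) (hl₀ : ContinuousOn l₀ K)
    (hπl₀ : ∀ q ∈ K, hopf (l₀ q) = F 0 q) :
    ∃ l : ℝ → Q → ℂ × ℂ, ContinuousOn (fun z : ℝ × Q => l z.1 z.2) (Icc 0 1 ×ˢ K) ∧
      (∀ τ ∈ Icc (0 : ℝ) 1, ∀ q ∈ K, hopf (l τ q) = F τ q) ∧ (∀ q ∈ K, l 0 q = l₀ q) ∧
      ∀ q ∈ K, (∀ τ ∈ Icc (0 : ℝ) 1, F τ q = F 0 q) → ∀ τ ∈ Icc (0 : ℝ) 1, l τ q = l₀ q := by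
  refine exists_lift hopf hopfTransport ?_ (fun p b h => hopf_hopfTransport h)
    (fun p h => hopfTransport_hopf h) hK F hF hF0 l₀ hl₀ hπl₀
  have := continuous_rad
  have := Complex.continuous_normSq
  have := Complex.continuous_conj
  have hw : Continuous fun z : (ℂ × ℂ) × (ℂ × ℝ) => hopfWeight z.1 z.2 := by
    unfold hopfWeight; fun_prop
  unfold hopfTransport
  refine ContinuousOn.smul (ContinuousOn.inv₀ hw.sqrt.continuousOn fun z hz => ?_) (by fun_prop)
  exact (Real.sqrt_pos.2 (hopfWeight_pos hz)).ne'

end Lifting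

section Circle

/-- The base point of the punctured complex plane. -/
def oneC : {v : ℂ // v ≠ 0} := ⟨1, one_ne_zero⟩

/-- The loop winding `k` times around the origin. -/
noncomputable def wind (k : ℤ) (y : Fin 1 → ℝ) : ℂ :=
  Complex.exp (k * (2 * Real.pi * Complex.I) * (y 0 : ℝ))

theorem exp_eq_one_const {X : Type*} [TopologicalSpace X] {S : Set X} (hS : IsPreconnected S)
    {g : X → ℂ} (hg : ContinuousOn g S) (h1 : ∀ x ∈ S, Complex.exp (g x) = 1) {x y : X}
    (hx : x ∈ S) (hy : y ∈ S) : g x = g y := by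
  have hpi := Real.two_pi_pos
  wlog hle : (g x).im ≤ (g y).im generalizing x y
  · exact (this hy hx (le_of_not_ge hle)).symm
  obtain ⟨m, hm⟩ := Complex.exp_eq_one_iff.1 (h1 x hx)
  obtain ⟨n, hn⟩ := Complex.exp_eq_one_iff.1 (h1 y hy)
  have im : ∀ j : ℤ, (j * (2 * Real.pi * Complex.I) : ℂ).im = j * (2 * Real.pi) := fun j => by
    simp
  rw [hm, hn, im, im] at hle
  have hmn : m ≤ n := by
    have := le_of_mul_le_mul_right hle hpi
    exact_mod_cast this
  rcases hmn.eq_or_lt with rfl | hlt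
  · rw [hm, hn]
  exfalso
  have hmem : ((m : ℝ) + 1 / 2) * (2 * Real.pi) ∈ Icc (g x).im (g y).im := by
    rw [hm, hn, im, im]
    have : (m : ℝ) + 1 ≤ n := by exact_mod_cast hlt
    constructor
    · nlinarith
    · nlinarith
  obtain ⟨z, hz, hz'⟩ := hS.intermediate_value hx hy
    (Complex.continuous_im.comp_continuousOn hg) hmem
  obtain ⟨l, hl⟩ := Complex.exp_eq_one_iff.1 (h1 z hz)
  replace hz' : (g z).im = _ := hz'
  rw [hl, im] at hz'
  have h2 : (l : ℝ) = m + 1 / 2 := mul_right_cancel₀ hpi.ne' hz'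
  have h3 : ((2 * l : ℤ) : ℝ) = ((2 * m + 1 : ℤ) : ℝ) := by push_cast; linarith
  have h4 : 2 * l = 2 * m + 1 := by exact_mod_cast h3
  omega

theorem continuous_wind (k : ℤ) : Continuous (wind k) := by
  unfold wind
  exact Complex.continuous_exp.comp (continuous_const.mul
    (Complex.continuous_ofReal.comp (continuous_apply 0)))

theorem isLoop_of_exp {f : (Fin 1 → ℝ) → ℂ} {θ : ℝ → ℂ} {m : ℤ} (hθ : ContinuousOn θ (Icc 0 1))
    (h0 : θ 0 = 0) (h1 : θ 1 = m * (2 * Real.pi * Complex.I))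
    (hf : ∀ y ∈ Icc (0 : Fin 1 → ℝ) 1, f y = Complex.exp (θ (y 0))) : IsLoop oneC.1 f := by
  refine IsLoop.congr (f := fun y => Complex.exp (θ (y 0))) ⟨?_, fun y _ => Complex.exp_ne_zero _,
    fun y hy i hi => ?_⟩ hf
  · exact Complex.continuous_exp.comp_continuousOn
      (hθ.comp (continuous_apply 0).continuousOn fun y hy => head_mem hy)
  · rw [Subsingleton.elim i 0] at hi
    change _ = (1 : ℂ)
    rcases hi with hi | hi
    · simp only [hi, h0, Complex.exp_zero]
    · simp only [hi, h1, Complex.exp_int_mul_two_pi_mul_I]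

theorem isLoop_wind (k : ℤ) : IsLoop oneC.1 (wind k) :=
  isLoop_of_exp (θ := fun t => k * (2 * Real.pi * Complex.I) * (t : ℝ)) (m := k)
    (by fun_prop) (by simp) (by simp) fun y _ => rfl

/-- Loops in the punctured plane are classified by the endpoint of a logarithm. -/
theorem cls_eq_wind {f : (Fin 1 → ℝ) → ℂ} {θ : ℝ → ℂ} {m : ℤ} (hθ : ContinuousOn θ (Icc 0 1))
    (h0 : θ 0 = 0) (h1 : θ 1 = m * (2 * Real.pi * Complex.I))
    (hf : ∀ y ∈ Icc (0 : Fin 1 → ℝ) 1, f y = Complex.exp (θ (y 0))) (l : IsLoop oneC.1 f) :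
    l.cls = (isLoop_wind m).cls := by
  have H : IsHtpy oneC.1 f (wind m) fun τ y => Complex.exp (((1 - τ : ℝ) : ℂ) * θ (y 0) +
      ((τ : ℝ) : ℂ) * (m * (2 * Real.pi * Complex.I) * (y 0 : ℝ))) := by
    refine ⟨?_, fun _ _ _ _ => Complex.exp_ne_zero _, fun τ hτ y hy i hi => ?_, fun y hy => ?_,
      fun y hy => ?_⟩
    · have : ContinuousOn (fun p : ℝ × (Fin 1 → ℝ) => θ (p.2 0)) (Icc 0 1 ×ˢ Icc 0 1) :=
        hθ.comp (f := fun p : ℝ × (Fin 1 → ℝ) => p.2 0) (by fun_prop) fun p hp => head_mem hp.2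
      have e1 : Continuous fun p : ℝ × (Fin 1 → ℝ) => ((1 - p.1 : ℝ) : ℂ) := by fun_prop
      have e2 : Continuous fun p : ℝ × (Fin 1 → ℝ) =>
        ((p.1 : ℝ) : ℂ) * (m * (2 * Real.pi * Complex.I) * (p.2 0 : ℝ)) := by fun_prop
      exact Complex.continuous_exp.comp_continuousOn
        ((e1.continuousOn.mul this).add e2.continuousOn)
    · rw [Subsingleton.elim i 0] at hi
      change _ = (1 : ℂ)
      rcases hi with hi | hi
      · simp only [hi, h0]; simp
      · simp only [hi, h1]
        rw [← Complex.exp_int_mul_two_pi_mul_I m]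
        congr 1; push_cast; ring
    · rw [hf y hy]; simp
    · simp [wind]
  exact H.cls_eq _ _

theorem exists_cls_eq_wind (a : PG 1 ℂ oneC) : ∃ m, a = (isLoop_wind m).cls := by
  obtain ⟨f, l, rfl, hfc, hfn⟩ := exists_loop a
  have m0 : (0 : ℝ) ∈ Icc (0 : ℝ) 1 := ⟨le_rfl, zero_le_one⟩
  have m1 : (1 : ℝ) ∈ Icc (0 : ℝ) 1 := ⟨zero_le_one, le_rfl⟩
  obtain ⟨θ, hθ, hexp, h0, -⟩ := exists_exp_lift (Q := Unit) (K := univ) isCompact_univ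
    (fun τ _ => f fun _ => τ) (by fun_prop) (fun _ _ _ _ => hfn _) (fun _ => 0)
    continuousOn_const (fun q _ => by
      rw [Complex.exp_zero]; exact (l.bd (fun _ => 0) ⟨le_rfl, zero_le_one⟩ 0 (Or.inl rfl)).symm)
  have e1 : Complex.exp (θ 1 ()) = 1 := by
    rw [hexp 1 m1 () trivial]; exact l.bd (fun _ => 1) ⟨zero_le_one, le_rfl⟩ 0 (Or.inr rfl)
  obtain ⟨m, hm⟩ := Complex.exp_eq_one_iff.1 e1
  refine ⟨m, cls_eq_wind (θ := fun t => θ t ()) ?_ (h0 () trivial) hm ?_ l⟩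
  · exact hθ.comp (f := fun t : ℝ => (t, ())) (by fun_prop) fun t ht => ⟨ht, trivial⟩
  · intro y hy
    rw [hexp _ (head_mem hy) () trivial]
    congr 1; funext i; rw [Subsingleton.elim i 0]

/-- The winding loops as a homomorphism. -/
noncomputable def windHom : Multiplicative ℤ →* PG 1 ℂ oneC :=
  MonoidHom.mk' (fun k => (isLoop_wind k.toAdd).cls) (by
    intro a b
    rw [← cls_cat 0 (isLoop_wind _) (isLoop_wind _) (isLoop_cat 0 (isLoop_wind _) (isLoop_wind _))]
    refine (cls_eq_wind (θ := fun t =>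
      2 * Real.pi * Complex.I * ((b.toAdd : ℂ) * ((min (2 * t) 1 : ℝ) : ℂ) +
      (a.toAdd : ℂ) * ((max (2 * t - 1) 0 : ℝ) : ℂ))) (by fun_prop) (by simp) ?_ ?_ _).symm
    · norm_num; ring
    · intro y hy
      simp only [cat]
      split_ifs with h
      · rw [min_eq_left (by linarith), max_eq_right (by linarith)]
        simp only [wind, Function.update_self]
        congr 1; push_cast; ring
      · rw [min_eq_right (by linarith), max_eq_left (by linarith)]
        simp only [wind, Function.update_self]
        rw [mul_add, Complex.exp_add, Complex.ofReal_one, mul_one,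
          mul_comm _ (b.toAdd : ℂ), Complex.exp_int_mul_two_pi_mul_I, one_mul]
        congr 1; push_cast; ring)

theorem windHom_apply (k : Multiplicative ℤ) : windHom k = (isLoop_wind k.toAdd).cls := rfl

theorem windHom_surjective : Function.Surjective windHom := fun a => by
  obtain ⟨m, rfl⟩ := exists_cls_eq_wind a
  exact ⟨Multiplicative.ofAdd m, rfl⟩

theorem isPreconnected_cube (k : ℕ) : IsPreconnected (Icc (0 : Fin k → ℝ) 1) :=
  (convex_Icc _ _).isPreconnected

theorem windHom_injective : Function.Injective windHom := by
  refine (injective_iff_map_eq_one _).2 fun k hk => ?_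
  rw [windHom_apply, ← cls_const oneC] at hk
  obtain ⟨H, hH, -⟩ := exists_htpy hk
  have m1 : (1 : ℝ) ∈ Icc (0 : ℝ) 1 := ⟨zero_le_one, le_rfl⟩
  obtain ⟨θ, hθ, hexp, h0, hs⟩ := exists_exp_lift (K := Icc (0 : Fin 1 → ℝ) 1) isCompact_Icc
    H hH.cont hH.ne (fun y => k.toAdd * (2 * Real.pi * Complex.I) * (y 0 : ℝ)) (by fun_prop)
    (fun y hy => (hH.zero y hy).symm)
  have c0 : (0 : Fin 1 → ℝ) ∈ Icc (0 : Fin 1 → ℝ) 1 := ⟨le_rfl, zero_le_one⟩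
  have c1 : (1 : Fin 1 → ℝ) ∈ Icc (0 : Fin 1 → ℝ) 1 := ⟨zero_le_one, le_rfl⟩
  have hst : ∀ y ∈ Icc (0 : Fin 1 → ℝ) 1, (y 0 = 0 ∨ y 0 = 1) →
      ∀ τ ∈ Icc (0 : ℝ) 1, H τ y = H 0 y :=
    fun y hy hy0 τ hτ => by
      rw [hH.bd τ hτ y hy 0 hy0, hH.bd 0 ⟨le_rfl, zero_le_one⟩ y hy 0 hy0]
  have key := exp_eq_one_const (isPreconnected_cube 1) (g := θ 1)
    (hθ.comp (f := fun y => ((1 : ℝ), y)) (by fun_prop) fun y hy => ⟨m1, hy⟩)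
    (fun y hy => by rw [hexp 1 m1 y hy, hH.one y hy]; rfl) c0 c1
  rw [hs _ c0 (hst _ c0 (Or.inl rfl)) 1 m1, hs _ c1 (hst _ c1 (Or.inr rfl)) 1 m1] at key
  have hne : (2 * Real.pi * Complex.I : ℂ) ≠ 0 := Complex.two_pi_I_ne_zero
  have : (k.toAdd : ℂ) = 0 := by
    simpa [Real.pi_ne_zero, Complex.I_ne_zero] using key.symm
  have h3 : k.toAdd = 0 := by exact_mod_cast this
  exact toAdd_eq_zero.1 h3

end Circle

section HopfSections

/-- The section of the Hopf map over the complement of the lower ray. -/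
noncomputable def secU (b : ℂ × ℝ) : ℂ × ℂ :=
  (((√(rad b + b.2) : ℝ) : ℂ), (starRingEnd ℂ) b.1 / ((√(rad b + b.2) : ℝ) : ℂ))

/-- The section of the Hopf map over the complement of the upper ray. -/
noncomputable def secV (b : ℂ × ℝ) : ℂ × ℂ :=
  (b.1 / ((√(rad b - b.2) : ℝ) : ℂ), ((√(rad b - b.2) : ℝ) : ℂ))

theorem rad_neg (b : ℂ × ℝ) : rad (b.1, -b.2) = rad b := by simp [rad]

theorem rad_add_pos {b : ℂ × ℝ} (h : Upper b) : 0 < rad b + b.2 := by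
  have h1 := rad_sq b
  have h0 := rad_nonneg b
  rcases h with h | h
  · have := Complex.normSq_pos.2 h
    by_contra hc
    nlinarith
  · linarith

theorem rad_sub_pos {b : ℂ × ℝ} (h : Lower b) : 0 < rad b - b.2 := by
  have h' : Upper (b.1, -b.2) := by
    rcases h with h | h
    · exact Or.inl h
    · exact Or.inr (neg_pos.2 h)
  have := rad_add_pos h'
  rw [rad_neg] at this
  simpa [sub_eq_add_neg] using this

theorem hopf_secU {b : ℂ × ℝ} (h : Upper b) : hopf (secU b) = b := by
  have hp := rad_add_pos h
  have hq := Real.sqrt_pos.2 hp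
  have hne : ((√(rad b + b.2) : ℝ) : ℂ) ≠ 0 := by exact_mod_cast hq.ne'
  refine Prod.ext ?_ ?_
  · simp only [hopf, secU, map_div₀, Complex.conj_conj, Complex.conj_ofReal]
    field_simp
  · simp only [hopf, secU, map_div₀, Complex.normSq_conj, Complex.normSq_ofReal,
      Real.mul_self_sqrt hp.le]
    have := rad_sq b
    field_simp
    linear_combination this

theorem hopf_secV {b : ℂ × ℝ} (h : Lower b) : hopf (secV b) = b := by
  have hp := rad_sub_pos h
  have hq := Real.sqrt_pos.2 hp
  have hne : ((√(rad b - b.2) : ℝ) : ℂ) ≠ 0 := by exact_mod_cast hq.ne'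
  refine Prod.ext ?_ ?_
  · simp only [hopf, secV, Complex.conj_ofReal]
    field_simp
  · simp only [hopf, secV, map_div₀, Complex.normSq_ofReal,
      Real.mul_self_sqrt hp.le]
    have := rad_sq b
    field_simp
    linear_combination -this

theorem continuousOn_secU : ContinuousOn secU {b | Upper b} := by
  have := continuous_rad
  have := Complex.continuous_conj
  have h1 : Continuous fun b : ℂ × ℝ => ((√(rad b + b.2) : ℝ) : ℂ) := by fun_prop
  refine h1.continuousOn.prodMk (ContinuousOn.div (by fun_prop) h1.continuousOn fun b hb => ?_)
  exact_mod_cast (Real.sqrt_pos.2 (rad_add_pos hb)).ne'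

theorem continuousOn_secV : ContinuousOn secV {b | Lower b} := by
  have := continuous_rad
  have h1 : Continuous fun b : ℂ × ℝ => ((√(rad b - b.2) : ℝ) : ℂ) := by fun_prop
  refine ContinuousOn.prodMk (ContinuousOn.div (by fun_prop) h1.continuousOn fun b hb => ?_)
    h1.continuousOn
  exact_mod_cast (Real.sqrt_pos.2 (rad_sub_pos hb)).ne'

theorem hopf_smul_unit {u : ℂ} (hu : Complex.normSq u = 1) (v : ℂ × ℂ) :
    hopf (u * v.1, u * v.2) = hopf v := by
  have : u * (starRingEnd ℂ) u = 1 := by rw [Complex.mul_conj, hu, Complex.ofReal_one]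
  refine Prod.ext ?_ ?_
  · simp only [hopf, map_mul]; linear_combination (v.1 * (starRingEnd ℂ) v.2) * this
  · simp [hopf, hu]

theorem normSq_wind (k : ℤ) (y : Fin 1 → ℝ) : Complex.normSq (wind k y) = 1 := by
  rw [Complex.normSq_eq_norm_sq, wind, Complex.norm_exp]; simp

theorem conj_wind (k : ℤ) (y : Fin 1 → ℝ) : (starRingEnd ℂ) (wind k y) = wind (-k) y := by
  rw [wind, ← Complex.exp_conj, wind]; congr 1
  simp only [map_mul, Complex.conj_ofReal, Complex.conj_I, map_intCast, map_ofNat]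
  push_cast; ring

/-- A lift of the suspended winding loop through the Hopf map. -/
noncomputable def windLift (k : ℤ) (y : Fin 2 → ℝ) : ℂ × ℂ :=
  if y 0 ≤ 1 / 2 then secU (susp 1 (wind k) y)
  else (wind (-k) (Fin.tail y) * (secV (susp 1 (wind k) y)).1,
    wind (-k) (Fin.tail y) * (secV (susp 1 (wind k) y)).2)

theorem continuous_susp_wind (k : ℤ) : Continuous (susp 1 (wind k)) :=
  (continuous_suspPt 1).comp (f := fun y : Fin 2 → ℝ => (y 0, wind k (Fin.tail y)))
    ((continuous_apply 0).prodMk ((continuous_wind k).comp continuous_tail))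

theorem wind_mul_wind_neg (k : ℤ) (y : Fin 1 → ℝ) : wind (-k) y * wind k y = 1 := by
  rw [← conj_wind, mul_comm, Complex.mul_conj, normSq_wind, Complex.ofReal_one]

theorem continuousOn_windLift (k : ℤ) : ContinuousOn (windLift k) (Icc 0 1) := by
  have hs := (isLoop_wind k).isSplit_susp one_ne_zero
  refine continuousOn_ite_le (φ := fun y : Fin 2 → ℝ => y 0) (by fun_prop) ?_ ?_ ?_
  · exact continuousOn_secU.comp (continuous_susp_wind k).continuousOn
      fun y hy => hs.upper y hy.1 hy.2
  · have h1 := continuousOn_secV.comp (continuous_susp_wind k).continuousOn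
      fun y (hy : y ∈ Icc (0 : Fin 2 → ℝ) 1 ∩ {y | 1 / 2 ≤ y 0}) => hs.lower y hy.1 hy.2
    have h2 : Continuous fun y : Fin 2 → ℝ => wind (-k) (Fin.tail y) :=
      (continuous_wind _).comp continuous_tail
    exact (h2.continuousOn.mul h1.fst).prodMk (h2.continuousOn.mul h1.snd)
  · intro y _ hy
    have hr : rad (wind k (Fin.tail y), 0) = 1 := by simp [rad, normSq_wind]
    simp only [susp, hy, suspPt_half, secU, secV, hr, add_zero, sub_zero, Real.sqrt_one,
      Complex.ofReal_one, div_one, mul_one, conj_wind, wind_mul_wind_neg]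

theorem hopf_windLift (k : ℤ) {y : Fin 2 → ℝ} (hy : y ∈ Icc (0 : Fin 2 → ℝ) 1) :
    hopf (windLift k y) = susp 1 (wind k) y := by
  have hs := (isLoop_wind k).isSplit_susp one_ne_zero
  unfold windLift
  split_ifs with h
  · exact hopf_secU (hs.upper y hy h)
  · rw [hopf_smul_unit (normSq_wind _ _), hopf_secV (hs.lower y hy (not_le.1 h).le)]

theorem rad_one : rad (1, 0) = 1 := by simp [rad]

/-- The second homotopy group of the punctured three-space. -/
theorem suspHom_oneC_injective : Function.Injective (suspHom (k := 0) oneC) := by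
  refine (injective_iff_map_eq_one _).2 fun a ha => ?_
  obtain ⟨k, rfl⟩ := exists_cls_eq_wind a
  rw [suspHom_cls, ← cls_const (suspBase oneC)] at ha
  obtain ⟨H, hH, -⟩ := exists_htpy ha
  have m0 : (0 : ℝ) ∈ Icc (0 : ℝ) 1 := ⟨le_rfl, zero_le_one⟩
  have m1 : (1 : ℝ) ∈ Icc (0 : ℝ) 1 := ⟨zero_le_one, le_rfl⟩
  obtain ⟨l, hl, hh, h0, hs⟩ := exists_hopf_lift (K := Icc (0 : Fin 2 → ℝ) 1) isCompact_Icc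
    H hH.cont hH.ne (windLift k) (continuousOn_windLift k)
    (fun y hy => (hopf_windLift k hy).trans (hH.zero y hy).symm)
  have hst : ∀ y ∈ Icc (0 : Fin 2 → ℝ) 1, ∀ i, (y i = 0 ∨ y i = 1) → l 1 y = windLift k y :=
    fun y hy i hi => hs y hy (fun τ hτ => by
      rw [hH.bd τ hτ y hy i hi, hH.bd 0 m0 y hy i hi]) 1 m1
  have hcons : ∀ {τ : ℝ} {z : Fin 1 → ℝ}, τ ∈ Icc (0 : ℝ) 1 → z ∈ Icc (0 : Fin 1 → ℝ) 1 →
      (Fin.cons τ z : Fin 2 → ℝ) ∈ Icc 0 1 := fun h1 h2 => cons_mem h1 h2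
  have hU : secU (1, 0) = (1, 1) := by simp [secU, rad_one]
  have hV : secV (1, 0) = (1, 1) := by simp [secV, rad_one]
  have w0 : ∀ k : ℤ, ∀ z ∈ Icc (0 : Fin 1 → ℝ) 1, (z 0 = 0 ∨ z 0 = 1) → wind k z = 1 :=
    fun k z hz hz0 => (isLoop_wind k).bd z hz 0 hz0
  have H2 : IsHtpy oneC.1 (fun _ => (1 : ℂ)) (wind (-k)) fun τ z => (l 1 (Fin.cons τ z)).1 := by
    refine ⟨?_, fun τ hτ z hz h => ?_, fun τ hτ z hz i hi => ?_, fun z hz => ?_, fun z hz => ?_⟩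
    · exact (hl.comp (f := fun p : ℝ × (Fin 1 → ℝ) => ((1 : ℝ), (Fin.cons p.1 p.2 : Fin 2 → ℝ)))
        (continuous_const.prodMk continuous_cons).continuousOn
        fun p hp => ⟨m1, hcons hp.1 hp.2⟩).fst
    · have := congrArg Prod.fst (hh 1 m1 _ (hcons hτ hz))
      rw [hH.one _ (hcons hτ hz)] at this
      simp only [hopf, h, zero_mul] at this
      exact zero_ne_one this
    · rw [Subsingleton.elim i 0] at hi
      rw [hst _ (hcons hτ hz) 1 (by simpa using hi)]
      have e : susp 1 (wind k) (Fin.cons τ z) = (1, 0) := by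
        simp only [susp, Fin.cons_zero, Fin.tail_cons]
        rw [w0 k z hz hi, suspPt_base]
      simp only [windLift, e, hU, hV, Fin.tail_cons, w0 (-k) z hz hi]
      split_ifs <;> simp [oneC]
    · rw [hst _ (hcons m0 hz) 0 (Or.inl rfl)]
      simp [windLift, susp, suspPt_zero, hU]
    · rw [hst _ (hcons m1 hz) 0 (Or.inr rfl)]
      have : ¬ ((1 : ℝ) ≤ 1 / 2) := by norm_num
      simp only [windLift, susp, suspPt_one, hV, Fin.cons_zero, Fin.tail_cons, if_neg this, mul_one]
  have e := H2.cls_eq (isLoop_const oneC.2) (isLoop_wind (-k))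
  have e2 : windHom (Multiplicative.ofAdd (-k)) = 1 := e.symm.trans (cls_const oneC)
  have e3 := (injective_iff_map_eq_one _).1 windHom_injective _ e2
  have e4 : -k = 0 := e3
  have e5 : k = 0 := by omega
  change windHom (Multiplicative.ofAdd k) = 1
  rw [e5]; exact windHom.map_one

end HopfSections

section Transfer

variable {E E' : Type*} [NormedAddCommGroup E] [NormedSpace ℝ E] [NormedAddCommGroup E']
  [NormedSpace ℝ E'] {k : ℕ}

/-- Mutually inverse maps of punctured spaces induce isomorphisms. -/
noncomputable def pmapEquiv {φ : E → E'} {ψ : E' → E} (hc : ContinuousOn φ {0}ᶜ)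
    (hn : ∀ v, v ≠ 0 → φ v ≠ 0) (hc' : ContinuousOn ψ {0}ᶜ) (hn' : ∀ v, v ≠ 0 → ψ v ≠ 0)
    (h1 : ∀ v, ψ (φ v) = v) (h2 : ∀ v, φ (ψ v) = v) {x : {v : E // v ≠ 0}}
    {x' : {v : E' // v ≠ 0}} (hx : φ x.1 = x'.1) : PG (k + 1) E x ≃* PG (k + 1) E' x' :=
  MonoidHom.toMulEquiv (pmap hc hn hx)
    (pmap hc' hn' (x := x') (x' := x) (by rw [← hx, h1]))
    (by
      ext a
      obtain ⟨f, l, rfl, -⟩ := exists_loop a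
      rw [MonoidHom.comp_apply, pmap_cls, pmap_cls]
      exact IsLoop.cls_congr _ _ fun y _ => h1 _)
    (by
      ext a
      obtain ⟨f, l, rfl, -⟩ := exists_loop a
      rw [MonoidHom.comp_apply, pmap_cls, pmap_cls]
      exact IsLoop.cls_congr _ _ fun y _ => h2 _)

theorem nonempty_PG_equiv [FiniteDimensional ℝ E] [FiniteDimensional ℝ E']
    (h : Module.finrank ℝ E = Module.finrank ℝ E') (x : {v : E // v ≠ 0})
    (x' : {v : E' // v ≠ 0}) : Nonempty (PG (k + 1) E x ≃* PG (k + 1) E' x') := by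
  let L : E ≃L[ℝ] E' := ContinuousLinearEquiv.ofFinrankEq h
  have hL : L x.1 ≠ 0 := (map_ne_zero_iff L L.injective).2 x.2
  obtain ⟨A, hA⟩ := SeparatingDual.exists_continuousLinearEquiv_apply_eq (R := ℝ) hL x'.2
  let B := L.trans A
  exact ⟨pmapEquiv (φ := B) (ψ := B.symm) B.continuous.continuousOn
    (fun v hv => (map_ne_zero_iff B B.injective).2 hv) B.symm.continuous.continuousOn
    (fun v hv => (map_ne_zero_iff B.symm B.symm.injective).2 hv) B.symm_apply_apply
    B.apply_symm_apply hA⟩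

theorem nonempty_PG_susp_equiv [FiniteDimensional ℝ E] [FiniteDimensional ℝ E']
    (h : Module.finrank ℝ E' = Module.finrank ℝ E + 1) (hdim : k + 4 < 2 * Module.finrank ℝ E)
    (x : {v : E // v ≠ 0}) (x' : {v : E' // v ≠ 0}) :
    Nonempty (PG (k + 1) E x ≃* PG (k + 2) E' x') := by
  obtain ⟨e⟩ := nonempty_PG_equiv (k := k + 1) (E := E × ℝ) (E' := E') (by simp [h]) (suspBase x) x'
  exact ⟨(MulEquiv.ofBijective (suspHom x)
    ⟨suspHom_injective x hdim, suspHom_surjective x (by omega)⟩).trans e⟩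

/-- The `n`-th homotopy group of an `n`-dimensional sphere, for `n ≥ 2`. -/
theorem nonempty_PG_int (n : ℕ) : ∀ (E : Type) [NormedAddCommGroup E] [NormedSpace ℝ E]
    [FiniteDimensional ℝ E], Module.finrank ℝ E = n + 3 → ∀ x : {v : E // v ≠ 0},
    Nonempty (PG (n + 2) E x ≃* Multiplicative ℤ) := by
  induction n with
  | zero =>
    intro E _ _ _ h x
    have h2 : Module.finrank ℝ (ℂ × ℝ) = 3 := by simp [Complex.finrank_real_complex]
    obtain ⟨e⟩ := nonempty_PG_equiv (k := 1) (E := E) (E' := ℂ × ℝ) (by rw [h, h2]) x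
      (suspBase oneC)
    refine ⟨e.trans (MulEquiv.ofBijective ((suspHom oneC).comp windHom) ⟨?_, ?_⟩).symm⟩
    · exact suspHom_oneC_injective.comp windHom_injective
    · exact (suspHom_surjective (k := 0) oneC (by simp [Complex.finrank_real_complex])).comp
        windHom_surjective
  | succ n ih =>
    intro E _ _ _ h x
    have hE : Module.finrank ℝ (EuclideanSpace ℝ (Fin (n + 3))) = n + 3 := by simp
    let x' : {v : EuclideanSpace ℝ (Fin (n + 3)) // v ≠ 0} :=
      ⟨EuclideanSpace.single 0 1, by simp⟩
    obtain ⟨e⟩ := ih _ hE x'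
    obtain ⟨e'⟩ := nonempty_PG_susp_equiv (k := n + 1) (E' := E) (by rw [hE, h])
      (by rw [hE]; omega) x' x
    exact ⟨e'.symm.trans e⟩

/-- Stability of the first stem. -/
theorem nonempty_PG_stem_equiv (n : ℕ) {E : Type} [NormedAddCommGroup E] [NormedSpace ℝ E]
    [FiniteDimensional ℝ E] (hE : Module.finrank ℝ E = 4) (x : {v : E // v ≠ 0}) :
    ∀ (E' : Type) [NormedAddCommGroup E'] [NormedSpace ℝ E']
    [FiniteDimensional ℝ E'], Module.finrank ℝ E' = n + 4 → ∀ x' : {v : E' // v ≠ 0},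
    Nonempty (PG (n + 4) E' x' ≃* PG 4 E x) := by
  induction n with
  | zero => exact fun E' _ _ _ h x' => nonempty_PG_equiv (k := 3) (by rw [h, hE]) x' x
  | succ n ih =>
    intro E' _ _ _ h x'
    have hF : Module.finrank ℝ (EuclideanSpace ℝ (Fin (n + 4))) = n + 4 := by simp
    let z : {v : EuclideanSpace ℝ (Fin (n + 4)) // v ≠ 0} :=
      ⟨EuclideanSpace.single 0 1, by simp⟩
    obtain ⟨e⟩ := ih _ hF z
    obtain ⟨e'⟩ := nonempty_PG_susp_equiv (k := n + 3) (E' := E') (by rw [hF, h])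
      (by rw [hF]; omega) z x'
    exact ⟨e'.symm.trans e⟩

end Transfer

section Sphere

variable {E : Type*} [NormedAddCommGroup E] [NormedSpace ℝ E] {k : ℕ}

/-- The inclusion of the unit sphere into the punctured space induces isomorphisms. -/
theorem nonempty_sphere_equiv (x : sphere (0 : E) 1) :
    ∃ x' : {v : E // v ≠ 0}, Nonempty ((π_ (k + 1) (sphere (0 : E) 1) x) ≃* PG (k + 1) E x') := by
  have hn : ∀ v : sphere (0 : E) 1, (v : E) ≠ 0 := fun v h => by
    have := mem_sphere_zero_iff_norm.1 v.2
    rw [h, norm_zero] at this; exact zero_ne_one this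
  let ι : C(sphere (0 : E) 1, {v : E // v ≠ 0}) :=
    ⟨fun v => ⟨v, hn v⟩, continuous_subtype_val.subtype_mk _⟩
  let ρ : C({v : E // v ≠ 0}, sphere (0 : E) 1) :=
    ⟨fun v => ⟨‖v.1‖⁻¹ • v.1, by
      rw [mem_sphere_zero_iff_norm, norm_smul, norm_inv, norm_norm,
        inv_mul_cancel₀ (norm_ne_zero_iff.2 v.2)]⟩,
      continuous_induced_rng.2 ((continuous_subtype_val.norm.inv₀ fun v =>
        norm_ne_zero_iff.2 v.2).smul continuous_subtype_val)⟩
  have hρι : ∀ v, ρ (ι v) = v := fun v => Subtype.ext (by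
    change ‖(v : E)‖⁻¹ • (v : E) = v
    rw [mem_sphere_zero_iff_norm.1 v.2]; simp)
  refine ⟨ι x, ⟨MonoidHom.toMulEquiv (inducedHom ι rfl) (inducedHom ρ (hρι x)) ?_ ?_⟩⟩
  · ext a
    induction a using Quotient.inductionOn with | _ f
    change inducedHom ρ _ (inducedHom ι rfl (⟦f⟧ : HomotopyGroup (Fin (k + 1)) _ x)) = ⟦f⟧
    rw [inducedHom_mk, inducedHom_mk]
    refine congrArg (Quotient.mk _) ?_
    ext y
    exact congrArg Subtype.val (hρι (f y))
  · ext a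
    obtain ⟨f, l, rfl, -⟩ := exists_loop a
    change inducedHom ι rfl (inducedHom ρ _ l.cls) = l.cls
    have hx1 : ‖(ι x).1‖ = 1 := mem_sphere_zero_iff_norm.1 x.2
    have H : IsHtpy (ι x).1 (fun y => ‖f y‖⁻¹ • f y) f
        fun τ y => ((1 - τ) * ‖f y‖⁻¹ + τ) • f y := by
      refine ⟨?_, fun τ hτ y hy => ?_, fun τ hτ y hy i hi => ?_, fun y hy => ?_, fun y hy => ?_⟩
      · have hf : ContinuousOn (fun p : ℝ × (Fin (k + 1) → ℝ) => f p.2) (Icc 0 1 ×ˢ Icc 0 1) :=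
          l.cont.comp continuousOn_snd fun p hp => hp.2
        exact ContinuousOn.smul (ContinuousOn.add (ContinuousOn.mul (by fun_prop)
          (hf.norm.inv₀ fun p hp => norm_ne_zero_iff.2 (l.ne _ hp.2))) (by fun_prop)) hf
      · refine smul_ne_zero (ne_of_gt ?_) (l.ne y hy)
        have h1 : 0 < ‖f y‖⁻¹ := inv_pos.2 (norm_pos_iff.2 (l.ne y hy))
        rcases hτ.1.eq_or_lt with h0 | h0
        · rw [← h0]; simpa using h1
        · have := mul_nonneg (sub_nonneg.2 hτ.2) h1.le
          linarith
      · simp only [l.bd y hy i hi, hx1]; simp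
      · simp
      · simp
    exact H.cls_eq H.isLoop_left l

end Sphere

section UpperBound

/-- The base point of the punctured complex plane of dimension two. -/
def oneOne : {v : ℂ × ℂ // v ≠ 0} := ⟨(1, 1), fun h => one_ne_zero (congrArg Prod.fst h)⟩

theorem hopf_one_one : hopf (1, 1) = (1, 0) := by simp [hopf]

/-- The homomorphism induced by the Hopf map. -/
noncomputable def hopfHom : PG 3 (ℂ × ℂ) oneOne →* PG 3 (ℂ × ℝ) (suspBase oneC) :=
  pmap continuous_hopf.continuousOn (fun _ h => hopf_ne_zero h) hopf_one_one

theorem eq_of_hopf_eq_one {v : ℂ × ℂ} (h : hopf v = (1, 0)) :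
    v.1 = v.2 ∧ Complex.normSq v.1 = 1 := by
  have h1 : v.1 * (starRingEnd ℂ) v.2 = 1 := congrArg Prod.fst h
  have h2 : (Complex.normSq v.1 - Complex.normSq v.2) / 2 = 0 := congrArg Prod.snd h
  have h3 : Complex.normSq v.1 = Complex.normSq v.2 := by linarith
  have h4 := congrArg Complex.normSq h1
  rw [map_mul, Complex.normSq_conj, h3, map_one] at h4
  have h5 : Complex.normSq v.2 = 1 := by nlinarith [Complex.normSq_nonneg v.2]
  refine ⟨?_, h3.trans h5⟩
  have h6 : v.2 * (starRingEnd ℂ) v.2 = 1 := by rw [Complex.mul_conj, h5, Complex.ofReal_one]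
  have hne : (starRingEnd ℂ) v.2 ≠ 0 := right_ne_zero_of_mul_eq_one h6
  exact mul_right_cancel₀ hne (h1.trans h6.symm)

theorem normSq_exp_smul {θ : ℂ} (h : Complex.normSq (Complex.exp θ) = 1) (t : ℝ) :
    Complex.normSq (Complex.exp (-(t : ℂ) * θ)) = 1 := by
  rw [Complex.normSq_eq_norm_sq, Complex.norm_exp] at h ⊢
  have h1 : Real.exp θ.re = 1 := by
    have := Real.exp_pos θ.re
    nlinarith
  have h2 : θ.re = 0 := by rwa [Real.exp_eq_one_iff] at h1
  simp [h2]

/-- A circle-valued map on the square which is trivial on the boundary has a logarithm which is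
trivial on the boundary. -/
theorem exists_log {μ : (Fin 2 → ℝ) → ℂ} (hμ : IsLoop 1 μ) :
    ∃ θ : (Fin 2 → ℝ) → ℂ, ContinuousOn θ (Icc 0 1) ∧
      (∀ q ∈ Icc (0 : Fin 2 → ℝ) 1, Complex.exp (θ q) = μ q) ∧
      ∀ q ∈ Icc (0 : Fin 2 → ℝ) 1, ∀ i, (q i = 0 ∨ q i = 1) → θ q = 0 := by
  have m0 : (0 : ℝ) ∈ Icc (0 : ℝ) 1 := ⟨le_rfl, zero_le_one⟩
  have m1 : (1 : ℝ) ∈ Icc (0 : ℝ) 1 := ⟨zero_le_one, le_rfl⟩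
  have hc : ∀ {τ : ℝ} {z : Fin 1 → ℝ}, τ ∈ Icc (0 : ℝ) 1 → z ∈ Icc (0 : Fin 1 → ℝ) 1 →
      (Fin.cons τ z : Fin 2 → ℝ) ∈ Icc 0 1 := fun h1 h2 => cons_mem h1 h2
  obtain ⟨l, hl, hexp, h0, hs⟩ := exists_exp_lift (K := Icc (0 : Fin 1 → ℝ) 1) isCompact_Icc
    (fun τ z => μ (Fin.cons τ z))
    (hμ.cont.comp (f := fun p : ℝ × (Fin 1 → ℝ) => (Fin.cons p.1 p.2 : Fin 2 → ℝ))
      continuous_cons.continuousOn fun p hp => hc hp.1 hp.2)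
    (fun τ hτ z hz => hμ.ne _ (hc hτ hz)) (fun _ => 0) continuousOn_const (fun z hz => by
      rw [Complex.exp_zero, hμ.bd _ (hc m0 hz) 0 (Or.inl rfl)])
  have hst : ∀ τ ∈ Icc (0 : ℝ) 1, ∀ z ∈ Icc (0 : Fin 1 → ℝ) 1, (z 0 = 0 ∨ z 0 = 1) → l τ z = 0 :=
    fun τ hτ z hz hz0 => hs z hz (fun τ' hτ' => by
      rw [hμ.bd _ (hc hτ' hz) 1 (by simpa using hz0), hμ.bd _ (hc m0 hz) 1 (by simpa using hz0)])
      τ hτ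
  have h1 : ∀ z ∈ Icc (0 : Fin 1 → ℝ) 1, l 1 z = 0 := fun z hz => by
    rw [← hst 1 m1 0 ⟨le_rfl, zero_le_one⟩ (Or.inl rfl)]
    refine exp_eq_one_const (isPreconnected_cube 1)
      (hl.comp (f := fun y => ((1 : ℝ), y)) (by fun_prop) fun y hy => ⟨m1, hy⟩)
      (fun y hy => ?_) hz ⟨le_rfl, zero_le_one⟩
    exact (hexp 1 m1 y hy).trans (hμ.bd _ (hc m1 hy) 0 (Or.inr rfl))
  refine ⟨fun q => l (q 0) (Fin.tail q), ?_, fun q hq => ?_, fun q hq i => ?_⟩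
  · exact hl.comp (f := fun q : Fin 2 → ℝ => (q 0, (Fin.tail q : Fin 1 → ℝ)))
      ((continuous_apply 0).prodMk continuous_tail).continuousOn
      fun q hq => ⟨head_mem hq, tail_mem hq⟩
  · rw [hexp _ (head_mem hq) _ (tail_mem hq)]; congr 1; exact Fin.cons_self_tail q
  · refine Fin.cases (fun hi => ?_) (fun j hj => ?_) i
    · rcases hi with hi | hi
      · simp only [hi]; exact h0 _ (tail_mem hq)
      · simp only [hi]; exact h1 _ (tail_mem hq)
    · rw [Subsingleton.elim j 0] at hj
      exact hst _ (head_mem hq) _ (tail_mem hq) hj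

theorem hopfHom_surjective : Function.Surjective hopfHom := by
  intro a
  obtain ⟨f, lf, rfl, -⟩ := exists_loop a
  have m0 : (0 : ℝ) ∈ Icc (0 : ℝ) 1 := ⟨le_rfl, zero_le_one⟩
  have m1 : (1 : ℝ) ∈ Icc (0 : ℝ) 1 := ⟨zero_le_one, le_rfl⟩
  have hc : ∀ {τ : ℝ} {z : Fin 2 → ℝ}, τ ∈ Icc (0 : ℝ) 1 → z ∈ Icc (0 : Fin 2 → ℝ) 1 →
      (Fin.cons τ z : Fin 3 → ℝ) ∈ Icc 0 1 := fun h1 h2 => cons_mem h1 h2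
  obtain ⟨l, hl, hh, h0, hs⟩ := exists_hopf_lift (K := Icc (0 : Fin 2 → ℝ) 1) isCompact_Icc
    (fun τ z => f (Fin.cons τ z))
    (lf.cont.comp (f := fun p : ℝ × (Fin 2 → ℝ) => (Fin.cons p.1 p.2 : Fin 3 → ℝ))
      continuous_cons.continuousOn fun p hp => hc hp.1 hp.2)
    (fun τ hτ z hz => lf.ne _ (hc hτ hz)) (fun _ => (1, 1)) continuousOn_const (fun z hz => by
      rw [hopf_one_one, lf.bd _ (hc m0 hz) 0 (Or.inl rfl)]; rfl)
  have hst : ∀ τ ∈ Icc (0 : ℝ) 1, ∀ z ∈ Icc (0 : Fin 2 → ℝ) 1, ∀ i, (z i = 0 ∨ z i = 1) →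
      l τ z = (1, 1) :=
    fun τ hτ z hz i hi => hs z hz (fun τ' hτ' => by
      rw [lf.bd _ (hc hτ' hz) i.succ (by simpa using hi),
        lf.bd _ (hc m0 hz) i.succ (by simpa using hi)]) τ hτ
  have h1 : ∀ z ∈ Icc (0 : Fin 2 → ℝ) 1, (l 1 z).1 = (l 1 z).2 ∧ Complex.normSq (l 1 z).1 = 1 :=
    fun z hz => eq_of_hopf_eq_one ((hh 1 m1 z hz).trans (lf.bd _ (hc m1 hz) 0 (Or.inr rfl)))
  have hμ : IsLoop 1 fun z => (l 1 z).1 :=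
    ⟨(hl.comp (f := fun y => ((1 : ℝ), y)) (by fun_prop) fun y hy => ⟨m1, hy⟩).fst,
      fun z hz h => by have := (h1 z hz).2; simp [h] at this,
      fun z hz i hi => by rw [hst 1 m1 z hz i hi]⟩
  obtain ⟨θ, hθ, hexp, hθ0⟩ := exists_log hμ
  let c : (Fin 3 → ℝ) → ℂ := fun y => Complex.exp (-((y 0 : ℝ) : ℂ) * θ (Fin.tail y))
  let g : (Fin 3 → ℝ) → ℂ × ℂ := fun y =>
    (c y * (l (y 0) (Fin.tail y)).1, c y * (l (y 0) (Fin.tail y)).2)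
  have hhg : ∀ y ∈ Icc (0 : Fin 3 → ℝ) 1, hopf (g y) = f y := fun y hy => by
    have hn : Complex.normSq (c y) = 1 := normSq_exp_smul (by
      rw [hexp _ (tail_mem hy)]; exact (h1 _ (tail_mem hy)).2) _
    rw [hopf_smul_unit hn, hh _ (head_mem hy) _ (tail_mem hy)]
    congr 1; exact Fin.cons_self_tail y
  have lg : IsLoop oneOne.1 g := by
    refine ⟨?_, fun y hy h => ?_, fun y hy i => ?_⟩
    · have e1 : ContinuousOn c (Icc 0 1) := Complex.continuous_exp.comp_continuousOn
        (ContinuousOn.mul (by fun_prop) (hθ.comp continuous_tail.continuousOn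
          fun y hy => tail_mem hy))
      have e2 : ContinuousOn (fun y : Fin 3 → ℝ => l (y 0) (Fin.tail y)) (Icc 0 1) :=
        hl.comp (f := fun q : Fin 3 → ℝ => (q 0, (Fin.tail q : Fin 2 → ℝ)))
          ((continuous_apply 0).prodMk continuous_tail).continuousOn
          fun q hq => ⟨head_mem hq, tail_mem hq⟩
      exact (e1.mul e2.fst).prodMk (e1.mul e2.snd)
    · apply lf.ne y hy
      rw [← hhg y hy, h]; simp [hopf]
    · refine Fin.cases (fun hi => ?_) (fun j hj => ?_) i
      · rcases hi with hi | hi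
        · simp only [g, c, hi, h0 _ (tail_mem hy)]; simp [oneOne]
        · have e1 := (h1 _ (tail_mem hy)).1
          have e2 := hexp _ (tail_mem hy)
          have e3 : c y * (l 1 (Fin.tail y)).1 = 1 := by
            simp only [c, hi]
            rw [← e2, ← Complex.exp_add]; simp
          simp only [g, hi]
          rw [← e1, e3]; rfl
      · have e1 : θ (Fin.tail y) = 0 := hθ0 _ (tail_mem hy) j hj
        simp only [g, c, e1, hst _ (head_mem hy) _ (tail_mem hy) j hj]; simp [oneOne]
  refine ⟨lg.cls, ?_⟩
  have lhg : IsLoop (suspBase oneC).1 fun y => hopf (g y) :=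
    lg.comp continuous_hopf.continuousOn (fun _ h => hopf_ne_zero h) hopf_one_one
  exact lhg.cls_congr lf hhg

/-- Rotation of the imaginary parts, from the identity to complex conjugation. -/
noncomputable def rotIm (τ : ℝ) (v : ℂ × ℂ) : ℂ × ℂ :=
  (⟨v.1.re, Real.cos (τ * Real.pi) * v.1.im - Real.sin (τ * Real.pi) * v.2.im⟩,
    ⟨v.2.re, Real.sin (τ * Real.pi) * v.1.im + Real.cos (τ * Real.pi) * v.2.im⟩)

theorem continuous_mk_complex {X : Type*} [TopologicalSpace X] {f g : X → ℝ} (hf : Continuous f)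
    (hg : Continuous g) : Continuous fun x => (⟨f x, g x⟩ : ℂ) := by
  have : (fun x => (⟨f x, g x⟩ : ℂ)) = fun x => (f x : ℂ) + (g x : ℂ) * Complex.I := by
    funext x; exact Complex.mk_eq_add_mul_I _ _
  rw [this]; fun_prop

theorem rot_eq_zero {c s a b : ℝ} (h : c ^ 2 + s ^ 2 = 1) (h1 : c * a - s * b = 0)
    (h2 : s * a + c * b = 0) : a = 0 ∧ b = 0 :=
  ⟨by linear_combination -a * h + c * h1 + s * h2, by linear_combination -b * h - s * h1 + c * h2⟩

theorem rotIm_ne_zero (τ : ℝ) {v : ℂ × ℂ} (hv : v ≠ 0) : rotIm τ v ≠ 0 := fun h => by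
  have h1 := congrArg Prod.fst h
  have h2 := congrArg Prod.snd h
  have e1 : v.1.re = 0 := congrArg Complex.re h1
  have e2 : v.2.re = 0 := congrArg Complex.re h2
  obtain ⟨e3, e4⟩ := rot_eq_zero (Real.cos_sq_add_sin_sq (τ * Real.pi))
    (congrArg Complex.im h1 : _ = (0 : ℝ)) (congrArg Complex.im h2)
  exact hv (Prod.ext (Complex.ext e1 e3) (Complex.ext e2 e4))

theorem continuous_rotIm : Continuous fun p : ℝ × (ℂ × ℂ) => rotIm p.1 p.2 := by
  unfold rotIm
  have := Complex.continuous_im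
  have := Complex.continuous_re
  exact (continuous_mk_complex (by fun_prop) (by fun_prop)).prodMk
    (continuous_mk_complex (by fun_prop) (by fun_prop))

/-- Conjugation on the target of the Hopf map. -/
noncomputable def conjT (v : ℂ × ℝ) : ℂ × ℝ := ((starRingEnd ℂ) v.1, v.2)

theorem continuous_conjT : Continuous conjT := by
  unfold conjT
  have := Complex.continuous_conj
  fun_prop

theorem conjT_ne_zero {v : ℂ × ℝ} (hv : v ≠ 0) : conjT v ≠ 0 := fun h =>
  hv (Prod.ext ((map_eq_zero (starRingEnd ℂ)).1 (congrArg Prod.fst h))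
    (congrArg Prod.snd h : (conjT v).2 = 0))

theorem conjT_base : conjT (suspBase oneC).1 = (suspBase oneC).1 := by
  simp [conjT, suspBase, oneC]

theorem conjT_hopf (v : ℂ × ℂ) : conjT (hopf v) = hopf (rotIm 1 v) := by
  refine Prod.ext (Complex.ext ?_ ?_) ?_ <;>
    simp [conjT, hopf, rotIm, Complex.normSq_apply]

theorem cls_conjT {f : (Fin 3 → ℝ) → ℂ × ℝ} (l : IsLoop (suspBase oneC).1 f)
    (l' : IsLoop (suspBase oneC).1 fun y => conjT (f y)) : l'.cls = l.cls := by
  obtain ⟨a, ha⟩ := hopfHom_surjective l.cls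
  obtain ⟨g, lg, rfl, -⟩ := exists_loop a
  have lhg : IsLoop (suspBase oneC).1 fun y => hopf (g y) :=
    lg.comp continuous_hopf.continuousOn (fun _ h => hopf_ne_zero h) hopf_one_one
  have ha' : lhg.cls = l.cls := ha
  have lc := lhg.comp continuous_conjT.continuousOn (fun _ h => conjT_ne_zero h) conjT_base
  have e1 : lc.cls = l'.cls := by
    have := congrArg
      (pmap continuous_conjT.continuousOn (fun _ h => conjT_ne_zero h) conjT_base) ha'
    exact this
  rw [← e1, ← ha']
  have base : ∀ τ, hopf (rotIm τ oneOne.1) = (suspBase oneC).1 := fun τ => by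
    refine Prod.ext (Complex.ext ?_ ?_) ?_ <;>
      simp [oneOne, hopf, rotIm, Complex.normSq_apply, suspBase, oneC]
  have l1 : IsLoop (suspBase oneC).1 fun y => hopf (rotIm 1 (g y)) := lc.congr fun y _ =>
    (conjT_hopf _).symm
  have r0 : ∀ v, rotIm 0 v = v := fun v => by simp [rotIm]
  have l0 : IsLoop (suspBase oneC).1 fun y => hopf (rotIm 0 (g y)) := lhg.congr fun y _ => by
    rw [r0]
  have key := cls_comp_eq_of_homotopy lg (fun τ v => hopf (rotIm τ v))
    (continuous_hopf.comp continuous_rotIm).continuousOn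
    (fun τ _ v hv => hopf_ne_zero (rotIm_ne_zero τ hv)) (fun τ _ => base τ) l0 l1
  rw [lc.cls_congr l1 fun y _ => conjT_hopf _, ← key]
  exact l0.cls_congr lhg fun y _ => by rw [r0]

/-- Rotated reflections in the plane spanned by the imaginary and the suspension coordinate. -/
noncomputable def refl (τ : ℝ) (v : (ℂ × ℝ) × ℝ) : (ℂ × ℝ) × ℝ :=
  ((⟨v.1.1.re, -(Real.cos (τ * Real.pi)) * v.1.1.im + Real.sin (τ * Real.pi) * v.2⟩, v.1.2),
    Real.sin (τ * Real.pi) * v.1.1.im + Real.cos (τ * Real.pi) * v.2)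

theorem continuous_refl : Continuous fun p : ℝ × ((ℂ × ℝ) × ℝ) => refl p.1 p.2 := by
  unfold refl
  have := Complex.continuous_im
  have := Complex.continuous_re
  exact ((continuous_mk_complex (by fun_prop) (by fun_prop)).prodMk (by fun_prop)).prodMk
    (by fun_prop)

theorem refl_ne_zero (τ : ℝ) {v : (ℂ × ℝ) × ℝ} (hv : v ≠ 0) : refl τ v ≠ 0 := fun h => by
  have h1 := congrArg (fun w => w.1.1) h
  have e1 : v.1.1.re = 0 := congrArg Complex.re h1
  have e2 : v.1.2 = 0 := congrArg (fun w => w.1.2) h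
  have e3 : -(Real.cos (τ * Real.pi)) * v.1.1.im + Real.sin (τ * Real.pi) * v.2 = 0 :=
    congrArg Complex.im h1
  obtain ⟨e4, e5⟩ := rot_eq_zero (Real.cos_sq_add_sin_sq (τ * Real.pi))
    (a := v.1.1.im) (b := v.2) (by linarith) (congrArg Prod.snd h)
  exact hv (Prod.ext (Prod.ext (Complex.ext e1 e4) e2) e5)

theorem norm_conjT_sub (v : ℂ × ℝ) : ‖conjT v - (1, 0)‖ = ‖v - (1, 0)‖ := by
  have h : conjT v - (1, 0) = ((starRingEnd ℂ) (v.1 - 1), v.2 - 0) := by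
    simp [conjT]
  rw [h, Prod.norm_def, Prod.norm_def, RCLike.norm_conj]
  rfl

theorem suspPt_conjT (t : ℝ) (v : ℂ × ℝ) :
    suspPt (1, 0) t (conjT v) = refl 0 (suspPt (1, 0) t v) := by
  refine Prod.ext (Prod.ext (Complex.ext ?_ ?_) ?_) ?_
  · simp [suspPt, refl, conjT]
  · simp [suspPt, refl, conjT]
  · simp [suspPt, refl, conjT]
  · simp only [suspPt, norm_conjT_sub, refl]; simp

theorem suspPt_one_sub (t : ℝ) (v : ℂ × ℝ) :
    suspPt (1, 0) (1 - t) v = refl 1 (suspPt (1, 0) t v) := by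
  have h : 1 - 2 * (1 - t) = -(1 - 2 * t) := by ring
  refine Prod.ext (Prod.ext (Complex.ext ?_ ?_) ?_) ?_ <;>
    simp only [suspPt, refl, h, abs_neg] <;> simp
  ring

/-- Every element of the stem group is its own inverse. -/
theorem stem_inv_eq (a : PG 4 ((ℂ × ℝ) × ℝ) (suspBase (suspBase oneC))) : a⁻¹ = a := by
  obtain ⟨b, rfl⟩ := suspHom_surjective (k := 2) (suspBase oneC)
    (by simp [Complex.finrank_real_complex]) a
  obtain ⟨f, l, rfl, -⟩ := exists_loop b
  have l' : IsLoop (suspBase oneC).1 fun y => conjT (f y) :=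
    l.comp continuous_conjT.continuousOn (fun _ h => conjT_ne_zero h) conjT_base
  have h1 : suspHom (suspBase oneC) l'.cls = suspHom (suspBase oneC) l.cls := by rw [cls_conjT l l']
  rw [suspHom_cls, suspHom_cls] at h1
  rw [suspHom_cls, ← cls_rev 0 l.susp, ← h1]
  have base : ∀ τ, refl τ (suspBase (suspBase oneC)).1 = (suspBase (suspBase oneC)).1 := fun τ => by
    refine Prod.ext (Prod.ext (Complex.ext ?_ ?_) ?_) ?_ <;>
      simp [refl, suspBase, oneC]
  have hx : (suspBase oneC).1 = (1, 0) := rfl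
  have e0 : ∀ y, susp (suspBase oneC).1 (fun y => conjT (f y)) y =
      refl 0 (susp (suspBase oneC).1 f y) := fun y => suspPt_conjT _ _
  have e1 : ∀ y : Fin 4 → ℝ, susp (suspBase oneC).1 f (Function.update y 0 (1 - y 0)) =
      refl 1 (susp (suspBase oneC).1 f y) := fun y => by
    simp only [susp, Function.update_self, Fin.tail_update_zero]; exact suspPt_one_sub _ _
  have l0 : IsLoop (suspBase (suspBase oneC)).1 fun y => refl 0 (susp (suspBase oneC).1 f y) :=
    l'.susp.congr fun y _ => (e0 y).symm
  have l1 : IsLoop (suspBase (suspBase oneC)).1 fun y => refl 1 (susp (suspBase oneC).1 f y) :=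
    (isLoop_rev 0 l.susp).congr fun y _ => (e1 y).symm
  have key := cls_comp_eq_of_homotopy l.susp refl continuous_refl.continuousOn
    (fun τ _ v hv => refl_ne_zero τ hv) (fun τ _ => base τ) l0 l1
  rw [(isLoop_rev 0 l.susp).cls_congr l1 fun y _ => e1 y, ← key]
  exact l0.cls_congr _ fun y _ => (e0 y).symm

/-- The stem group has at most two elements. -/
theorem exists_stem_generator : ∃ g : PG 4 ((ℂ × ℝ) × ℝ) (suspBase (suspBase oneC)),
    ∀ a, a = 1 ∨ a = g := by
  obtain ⟨e⟩ := nonempty_PG_int 1 (ℂ × ℂ) (by simp [Complex.finrank_real_complex]) oneOne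
  let φ : Multiplicative ℤ →* PG 4 ((ℂ × ℝ) × ℝ) (suspBase (suspBase oneC)) :=
    ((suspHom (suspBase oneC)).comp hopfHom).comp e.symm.toMonoidHom
  have hφ : Function.Surjective φ :=
    ((suspHom_surjective (k := 2) (suspBase oneC) (by simp [Complex.finrank_real_complex])).comp
      hopfHom_surjective).comp e.symm.surjective
  refine ⟨φ (Multiplicative.ofAdd 1), fun a => ?_⟩
  obtain ⟨m, rfl⟩ := hφ a
  have hm : φ m = φ (Multiplicative.ofAdd 1) ^ m.toAdd := by
    rw [← map_zpow, ← ofAdd_zsmul]; simp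
  have h2 : φ (Multiplicative.ofAdd 1) ^ (2 : ℤ) = 1 := by
    rw [zpow_two, mul_eq_one_iff_eq_inv]; exact (stem_inv_eq _).symm
  rw [hm]
  rcases Int.even_or_odd' m.toAdd with ⟨j, hj | hj⟩
  · left; rw [hj, zpow_mul, h2, one_zpow]
  · right; rw [hj, zpow_add, zpow_mul, h2, one_zpow, one_mul, zpow_one]

/-- Reduction of the main theorem to the nontriviality of the stem group. -/
theorem pontryagin_of_nontrivial
    (h : Nontrivial (PG 4 ((ℂ × ℝ) × ℝ) (suspBase (suspBase oneC)))) (n : ℕ) (hn : 3 ≤ n)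
    (x : sphere (0 : EuclideanSpace ℝ (Fin (n + 1))) 1) :
    Nonempty ((π_ (n + 1) (sphere (0 : EuclideanSpace ℝ (Fin (n + 1))) 1) x) ≃*
      Multiplicative (ZMod 2)) := by
  obtain ⟨g, hg⟩ := exists_stem_generator
  have hcard : Nat.card (PG 4 ((ℂ × ℝ) × ℝ) (suspBase (suspBase oneC))) = 2 := by
    refine Nat.card_eq_two_iff.2 ⟨1, g, ?_, ?_⟩
    · rintro rfl
      obtain ⟨a, ha⟩ := exists_ne (1 : PG 4 ((ℂ × ℝ) × ℝ) (suspBase (suspBase oneC)))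
      rcases hg a with h | h <;> exact ha h
    · ext a; simpa using hg a
  have : Fact (Nat.Prime 2) := ⟨Nat.prime_two⟩
  let e₀ := mulEquivOfPrimeCardEq (p := 2) (G' := Multiplicative (ZMod 2)) hcard (by simp)
  obtain ⟨m, rfl⟩ : ∃ m, n = m + 3 := ⟨n - 3, by omega⟩
  obtain ⟨x', ⟨e₁⟩⟩ := nonempty_sphere_equiv (k := m + 3) x
  obtain ⟨e₂⟩ := nonempty_PG_stem_equiv m (E := (ℂ × ℝ) × ℝ)
    (by simp [Complex.finrank_real_complex])
    (suspBase (suspBase oneC)) (EuclideanSpace ℝ (Fin (m + 3 + 1))) (by simp) x'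
  exact ⟨(e₁.trans e₂).trans e₀⟩

end UpperBound

section Filling

/-- Coordinates on the complex plane of dimension two. -/
noncomputable def toC2 (w : ℝ × (Fin 3 → ℝ)) : ℂ × ℂ :=
  (⟨-w.1 + w.2 0, w.2 1⟩, ⟨-w.1 - w.2 0, w.2 2⟩)

/-- The inverse coordinates. -/
noncomputable def ofC2 (v : ℂ × ℂ) : ℝ × (Fin 3 → ℝ) :=
  (-(v.1.re + v.2.re) / 2, ![(v.1.re - v.2.re) / 2, v.1.im, v.2.im])

theorem toC2_ofC2 (v : ℂ × ℂ) : toC2 (ofC2 v) = v := by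
  refine Prod.ext (Complex.ext ?_ ?_) (Complex.ext ?_ ?_) <;> simp [toC2, ofC2] <;> ring

theorem continuous_toC2 : Continuous toC2 :=
  (continuous_mk_complex (by fun_prop) (by fun_prop)).prodMk
    (continuous_mk_complex (by fun_prop) (by fun_prop))

theorem continuous_ofC2 : Continuous ofC2 := by
  have := Complex.continuous_re
  have := Complex.continuous_im
  refine Continuous.prodMk (by fun_prop) (continuous_pi fun i => ?_)
  fin_cases i <;> simp <;> fun_prop

theorem toC2_ne_zero {w : ℝ × (Fin 3 → ℝ)} (hw : w ≠ 0) : toC2 w ≠ 0 := fun h => by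
  have h1 : -w.1 + w.2 0 = 0 := congrArg (fun v => v.1.re) h
  have h2 : w.2 1 = 0 := congrArg (fun v => v.1.im) h
  have h3 : -w.1 - w.2 0 = 0 := congrArg (fun v => v.2.re) h
  have h4 : w.2 2 = 0 := congrArg (fun v => v.2.im) h
  refine hw (Prod.ext (by simp; linarith) (funext fun i => ?_))
  fin_cases i
  · simp; linarith
  · simpa using h2
  · simpa using h4

theorem norm_ofC2_ge {v : ℂ × ℂ} (h : 6 ≤ ‖v.1‖ ∨ 6 ≤ ‖v.2‖) : 2 ≤ ‖ofC2 v‖ := by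
  set w := ofC2 v with hw
  have e : toC2 w = v := toC2_ofC2 v
  have h0 : |w.1| ≤ ‖w‖ := norm_fst_le w
  have h1 : ∀ i, |w.2 i| ≤ ‖w‖ := fun i => (norm_le_pi_norm w.2 i).trans (norm_snd_le w)
  have h10 := h1 0
  have h11 := h1 1
  have h12 := h1 2
  have a1 : ‖v.1‖ ≤ |w.1| + |w.2 0| + |w.2 1| := by
    refine (Complex.norm_le_abs_re_add_abs_im _).trans ?_
    rw [← e]
    have := abs_add_le (-w.1) (w.2 0)
    rw [abs_neg] at this
    simpa [toC2] using this
  have a2 : ‖v.2‖ ≤ |w.1| + |w.2 0| + |w.2 2| := by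
    refine (Complex.norm_le_abs_re_add_abs_im _).trans ?_
    rw [← e]
    have := abs_sub (-w.1) (w.2 0)
    rw [abs_neg] at this
    simpa [toC2] using this
  rcases h with h | h <;> linarith

/-- The radius used to collapse the boundary of a cube. -/
noncomputable def collRad (w : ℝ × (Fin 3 → ℝ)) : ℝ := min 1 (max ‖w.2‖ (1 - w.1))

/-- A map collapsing all but one face of a cube. -/
noncomputable def coll (w : ℝ × (Fin 3 → ℝ)) : ℝ × (Fin 3 → ℝ) :=
  (1 - 2 * collRad w, (1 - collRad w) • w.2)

/-- The straight-line deformation of the identity into the collapsing map. -/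
noncomputable def blend (τ : ℝ) (w : ℝ × (Fin 3 → ℝ)) : ℝ × (Fin 3 → ℝ) :=
  (1 - τ) • w + τ • coll w

theorem continuous_blend : Continuous fun p : ℝ × (ℝ × (Fin 3 → ℝ)) => blend p.1 p.2 := by
  unfold blend coll collRad; fun_prop

theorem collRad_eq_one {w : ℝ × (Fin 3 → ℝ)} (h : 1 ≤ ‖w.2‖ ∨ w.1 ≤ 0) : collRad w = 1 := by
  refine min_eq_left ?_
  rcases h with h | h
  · exact le_max_of_le_left h
  · exact le_max_of_le_right (by linarith)

theorem coll_eq {w : ℝ × (Fin 3 → ℝ)} (h : 1 ≤ ‖w.2‖ ∨ w.1 ≤ 0) : coll w = (-1, 0) := by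
  rw [coll, collRad_eq_one h]; norm_num

theorem blend_ne_zero {τ : ℝ} (hτ : τ ∈ Icc (0 : ℝ) 1) {w : ℝ × (Fin 3 → ℝ)} (hw : 1 ≤ ‖w‖) :
    blend τ w ≠ 0 := fun h => by
  have h1 : (1 - τ) * w.1 + τ * (1 - 2 * collRad w) = 0 := congrArg Prod.fst h
  have h2 : (1 - τ) • w.2 + τ • (1 - collRad w) • w.2 = 0 := congrArg Prod.snd h
  have hr : collRad w ≤ 1 := min_le_left _ _
  rw [smul_smul, ← add_smul] at h2
  have hτ' := mul_nonneg hτ.1 (sub_nonneg.2 hr)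
  rcases smul_eq_zero.1 h2 with h3 | h3
  · have t1 : τ = 1 := by linarith [hτ.2]
    rw [t1] at h3 h1
    linarith
  · rw [Prod.norm_def, h3, norm_zero, max_eq_left (norm_nonneg _), Real.norm_eq_abs] at hw
    rcases le_abs'.1 hw with hw | hw
    · rw [collRad_eq_one (Or.inr (by linarith))] at h1
      nlinarith [hτ.1, hτ.2]
    · have : collRad w = 0 := by
        rw [collRad, h3, norm_zero, max_eq_left (by linarith), min_eq_right zero_le_one]
      rw [this] at h1
      nlinarith [hτ.1, hτ.2]

theorem hopf_toC2_base : hopf (toC2 (-1, 0)) = (1, 0) := by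
  rw [← hopf_one_one]; congr 1
  refine Prod.ext (Complex.ext ?_ ?_) (Complex.ext ?_ ?_) <;> simp [toC2]

/-- The Hopf map as a map on the cube. -/
noncomputable def hopfCube (z : Fin 3 → ℝ) : ℂ × ℝ :=
  hopf (toC2 (blend 1 (1, (2 : ℝ) • z - 1)))

theorem blend_one (w : ℝ × (Fin 3 → ℝ)) : blend 1 w = coll w := by simp [blend]

theorem isLoop_hopfCube : IsLoop (suspBase oneC).1 hopfCube := by
  refine ⟨Continuous.continuousOn ?_, fun z _ => ?_, fun z _ i hi => ?_⟩
  · exact continuous_hopf.comp (continuous_toC2.comp (continuous_blend.comp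
      (f := fun z : Fin 3 → ℝ => ((1 : ℝ), ((1 : ℝ), (2 : ℝ) • z - 1))) (by fun_prop)))
  · refine hopf_ne_zero (toC2_ne_zero (blend_ne_zero ⟨zero_le_one, le_rfl⟩ ?_))
    exact (by simp : (1 : ℝ) ≤ ‖(1 : ℝ)‖).trans (norm_fst_le ((1 : ℝ), (2 : ℝ) • z - 1))
  · rw [hopfCube, blend_one, coll_eq, hopf_toC2_base]; · rfl
    left
    refine le_trans ?_ (norm_le_pi_norm ((2 : ℝ) • z - 1) i)
    rcases hi with hi | hi <;> norm_num [hi]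

/-- If the stem group vanishes then the suspended Hopf map extends over the inside of a ball. -/
theorem exists_filling
    (h : ∀ a : PG 4 ((ℂ × ℝ) × ℝ) (suspBase (suspBase oneC)), a = 1) :
    ∃ G : ℂ × ℂ → ℝ → (ℂ × ℝ) × ℝ,
      ContinuousOn (fun p : (ℂ × ℂ) × ℝ => G p.1 p.2) (univ ×ˢ Icc 0 1) ∧
      (∀ v, ∀ t ∈ Icc (0 : ℝ) 1, G v t ≠ 0) ∧
      (∀ v, ∀ t, (t = 0 ∨ t = 1) → G v t = ((1, 0), 0)) ∧
      ∀ v : ℂ × ℂ, (6 ≤ ‖v.1‖ ∨ 6 ≤ ‖v.2‖) → ∀ t, G v t = suspPt (1, 0) t (hopf v) := by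
  have hc : isLoop_hopfCube.susp.cls =
      (isLoop_const (k := 4) (suspBase (suspBase oneC)).2).cls := by
    rw [h isLoop_hopfCube.susp.cls, h (IsLoop.cls _)]
  obtain ⟨H, hH, Hc, Hn⟩ := exists_htpy hc
  let inner : (ℂ × ℂ) × ℝ → (ℂ × ℝ) × ℝ := fun p =>
    H ((1 - (ofC2 p.1).1) / 2) (Fin.cons p.2 ((1 / 2 : ℝ) • ((ofC2 p.1).2 + 1)))
  let outer : (ℂ × ℂ) × ℝ → (ℂ × ℝ) × ℝ := fun p =>
    suspPt (1, 0) p.2 (hopf (toC2 (blend (clamp (2 - ‖ofC2 p.1‖)) (ofC2 p.1))))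
  have hofc := continuous_ofC2
  have hin : Continuous inner := by
    refine Hc.comp (f := fun p : (ℂ × ℂ) × ℝ => ((1 - (ofC2 p.1).1) / 2,
      (Fin.cons p.2 ((1 / 2 : ℝ) • ((ofC2 p.1).2 + 1)) : Fin 4 → ℝ))) ?_
    refine Continuous.prodMk (by fun_prop) (continuous_cons.comp
      (f := fun p : (ℂ × ℂ) × ℝ => (p.2, (1 / 2 : ℝ) • ((ofC2 p.1).2 + 1))) (by fun_prop))
  have hout : Continuous outer := by
    have h1 := continuous_clamp
    have h2 : Continuous fun p : (ℂ × ℂ) × ℝ =>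
        hopf (toC2 (blend (clamp (2 - ‖ofC2 p.1‖)) (ofC2 p.1))) :=
      continuous_hopf.comp (continuous_toC2.comp (continuous_blend.comp
        (f := fun p : (ℂ × ℂ) × ℝ => (clamp (2 - ‖ofC2 p.1‖), ofC2 p.1)) (by fun_prop)))
    exact (continuous_suspPt ((1 : ℂ), (0 : ℝ))).comp (f := fun p : (ℂ × ℂ) × ℝ =>
      (p.2, hopf (toC2 (blend (clamp (2 - ‖ofC2 p.1‖)) (ofC2 p.1))))) (continuous_snd.prodMk h2)
  have m0 : (0 : ℝ) ∈ Icc (0 : ℝ) 1 := ⟨le_rfl, zero_le_one⟩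
  have m1 : (1 : ℝ) ∈ Icc (0 : ℝ) 1 := ⟨zero_le_one, le_rfl⟩
  have hbase : (suspBase (suspBase oneC)).1 = ((1, 0), 0) := rfl
  have mem : ∀ v : ℂ × ℂ, ‖ofC2 v‖ ≤ 1 → (1 - (ofC2 v).1) / 2 ∈ Icc (0 : ℝ) 1 ∧
      (1 / 2 : ℝ) • ((ofC2 v).2 + 1) ∈ Icc (0 : Fin 3 → ℝ) 1 := fun v hv => by
    have h0 := abs_le.1 ((norm_fst_le (ofC2 v)).trans hv)
    have h1 : ∀ i, -1 ≤ (ofC2 v).2 i ∧ (ofC2 v).2 i ≤ 1 := fun i =>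
      abs_le.1 (((norm_le_pi_norm _ i).trans (norm_snd_le (ofC2 v))).trans hv)
    refine ⟨⟨by linarith, by linarith⟩, fun i => ?_, fun i => ?_⟩
    · have := (h1 i).1
      simp; linarith
    · have := (h1 i).2
      simp; linarith
  refine ⟨fun v t => if ‖ofC2 v‖ ≤ 1 then inner (v, t) else outer (v, t), ?_, ?_, ?_, ?_⟩
  · refine continuousOn_ite_le (φ := fun p : (ℂ × ℂ) × ℝ => ‖ofC2 p.1‖) (by fun_prop)
      hin.continuousOn hout.continuousOn ?_
    rintro ⟨v, t⟩ ⟨-, ht⟩ hv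
    obtain ⟨e1, e2⟩ := mem v hv.le
    have e3 := cons_mem ht e2
    simp only [inner, outer]
    simp only at hv
    rw [hv, show (2 : ℝ) - 1 = 1 by norm_num, clamp_of_one_le le_rfl, blend_one]
    by_cases hy : ∃ i, 1 ≤ |(ofC2 v).2 i|
    · obtain ⟨i, hi⟩ := hy
      have hi' : |(ofC2 v).2 i| ≤ 1 :=
        ((norm_le_pi_norm _ i).trans (norm_snd_le (ofC2 v))).trans hv.le
      rw [coll_eq (Or.inl (hi.trans (norm_le_pi_norm (ofC2 v).2 i))), hopf_toC2_base, suspPt_base]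
      refine hH.bd _ e1 _ e3 i.succ ?_
      rcases (abs_eq zero_le_one).1 (le_antisymm hi' hi) with h | h
      · right; simp [h]; norm_num
      · left; simp [h]
    · push Not at hy
      have hy' : ‖(ofC2 v).2‖ < 1 := (pi_norm_lt_iff one_pos).2 hy
      have hx : |(ofC2 v).1| = 1 := by
        rw [Prod.norm_def] at hv
        rcases max_choice ‖(ofC2 v).1‖ ‖(ofC2 v).2‖ with h | h
        · rw [h] at hv; exact hv
        · rw [h] at hv; exact absurd hv hy'.ne
      rcases (abs_eq zero_le_one).1 hx with h | h
      · rw [h, sub_self, zero_div, hH.zero _ e3]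
        simp only [susp, Fin.cons_zero, Fin.tail_cons, hopfCube, blend_one]
        have : (2 : ℝ) • (1 / 2 : ℝ) • ((ofC2 v).2 + 1) - 1 = (ofC2 v).2 := by
          rw [smul_smul]; norm_num
        rw [this, ← h]; rfl
      · rw [coll_eq (Or.inr (by linarith)), hopf_toC2_base, suspPt_base, h,
          show (1 - -1) / 2 = (1 : ℝ) by norm_num, hH.one _ e3]
        exact hbase
  · intro v t ht
    beta_reduce
    split_ifs with hv
    · exact Hn _ _
    · refine suspPt_ne_zero (fun h => one_ne_zero (congrArg Prod.fst h)) (hopf_ne_zero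
        (toC2_ne_zero (blend_ne_zero (clamp_mem _) (not_le.1 hv).le)))
  · intro v t ht
    beta_reduce
    split_ifs with hv
    · obtain ⟨e1, e2⟩ := mem v hv
      have ht' : t ∈ Icc (0 : ℝ) 1 := by rcases ht with rfl | rfl <;> assumption
      exact hH.bd _ e1 _ (cons_mem ht' e2) 0 ht
    · simp only [outer]
      rcases ht with rfl | rfl
      · exact suspPt_zero _ _
      · exact suspPt_one _ _
  · intro v hv t
    have h2 := norm_ofC2_ge hv
    beta_reduce
    rw [if_neg (by linarith)]
    simp only [outer]
    rw [clamp_of_nonpos (by linarith)]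
    simp [blend, toC2_ofC2]

end Filling

section Permutation

variable {k : ℕ} {E : Type*} [NormedAddCommGroup E] [NormedSpace ℝ E]

theorem comp_perm_mem (e : Equiv.Perm (Fin k)) {y : Fin k → ℝ} (hy : y ∈ Icc (0 : Fin k → ℝ) 1) :
    y ∘ e ∈ Icc (0 : Fin k → ℝ) 1 :=
  ⟨fun i => hy.1 (e i), fun i => hy.2 (e i)⟩

theorem continuous_comp_perm (e : Equiv.Perm (Fin k)) :
    Continuous fun y : Fin k → ℝ => y ∘ e :=
  continuous_pi fun i => continuous_apply (e i)

theorem IsHtpy.perm (e : Equiv.Perm (Fin k)) {x : E} {f g : (Fin k → ℝ) → E}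
    {H : ℝ → (Fin k → ℝ) → E} (hH : IsHtpy x f g H) :
    IsHtpy x (fun y => f (y ∘ e)) (fun y => g (y ∘ e)) fun τ y => H τ (y ∘ e) := by
  refine ⟨?_, fun τ hτ y hy => hH.ne τ hτ _ (comp_perm_mem e hy), fun τ hτ y hy i hi =>
    hH.bd τ hτ _ (comp_perm_mem e hy) (e.symm i) (by simpa using hi),
    fun y hy => hH.zero _ (comp_perm_mem e hy), fun y hy => hH.one _ (comp_perm_mem e hy)⟩
  exact hH.cont.comp (f := fun p : ℝ × (Fin k → ℝ) => (p.1, p.2 ∘ e))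
    (continuous_fst.prodMk ((continuous_comp_perm e).comp continuous_snd)).continuousOn
    fun p hp => ⟨hp.1, comp_perm_mem e hp.2⟩

theorem IsLoop.perm (e : Equiv.Perm (Fin k)) {x : E} {f : (Fin k → ℝ) → E} (hf : IsLoop x f) :
    IsLoop x fun y => f (y ∘ e) :=
  (hf.htpy_refl.perm e).isLoop_left

theorem perm_cls_eq (e : Equiv.Perm (Fin k)) {x : {v : E // v ≠ 0}} {f g : (Fin k → ℝ) → E}
    {hf : IsLoop x.1 f} {hg : IsLoop x.1 g} (h : hf.cls = hg.cls) :
    (hf.perm e).cls = (hg.perm e).cls := by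
  obtain ⟨H, hH, -⟩ := exists_htpy h
  exact (hH.perm e).cls_eq _ _

theorem cat_perm (e : Equiv.Perm (Fin k)) (i : Fin k) (f g : (Fin k → ℝ) → E)
    (y : Fin k → ℝ) :
    cat i f g (y ∘ e) = cat (e i) (fun y => f (y ∘ e)) (fun y => g (y ∘ e)) y := by
  have h : ∀ r, Function.update (y ∘ e) i r = Function.update y (e i) r ∘ e := fun r => by
    rw [Function.update_comp_equiv]; simp
  simp only [cat, Function.comp_apply]
  rw [h, h]

/-- The action of a permutation of the coordinates on homotopy groups. -/
noncomputable def permHom (e : Equiv.Perm (Fin (k + 1))) (x : {v : E // v ≠ 0}) :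
    PG (k + 1) E x →* PG (k + 1) E x :=
  MonoidHom.mk' (fun a => ((exists_loop a).choose_spec.choose.perm e).cls) (by
    intro a b
    have ha := (exists_loop a).choose_spec.choose_spec.1
    have hb := (exists_loop b).choose_spec.choose_spec.1
    have hab := (exists_loop (a * b)).choose_spec.choose_spec.1
    set la := (exists_loop a).choose_spec.choose
    set lb := (exists_loop b).choose_spec.choose
    have h2 := isLoop_cat 0 lb la
    have h1 : (exists_loop (a * b)).choose_spec.choose.cls = h2.cls := by
      rw [hab, cls_cat 0 lb la h2, ha, hb]
    rw [perm_cls_eq e h1, ← cls_cat (e 0) (lb.perm e) (la.perm e)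
      (isLoop_cat (e 0) (lb.perm e) (la.perm e))]
    exact IsLoop.cls_congr _ _ fun y _ => cat_perm e 0 _ _ y)

theorem permHom_cls (e : Equiv.Perm (Fin (k + 1))) {x : {v : E // v ≠ 0}}
    {f : (Fin (k + 1) → ℝ) → E} (hf : IsLoop x.1 f) :
    permHom e x hf.cls = (hf.perm e).cls :=
  perm_cls_eq e (exists_loop hf.cls).choose_spec.choose_spec.1

theorem permHom_surjective (e : Equiv.Perm (Fin (k + 1))) (x : {v : E // v ≠ 0}) :
    Function.Surjective (permHom (E := E) e x) := fun a => by
  obtain ⟨f, hf, rfl, -⟩ := exists_loop a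
  refine ⟨(hf.perm e.symm).cls, ?_⟩
  rw [permHom_cls]
  exact IsLoop.cls_congr _ _ fun y _ => congrArg f (funext fun i => by simp)

end Permutation

section Pinch

variable {E : Type*} [NormedAddCommGroup E] [NormedSpace ℝ E]

/-- The map of a punctured space that collapses the closed upper half space to a point. -/
noncomputable def pin (w : E × ℝ) : E × ℝ :=
  (max (-w.2) 0 • w.1, 1 - 2 * max (-w.2) 0 / (‖w.1‖ + |w.2|))

theorem pin_of_nonneg {w : E × ℝ} (h : 0 ≤ w.2) : pin w = (0, 1) := by
  rw [pin, max_eq_right (by linarith)]; simp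

theorem pin_ne_zero (w : E × ℝ) : pin w ≠ 0 := fun h => by
  rcases le_or_gt 0 w.2 with h2 | h2
  · rw [pin_of_nonneg h2] at h
    exact one_ne_zero (congrArg Prod.snd h)
  · have e1 : max (-w.2) 0 • w.1 = 0 := congrArg Prod.fst h
    have e2 : 1 - 2 * max (-w.2) 0 / (‖w.1‖ + |w.2|) = 0 := congrArg Prod.snd h
    rw [max_eq_left (by linarith)] at e1 e2
    rcases smul_eq_zero.1 e1 with e1 | e1
    · linarith
    · rw [e1, norm_zero, abs_of_neg h2, zero_add, mul_div_assoc, div_self (by linarith)] at e2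
      norm_num at e2

theorem continuousOn_pin : ContinuousOn (pin : E × ℝ → E × ℝ) {0}ᶜ := by
  unfold pin
  have : ∀ w ∈ ({0}ᶜ : Set (E × ℝ)), ‖w.1‖ + |w.2| ≠ 0 := fun w hw h => by
    have h1 := norm_nonneg w.1
    have h2 := abs_nonneg w.2
    exact hw (Prod.ext (norm_eq_zero.1 (by linarith)) (abs_eq_zero.1 (by linarith)))
  fun_prop (disch := assumption)

end Pinch

section Join

/-- Forgetting the second coordinate. -/
def drop (v : (ℂ × ℝ) × ℝ) : ℂ × ℝ := (v.1.1, v.2)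

/-- The join-type pairing of two points. -/
noncomputable def pair (v v' : (ℂ × ℝ) × ℝ) : ((ℂ × ℝ) × (ℂ × ℝ)) × ℝ :=
  ((drop v, drop v'), max (-v.1.2) v'.1.2)

theorem continuous_pair :
    Continuous fun p : ((ℂ × ℝ) × ℝ) × ((ℂ × ℝ) × ℝ) => pair p.1 p.2 := by
  unfold pair drop; fun_prop

theorem pair_ne_zero {v v' : (ℂ × ℝ) × ℝ} (hv : v ≠ 0) (hv' : v' ≠ 0) : pair v v' ≠ 0 := fun h => by
  have h1 : v.1.1 = 0 := congrArg (fun w => w.1.1.1) h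
  have h2 : v.2 = 0 := congrArg (fun w => w.1.1.2) h
  have h3 : v'.1.1 = 0 := congrArg (fun w => w.1.2.1) h
  have h4 : v'.2 = 0 := congrArg (fun w => w.1.2.2) h
  have h5 : max (-v.1.2) v'.1.2 = 0 := congrArg Prod.snd h
  rcases max_choice (-v.1.2) v'.1.2 with e | e <;> rw [e] at h5
  · exact hv (Prod.ext (Prod.ext h1 (by simpa using h5)) h2)
  · exact hv' (Prod.ext (Prod.ext h3 h5) h4)

/-- The rotation in the plane spanned by the imaginary axis and the second coordinate. -/
noncomputable def rot (θ : ℝ) (v : (ℂ × ℝ) × ℝ) : (ℂ × ℝ) × ℝ :=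
  ((⟨v.1.1.re, Real.cos θ * v.1.1.im - Real.sin θ * v.1.2⟩,
    Real.sin θ * v.1.1.im + Real.cos θ * v.1.2), v.2)

theorem continuous_rot : Continuous fun p : ℝ × ((ℂ × ℝ) × ℝ) => rot p.1 p.2 := by
  have := Complex.continuous_re
  have := Complex.continuous_im
  unfold rot
  exact ((continuous_mk_complex (by fun_prop) (by fun_prop)).prodMk (by fun_prop)).prodMk
    (by fun_prop)

theorem rot_ne_zero (θ : ℝ) {v : (ℂ × ℝ) × ℝ} (hv : v ≠ 0) : rot θ v ≠ 0 := fun h => by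
  have h1 : v.1.1.re = 0 := congrArg (fun w => w.1.1.re) h
  have h2 := congrArg (fun w => w.1.1.im) h
  have h3 := congrArg (fun w => w.1.2) h
  have h4 : v.2 = 0 := congrArg Prod.snd h
  obtain ⟨e1, e2⟩ := rot_eq_zero (by rw [add_comm]; exact Real.sin_sq_add_cos_sq θ) h2 h3
  exact hv (Prod.ext (Prod.ext (Complex.ext h1 e1) e2) h4)

theorem rot_zero (v : (ℂ × ℝ) × ℝ) : rot 0 v = v :=
  Prod.ext (Prod.ext (Complex.ext rfl (by simp [rot])) (by simp [rot])) rfl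

theorem rot_base_snd (θ : ℝ) : (rot θ ((1, 0), 0)).1.2 = 0 := by simp [rot]

theorem rot_suspPt_snd (θ t : ℝ) (v : ℂ × ℝ) :
    (rot θ (suspPt (1, 0) t v)).1.2 =
      (1 - |1 - 2 * t|) * (Real.sin θ * v.1.im + Real.cos θ * v.2) := by
  simp [rot, suspPt]; ring

/-- The linear involution exchanging the two factors of the pairing. -/
noncomputable def swapW (w : ((ℂ × ℝ) × (ℂ × ℝ)) × ℝ) : ((ℂ × ℝ) × (ℂ × ℝ)) × ℝ :=
  (((star w.1.2.1, w.1.2.2), (star w.1.1.1, w.1.1.2)), w.2)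

theorem continuous_swapW : Continuous swapW := by unfold swapW; fun_prop

theorem swapW_swapW (w : ((ℂ × ℝ) × (ℂ × ℝ)) × ℝ) : swapW (swapW w) = w := by simp [swapW]

theorem swapW_ne_zero {w : ((ℂ × ℝ) × (ℂ × ℝ)) × ℝ} (hw : w ≠ 0) : swapW w ≠ 0 := fun h => by
  refine hw ?_
  rw [← swapW_swapW w, h]; simp [swapW]

theorem pin_swapW (w : ((ℂ × ℝ) × (ℂ × ℝ)) × ℝ) : pin (swapW w) = swapW (pin w) := by
  have : ‖(swapW w).1‖ = ‖w.1‖ := by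
    simp [swapW, Prod.norm_def]; exact max_comm _ _
  rw [pin, this]
  simp [pin, swapW]

theorem pair_rot_pi (v v' : (ℂ × ℝ) × ℝ) :
    pair (rot Real.pi v) (rot Real.pi v') = swapW (pair v' v) := by
  refine Prod.ext (Prod.ext (Prod.ext (Complex.ext ?_ ?_) ?_) (Prod.ext (Complex.ext ?_ ?_) ?_)) ?_
    <;> simp [pair, rot, swapW, drop, max_comm]

/-- A map that is a suspended Hopf map outside a ball. -/
structure IsFilling (G : ℂ × ℂ → ℝ → (ℂ × ℝ) × ℝ) : Prop where
  cont : ContinuousOn (fun p : (ℂ × ℂ) × ℝ => G p.1 p.2) (univ ×ˢ Icc 0 1)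
  ne : ∀ v, ∀ t ∈ Icc (0 : ℝ) 1, G v t ≠ 0
  bd : ∀ v t, (t = 0 ∨ t = 1) → G v t = ((1, 0), 0)
  out : ∀ v : ℂ × ℂ, (6 ≤ ‖v.1‖ ∨ 6 ≤ ‖v.2‖) → ∀ t, G v t = suspPt (1, 0) t (hopf v)

/-- The pairing of two points of a filling over the same point. -/
noncomputable def fiberPair (G : ℂ × ℂ → ℝ → (ℂ × ℝ) × ℝ) (θ : ℝ) (v : ℂ × ℂ) (s t : ℝ) :
    ((ℂ × ℝ) × (ℂ × ℝ)) × ℝ :=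
  pin (pair (rot θ (G v s)) (rot θ (G v t)))

variable {G : ℂ × ℂ → ℝ → (ℂ × ℝ) × ℝ}

theorem fiberPair_ne (G : ℂ × ℂ → ℝ → (ℂ × ℝ) × ℝ) (θ : ℝ) (v : ℂ × ℂ) (s t : ℝ) :
    fiberPair G θ v s t ≠ 0 :=
  pin_ne_zero _

theorem IsFilling.continuousOn_fiberPair (hG : IsFilling G) {X : Type*} [TopologicalSpace X]
    {S : Set X} {θ s t : X → ℝ} {v : X → ℂ × ℂ} (hθ : ContinuousOn θ S) (hv : ContinuousOn v S)
    (hs : ContinuousOn s S) (ht : ContinuousOn t S) (hs' : ∀ x ∈ S, s x ∈ Icc (0 : ℝ) 1)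
    (ht' : ∀ x ∈ S, t x ∈ Icc (0 : ℝ) 1) :
    ContinuousOn (fun x => fiberPair G (θ x) (v x) (s x) (t x)) S := by
  have h : ∀ r : X → ℝ, ContinuousOn r S → (∀ x ∈ S, r x ∈ Icc (0 : ℝ) 1) →
      ContinuousOn (fun x => rot (θ x) (G (v x) (r x))) S := fun r hr hr' =>
    continuous_rot.comp_continuousOn (f := fun x => (θ x, G (v x) (r x)))
      (hθ.prodMk (hG.cont.comp (f := fun x => (v x, r x)) (hv.prodMk hr)
        fun x hx => ⟨mem_univ _, hr' x hx⟩))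
  refine continuousOn_pin.comp (f := fun x => pair (rot (θ x) (G (v x) (s x)))
    (rot (θ x) (G (v x) (t x)))) ?_ fun x hx => pair_ne_zero
      (rot_ne_zero _ (hG.ne _ _ (hs' x hx))) (rot_ne_zero _ (hG.ne _ _ (ht' x hx)))
  exact continuous_pair.comp_continuousOn
    (f := fun x => (rot (θ x) (G (v x) (s x)), rot (θ x) (G (v x) (t x))))
    ((h s hs hs').prodMk (h t ht ht'))

/-- The parameters for which the paired points are in the collapsed region. -/
def Special (s t : ℝ) : Prop := s = 0 ∨ s = 1 ∨ t = 0 ∨ t = 1 ∨ s = t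

theorem IsFilling.fiberPair_special (hG : IsFilling G) (θ : ℝ) (v : ℂ × ℂ) {s t : ℝ}
    (h : Special s t) : fiberPair G θ v s t = (0, 1) := by
  refine pin_of_nonneg ?_
  have h1 : (s = 0 ∨ s = 1) → 0 ≤ (pair (rot θ (G v s)) (rot θ (G v t))).2 := fun h => by
    refine le_max_of_le_left ?_
    rw [hG.bd v s h, rot_base_snd, neg_zero]
  have h2 : (t = 0 ∨ t = 1) → 0 ≤ (pair (rot θ (G v s)) (rot θ (G v t))).2 := fun h => by
    refine le_max_of_le_right ?_
    rw [hG.bd v t h, rot_base_snd]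
  rcases h with h | h | h | h | h
  · exact h1 (Or.inl h)
  · exact h1 (Or.inr h)
  · exact h2 (Or.inl h)
  · exact h2 (Or.inr h)
  · subst h
    rcases le_total 0 (rot θ (G v s)).1.2 with h | h
    · exact le_max_of_le_right h
    · exact le_max_of_le_left (by linarith)

theorem IsFilling.fiberPair_out (hG : IsFilling G) (θ : ℝ) {v : ℂ × ℂ}
    (hv : 6 ≤ ‖v.1‖ ∨ 6 ≤ ‖v.2‖) {s t : ℝ} (hs : s ∈ Icc (0 : ℝ) 1) (ht : t ∈ Icc (0 : ℝ) 1) :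
    fiberPair G θ v s t = (0, 1) := by
  refine pin_of_nonneg ?_
  simp only [pair]
  rw [hG.out v hv s, hG.out v hv t, rot_suspPt_snd, rot_suspPt_snd]
  have h1 := sub_nonneg.2 (abs_coord_le hs)
  have h2 := sub_nonneg.2 (abs_coord_le ht)
  rcases le_total 0 (Real.sin θ * (hopf v).1.im + Real.cos θ * (hopf v).2) with h | h
  · exact le_max_of_le_right (mul_nonneg h2 h)
  · exact le_max_of_le_left (neg_nonneg.2 (mul_nonpos_of_nonneg_of_nonpos h1 h))

/-- The base point of the target of the pairing. -/
def baseW : {w : ((ℂ × ℝ) × (ℂ × ℝ)) × ℝ // w ≠ 0} :=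
  ⟨(0, 1), fun h => one_ne_zero (congrArg Prod.snd h)⟩

/-- The first four coordinates of the cube as coordinates of a complex plane. -/
noncomputable def planePt (y : Fin 6 → ℝ) : ℂ × ℂ :=
  (⟨6 * (2 * y 0 - 1), 6 * (2 * y 1 - 1)⟩, ⟨6 * (2 * y 2 - 1), 6 * (2 * y 3 - 1)⟩)

theorem continuous_planePt : Continuous planePt :=
  (continuous_mk_complex (by fun_prop) (by fun_prop)).prodMk
    (continuous_mk_complex (by fun_prop) (by fun_prop))

theorem norm_planePt_of_boundary {y : Fin 6 → ℝ} {i : Fin 6} (hi : y i = 0 ∨ y i = 1)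
    (h4 : i ≠ 4) (h5 : i ≠ 5) : 6 ≤ ‖(planePt y).1‖ ∨ 6 ≤ ‖(planePt y).2‖ := by
  have hr : |6 * (2 * y i - 1)| = 6 := by rcases hi with hi | hi <;> norm_num [hi]
  fin_cases i
  · exact Or.inl (hr.ge.trans (Complex.abs_re_le_norm (planePt y).1))
  · exact Or.inl (hr.ge.trans (Complex.abs_im_le_norm (planePt y).1))
  · exact Or.inr (hr.ge.trans (Complex.abs_re_le_norm (planePt y).2))
  · exact Or.inr (hr.ge.trans (Complex.abs_im_le_norm (planePt y).2))
  · exact absurd rfl h4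
  · exact absurd rfl h5

/-- Homotopies of loops obtained by moving the two parameters of the pairing. -/
theorem IsFilling.isHtpy (hG : IsFilling G) {θ : ℝ → ℝ} {p q : ℝ → ℝ → ℝ → ℝ}
    (hθ : Continuous θ) (hp : Continuous fun z : ℝ × ℝ × ℝ => p z.1 z.2.1 z.2.2)
    (hq : Continuous fun z : ℝ × ℝ × ℝ => q z.1 z.2.1 z.2.2)
    (hm : ∀ τ ∈ Icc (0 : ℝ) 1, ∀ s ∈ Icc (0 : ℝ) 1, ∀ t ∈ Icc (0 : ℝ) 1,
      p τ s t ∈ Icc (0 : ℝ) 1 ∧ q τ s t ∈ Icc (0 : ℝ) 1)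
    (hb : ∀ τ s t, (s = 0 ∨ s = 1 ∨ t = 0 ∨ t = 1) → Special (p τ s t) (q τ s t)) :
    IsHtpy baseW.1 (fun y => fiberPair G (θ 0) (planePt y) (p 0 (y 4) (y 5)) (q 0 (y 4) (y 5)))
      (fun y => fiberPair G (θ 1) (planePt y) (p 1 (y 4) (y 5)) (q 1 (y 4) (y 5)))
      fun τ y => fiberPair G (θ τ) (planePt y) (p τ (y 4) (y 5)) (q τ (y 4) (y 5)) := by
  have hm' : ∀ τ ∈ Icc (0 : ℝ) 1, ∀ y ∈ Icc (0 : Fin 6 → ℝ) 1,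
      p τ (y 4) (y 5) ∈ Icc (0 : ℝ) 1 ∧ q τ (y 4) (y 5) ∈ Icc (0 : ℝ) 1 := fun τ hτ y hy =>
    hm τ hτ _ ⟨hy.1 4, hy.2 4⟩ _ ⟨hy.1 5, hy.2 5⟩
  have hz : Continuous fun x : ℝ × (Fin 6 → ℝ) => (x.1, x.2 4, x.2 5) := by fun_prop
  refine ⟨?_, fun τ hτ y hy => fiberPair_ne _ _ _ _ _, ?_,
    fun _ _ => rfl, fun _ _ => rfl⟩
  · exact hG.continuousOn_fiberPair (hθ.comp continuous_fst).continuousOn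
      (continuous_planePt.comp continuous_snd).continuousOn (hp.comp hz).continuousOn
      (hq.comp hz).continuousOn (fun x hx => (hm' _ hx.1 _ hx.2).1)
      fun x hx => (hm' _ hx.1 _ hx.2).2
  · intro τ hτ y hy i hi
    by_cases h4 : i = 4
    · subst h4
      exact hG.fiberPair_special _ _ (hb _ _ _ (hi.elim Or.inl fun h => Or.inr (Or.inl h)))
    by_cases h5 : i = 5
    · subst h5
      exact hG.fiberPair_special _ _ (hb _ _ _ (Or.inr (Or.inr hi)))
    · exact hG.fiberPair_out _ (norm_planePt_of_boundary hi h4 h5) (hm' τ hτ y hy).1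
        (hm' τ hτ y hy).2

end Join

section Square

theorem eq_or_eq_inv_of_surjective {A : Type*} [Group A] (e : A ≃* Multiplicative ℤ)
    (α : A →* A) (hα : Function.Surjective α) (a : A) : α a = a ∨ α a = a⁻¹ := by
  let β : ℤ →+ ℤ := MonoidHom.toAdditive (e.toMonoidHom.comp (α.comp e.symm.toMonoidHom))
  have hβ : ∀ m, β m = m * β 1 := fun m => by
    rw [← smul_eq_mul, ← map_zsmul, smul_eq_mul, mul_one]
  have key : ∀ a, Multiplicative.toAdd (e (α a)) = Multiplicative.toAdd (e a) * β 1 := fun a => by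
    rw [← hβ]
    change _ = Multiplicative.toAdd (e (α (e.symm (e a))))
    rw [MulEquiv.symm_apply_apply]
  have hu : IsUnit (β 1) := by
    obtain ⟨b, hb⟩ := hα (e.symm (Multiplicative.ofAdd 1))
    have := key b
    rw [hb] at this
    refine IsUnit.of_mul_eq_one (Multiplicative.toAdd (e b)) ?_
    rw [mul_comm, ← this]; simp
  rcases Int.isUnit_iff.1 hu with h | h
  · left
    refine e.injective (Multiplicative.toAdd.injective ?_)
    rw [key, h, mul_one]
  · right
    refine e.injective (Multiplicative.toAdd.injective ?_)
    rw [key, h, map_inv]; simp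

variable {G : ℂ × ℂ → ℝ → (ℂ × ℝ) × ℝ}

/-- The loop of pairs of points of a filling over the same point. -/
noncomputable def fiberLoop (G : ℂ × ℂ → ℝ → (ℂ × ℝ) × ℝ) (y : Fin 6 → ℝ) :
    ((ℂ × ℝ) × (ℂ × ℝ)) × ℝ :=
  fiberPair G 0 (planePt y) (y 4) (y 5)

/-- The part of the loop of pairs below the diagonal. -/
noncomputable def lowerLoop (G : ℂ × ℂ → ℝ → (ℂ × ℝ) × ℝ) (y : Fin 6 → ℝ) :
    ((ℂ × ℝ) × (ℂ × ℝ)) × ℝ :=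
  fiberPair G 0 (planePt y) (y 4 * y 5) (y 5)

/-- The part of the loop of pairs above the diagonal. -/
noncomputable def upperLoop (G : ℂ × ℂ → ℝ → (ℂ × ℝ) × ℝ) (y : Fin 6 → ℝ) :
    ((ℂ × ℝ) × (ℂ × ℝ)) × ℝ :=
  fiberPair G 0 (planePt y) (y 5 + (1 - y 5) * y 4) (y 5)

theorem mul_mem_Icc {s t : ℝ} (hs : s ∈ Icc (0 : ℝ) 1) (ht : t ∈ Icc (0 : ℝ) 1) :
    s * t ∈ Icc (0 : ℝ) 1 :=
  ⟨mul_nonneg hs.1 ht.1, mul_le_one₀ hs.2 ht.1 ht.2⟩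

theorem join_mem_Icc {s t : ℝ} (hs : s ∈ Icc (0 : ℝ) 1) (ht : t ∈ Icc (0 : ℝ) 1) :
    t + (1 - t) * s ∈ Icc (0 : ℝ) 1 := by
  obtain ⟨h1, h2⟩ := hs
  obtain ⟨h3, h4⟩ := ht
  constructor <;> nlinarith

theorem IsFilling.isHtpy_split (hG : IsFilling G) :
    ∃ H, IsHtpy baseW.1 (fiberLoop G) (cat 4 (lowerLoop G) (upperLoop G)) H := by
  have hr := continuous_reparam
  have h := hG.isHtpy (θ := fun _ => 0) (p := fun τ s t => (1 - τ) * s + τ * reparam t s)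
    (q := fun _ _ t => t) continuous_const
    (((continuous_const.sub continuous_fst).mul (continuous_fst.comp continuous_snd)).add
      (continuous_fst.mul (hr.comp (f := fun z : ℝ × ℝ × ℝ => (z.2.2, z.2.1)) (by fun_prop))))
    (by fun_prop)
    (fun τ hτ s hs t ht => ⟨segment_mem hτ hs (reparam_mem ht hs), ht⟩) (by
      rintro τ s t (rfl | rfl | rfl | rfl)
      · left; rw [reparam_of_le (by norm_num)]; ring
      · right; left; rw [reparam_of_ge (by norm_num)]; ring
      · exact Or.inr (Or.inr (Or.inl rfl))
      · exact Or.inr (Or.inr (Or.inr (Or.inl rfl))))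
  refine ⟨_, h.cont, h.ne, h.bd, fun y hy => ?_, fun y hy => ?_⟩
  · simp [fiberLoop]
  · have hd : ∀ r, planePt (Function.update y 4 r) = planePt y := fun r => rfl
    simp only [cat, lowerLoop, upperLoop, hd, Function.update_self]
    have h5 : ∀ r, Function.update y 4 r 5 = y 5 := fun r => rfl
    rw [h5, h5, sub_self, zero_mul, zero_add, one_mul]
    split_ifs with h
    · rw [reparam_of_le h]; congr 1; ring
    · rw [reparam_of_ge (not_le.1 h).le]

theorem IsFilling.isHtpy_rot (hG : IsFilling G) :
    ∃ H, IsHtpy baseW.1 (lowerLoop G)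
      (fun y => swapW (fiberPair G 0 (planePt y) (y 5) (y 4 * y 5))) H := by
  have h := hG.isHtpy (θ := fun τ => Real.pi * τ) (p := fun _ s t => s * t)
    (q := fun _ _ t => t) (by fun_prop) (by fun_prop) (by fun_prop)
    (fun τ hτ s hs t ht => ⟨mul_mem_Icc hs ht, ht⟩) (by
      rintro τ s t (rfl | rfl | rfl | rfl)
      · left; ring
      · right; right; right; right; ring
      · exact Or.inr (Or.inr (Or.inl rfl))
      · exact Or.inr (Or.inr (Or.inr (Or.inl rfl))))
  refine ⟨_, h.cont, h.ne, h.bd, fun y hy => ?_, fun y hy => ?_⟩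
  · simp [lowerLoop]
  · simp only [mul_one, fiberPair, pair_rot_pi, pin_swapW, rot_zero]

theorem IsFilling.isHtpy_shear (hG : IsFilling G) :
    ∃ H, IsHtpy baseW.1 (fun y => fiberPair G 0 (planePt y) (y 5) (y 4 * y 5))
      (fun y => upperLoop G (y ∘ Equiv.swap 4 5)) H := by
  have h := hG.isHtpy (θ := fun _ => 0) (p := fun τ s t => (1 - τ) * t + τ * (s + (1 - s) * t))
    (q := fun τ s t => (1 - τ) * (s * t) + τ * s) (by fun_prop) (by fun_prop) (by fun_prop)
    (fun τ hτ s hs t ht => ⟨segment_mem hτ ht (join_mem_Icc ht hs),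
      segment_mem hτ (mul_mem_Icc hs ht) hs⟩) (by
      rintro τ s t (rfl | rfl | rfl | rfl)
      · right; right; left; ring
      · right; right; right; right; ring
      · right; right; right; right; ring
      · right; left; ring)
  refine ⟨_, h.cont, h.ne, h.bd, fun y hy => ?_, fun y hy => ?_⟩
  · simp
  · have hd : planePt (y ∘ Equiv.swap 4 5) = planePt y := rfl
    have h4 : (y ∘ Equiv.swap 4 5) 4 = y 5 := rfl
    have h5 : (y ∘ Equiv.swap 4 5) 5 = y 4 := rfl
    rw [upperLoop, hd, h4, h5]
    simp

theorem swapW_base : swapW baseW.1 = baseW.1 := by simp [swapW, baseW]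

theorem pmap_swapW_surjective : Function.Surjective (pmap (k := 5) (x := baseW) (x' := baseW)
    continuous_swapW.continuousOn (fun _ => swapW_ne_zero) swapW_base) := fun a => by
  obtain ⟨f, hf, rfl, -⟩ := exists_loop a
  refine ⟨(hf.comp continuous_swapW.continuousOn (fun _ => swapW_ne_zero) swapW_base).cls, ?_⟩
  rw [pmap_cls]
  exact IsLoop.cls_congr _ _ fun y _ => swapW_swapW _

theorem nonempty_PG_baseW : Nonempty (PG 6 _ baseW ≃* Multiplicative ℤ) :=
  nonempty_PG_int 4 _ (by simp) baseW

/-- The class of the loop of pairs of a filling is a square. -/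
theorem IsFilling.exists_sq (hG : IsFilling G) (hM : IsLoop baseW.1 (fiberLoop G)) :
    ∃ a : PG 6 _ baseW, hM.cls = a ^ 2 := by
  obtain ⟨e⟩ := nonempty_PG_baseW
  obtain ⟨_, h1⟩ := hG.isHtpy_split
  obtain ⟨_, h2⟩ := hG.isHtpy_rot
  obtain ⟨_, h3⟩ := hG.isHtpy_shear
  have hL := h2.isLoop_left
  have hV := h3.isLoop_left
  have hU : IsLoop baseW.1 (upperLoop G) :=
    (h3.isLoop_right.perm (Equiv.swap 4 5)).congr fun y _ => by
      congr 1; funext i; simp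
  let α : PG 6 _ baseW →* PG 6 _ baseW := (pmap (k := 5) (x := baseW) (x' := baseW)
    continuous_swapW.continuousOn (fun _ => swapW_ne_zero) swapW_base).comp
      (permHom (k := 5) (Equiv.swap 4 5) baseW)
  have hα : Function.Surjective α := pmap_swapW_surjective.comp (permHom_surjective _ _)
  have e1 : hM.cls = hU.cls * hL.cls := by
    rw [← cls_cat 4 hL hU (isLoop_cat 4 hL hU)]; exact h1.cls_eq _ _
  have e2 : hL.cls = α hU.cls := by
    refine (h2.cls_eq hL h2.isLoop_right).trans ?_
    simp only [α, MonoidHom.comp_apply]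
    rw [permHom_cls, ← h3.cls_eq hV (hU.perm _), pmap_cls]
  rcases eq_or_eq_inv_of_surjective e α hα hU.cls with h | h
  · exact ⟨hU.cls, by rw [e1, e2, h, sq]⟩
  · exact ⟨1, by rw [e1, e2, h, mul_inv_cancel, one_pow]⟩

end Square

section Degree

/-- Centered coordinates on the cube. -/
noncomputable def center (y : Fin 6 → ℝ) : Fin 6 → ℝ := fun i => 2 * y i - 1

/-- The linear isomorphism of real coordinates onto the first factor. -/
noncomputable def emb (w : Fin 6 → ℝ) : (ℂ × ℝ) × (ℂ × ℝ) :=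
  ((⟨w 2, -w 3⟩, -w 4), (⟨w 0, w 1⟩, -w 5))

/-- The inverse of the linear isomorphism onto the first factor. -/
noncomputable def coords (v : (ℂ × ℝ) × (ℂ × ℝ)) : Fin 6 → ℝ :=
  ![v.2.1.re, v.2.1.im, v.1.1.re, -v.1.1.im, -v.1.2, -v.2.2]

theorem coords_smul_emb (r : ℝ) (w : Fin 6 → ℝ) : coords (r • emb w) = r • w := by
  funext i; fin_cases i <;> simp [coords, emb]

theorem coords_emb (w : Fin 6 → ℝ) : coords (emb w) = w := by
  simpa using coords_smul_emb 1 w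

theorem continuous_center : Continuous center := by unfold center; fun_prop

theorem continuous_emb : Continuous emb :=
  ((continuous_mk_complex (by fun_prop) (by fun_prop)).prodMk (by fun_prop)).prodMk
    ((continuous_mk_complex (by fun_prop) (by fun_prop)).prodMk (by fun_prop))

theorem continuous_coords : Continuous coords := by
  have := Complex.continuous_re
  have := Complex.continuous_im
  refine continuous_pi fun i => ?_
  fin_cases i <;> simp [coords] <;> fun_prop

theorem coords_eq_zero {v : (ℂ × ℝ) × (ℂ × ℝ)} (h : coords v = 0) : v = 0 := by
  have h' : ∀ i, coords v i = 0 := fun i => congrFun h i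
  have h0 := h' 0
  have h1 := h' 1
  have h2 := h' 2
  have h3 := h' 3
  have h4 := h' 4
  have h5 := h' 5
  simp [coords] at h0 h1 h2 h3 h4 h5
  exact Prod.ext (Prod.ext (Complex.ext h2 h3) h4) (Prod.ext (Complex.ext h0 h1) h5)

theorem norm_center_le {y : Fin 6 → ℝ} (hy : y ∈ Icc (0 : Fin 6 → ℝ) 1) : ‖center y‖ ≤ 1 := by
  refine (pi_norm_le_iff_of_nonneg zero_le_one).2 fun i => abs_le.2 ⟨?_, ?_⟩
  · have := hy.1 i
    simp only [Pi.zero_apply] at this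
    simp only [center]; linarith
  · have := hy.2 i
    simp only [Pi.one_apply] at this
    simp only [center]; linarith

theorem norm_center_of_boundary {y : Fin 6 → ℝ} (hy : y ∈ Icc (0 : Fin 6 → ℝ) 1) {i : Fin 6}
    (hi : y i = 0 ∨ y i = 1) : ‖center y‖ = 1 := by
  refine le_antisymm (norm_center_le hy) ?_
  refine le_trans ?_ (norm_le_pi_norm (center y) i)
  rcases hi with hi | hi <;> norm_num [center, hi]

/-- The loop of degree one. -/
noncomputable def stdPt (y : Fin 6 → ℝ) : ((ℂ × ℝ) × (ℂ × ℝ)) × ℝ :=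
  (emb (center y), ‖center y‖ - 1)

theorem continuous_stdPt : Continuous stdPt :=
  (continuous_emb.comp continuous_center).prodMk (continuous_center.norm.sub continuous_const)

theorem stdPt_ne_zero (y : Fin 6 → ℝ) : stdPt y ≠ 0 := fun h => by
  have h1 : emb (center y) = 0 := congrArg Prod.fst h
  have h2 : ‖center y‖ - 1 = 0 := congrArg Prod.snd h
  have h3 : center y = 0 := by rw [← coords_emb (center y), h1]; simpa using coords_smul_emb 0 0
  rw [h3] at h2; norm_num at h2

/-- The extension of a loop to a self-map of the punctured space. -/
noncomputable def extend (g : (Fin 6 → ℝ) → ((ℂ × ℝ) × (ℂ × ℝ)) × ℝ)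
    (w : ((ℂ × ℝ) × (ℂ × ℝ)) × ℝ) : ((ℂ × ℝ) × (ℂ × ℝ)) × ℝ :=
  if ‖coords w.1‖ + w.2 ≤ 0 then g ((1 / 2 : ℝ) • ((1 / (-w.2)) • coords w.1 + 1)) else (0, 1)

theorem extend_mem {w : ((ℂ × ℝ) × (ℂ × ℝ)) × ℝ} (hw : w ≠ 0) (h : ‖coords w.1‖ + w.2 ≤ 0) :
    w.2 < 0 ∧ (1 / 2 : ℝ) • ((1 / (-w.2)) • coords w.1 + 1) ∈ Icc (0 : Fin 6 → ℝ) 1 := by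
  have hn := norm_nonneg (coords w.1)
  have h0 : w.2 < 0 := by
    refine lt_of_le_of_ne (by linarith) fun h0 => hw (Prod.ext (coords_eq_zero ?_) h0)
    exact norm_eq_zero.1 (by linarith)
  have hi : ∀ i, |coords w.1 i / (-w.2)| ≤ 1 := fun i => by
    rw [abs_div, abs_of_pos (show 0 < -w.2 by linarith), div_le_one (by linarith)]
    exact (norm_le_pi_norm (coords w.1) i).trans (by linarith)
  refine ⟨h0, fun i => ?_, fun i => ?_⟩
  · have := (abs_le.1 (hi i)).1
    simp only [Pi.zero_apply, Pi.smul_apply, Pi.add_apply, Pi.one_apply, smul_eq_mul]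
    rw [one_div_mul_eq_div (-w.2)]; linarith
  · have := (abs_le.1 (hi i)).2
    simp only [Pi.smul_apply, Pi.add_apply, Pi.one_apply, smul_eq_mul]
    rw [one_div_mul_eq_div (-w.2)]; linarith

theorem extend_eq_base {g : (Fin 6 → ℝ) → ((ℂ × ℝ) × (ℂ × ℝ)) × ℝ} (hg : IsLoop baseW.1 g)
    {w : ((ℂ × ℝ) × (ℂ × ℝ)) × ℝ} (hw : w ≠ 0) (h : ‖coords w.1‖ + w.2 = 0) :
    g ((1 / 2 : ℝ) • ((1 / (-w.2)) • coords w.1 + 1)) = (0, 1) := by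
  obtain ⟨h0, hm⟩ := extend_mem hw h.le
  obtain ⟨i, hi⟩ := Finite.exists_max (fun i => ‖coords w.1 i‖)
  have he : |coords w.1 i| = -w.2 := by
    refine le_antisymm ((norm_le_pi_norm (coords w.1) i).trans (by linarith)) ?_
    have := (pi_norm_le_iff_of_nonneg (norm_nonneg _)).2 hi
    exact le_trans (by linarith) this
  refine hg.bd _ hm i ?_
  simp only [Pi.smul_apply, Pi.add_apply, Pi.one_apply, smul_eq_mul]
  rw [one_div_mul_eq_div (-w.2)]
  rcases abs_choice (coords w.1 i) with h' | h' <;> rw [h'] at he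
  · right; rw [he, div_self (by linarith)]; norm_num
  · left; rw [show coords w.1 i = -(-w.2) by linarith, neg_div, div_self (by linarith)]; norm_num

theorem continuousOn_extend {g : (Fin 6 → ℝ) → ((ℂ × ℝ) × (ℂ × ℝ)) × ℝ}
    (hg : IsLoop baseW.1 g) : ContinuousOn (extend g) {0}ᶜ := by
  have hc := continuous_coords
  refine continuousOn_ite_le (φ := fun w : ((ℂ × ℝ) × (ℂ × ℝ)) × ℝ => ‖coords w.1‖ + w.2)
    (by fun_prop) ?_ continuousOn_const fun w hw h => extend_eq_base hg hw h
  refine hg.cont.comp (f := fun w : ((ℂ × ℝ) × (ℂ × ℝ)) × ℝ =>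
    (1 / 2 : ℝ) • ((1 / (-w.2)) • coords w.1 + 1)) ?_ fun w hw => (extend_mem hw.1 hw.2).2
  have h : ∀ w ∈ {0}ᶜ ∩ {w : ((ℂ × ℝ) × (ℂ × ℝ)) × ℝ | ‖coords w.1‖ + w.2 ≤ 0}, -w.2 ≠ 0 :=
    fun w hw => by linarith [(extend_mem hw.1 hw.2).1]
  fun_prop (disch := assumption)

theorem extend_ne_zero {g : (Fin 6 → ℝ) → ((ℂ × ℝ) × (ℂ × ℝ)) × ℝ} (hg : IsLoop baseW.1 g)
    (w : ((ℂ × ℝ) × (ℂ × ℝ)) × ℝ) (hw : w ≠ 0) : extend g w ≠ 0 := by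
  unfold extend
  split_ifs with h
  · exact hg.ne _ (extend_mem hw h).2
  · exact baseW.2

theorem extend_base (g : (Fin 6 → ℝ) → ((ℂ × ℝ) × (ℂ × ℝ)) × ℝ) :
    extend g baseW.1 = baseW.1 := by
  rw [extend, if_neg]; · rfl
  have := norm_nonneg (coords baseW.1.1)
  simp only [baseW] at this ⊢
  linarith

/-- The standard loop is universal among all loops. -/
theorem isHtpy_extend {g : (Fin 6 → ℝ) → ((ℂ × ℝ) × (ℂ × ℝ)) × ℝ} (hg : IsLoop baseW.1 g) :
    ∃ H, IsHtpy baseW.1 (fun y => extend g (pin (stdPt y))) g H := by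
  have hp : Continuous fun y => pin (stdPt y) :=
    continuousOn_pin.comp_continuous continuous_stdPt stdPt_ne_zero
  let P : ℝ → (Fin 6 → ℝ) → ((ℂ × ℝ) × (ℂ × ℝ)) × ℝ := fun τ y =>
    (1 - τ) • pin (stdPt y) + τ • (emb (center y), (-1 : ℝ))
  have hPc : Continuous fun p : ℝ × (Fin 6 → ℝ) => P p.1 p.2 := by
    have h1 := continuous_emb
    have h2 := continuous_center
    exact ((continuous_const.sub continuous_fst).smul (hp.comp continuous_snd)).add
      (continuous_fst.smul ((h1.comp (h2.comp continuous_snd)).prodMk continuous_const))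
  have hb : ∀ y, ‖center y‖ = 1 → ∀ τ, P τ y = (τ • emb (center y), 1 - 2 * τ) := by
    intro y hy τ
    simp only [P]
    rw [pin_of_nonneg (by rw [stdPt, hy, sub_self])]
    refine Prod.ext (by simp) ?_
    simp; ring
  have hPn : ∀ τ ∈ Icc (0 : ℝ) 1, ∀ y ∈ Icc (0 : Fin 6 → ℝ) 1, P τ y ≠ 0 := by
    intro τ hτ y hy h
    have hle := norm_center_le hy
    have h1 : (1 - τ) • max (-(‖center y‖ - 1)) 0 • emb (center y) + τ • emb (center y) = 0 :=
      congrArg Prod.fst h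
    rw [max_eq_left (by linarith), smul_smul, ← add_smul] at h1
    have h2 := coords_smul_emb ((1 - τ) * -(‖center y‖ - 1) + τ) (center y)
    rw [h1, show (0 : (ℂ × ℝ) × (ℂ × ℝ)) = (0 : ℝ) • emb 0 by simp, coords_smul_emb,
      zero_smul] at h2
    have h3 : 0 ≤ (1 - τ) * -(‖center y‖ - 1) :=
      mul_nonneg (by linarith [hτ.2]) (by linarith)
    rcases smul_eq_zero.1 h2.symm with h4 | h4
    · have hτ0 : τ = 0 := by linarith [hτ.1]
      simp only [P, hτ0, sub_zero, one_smul, zero_smul, add_zero] at h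
      exact pin_ne_zero _ h
    · have h5 : (1 - τ) * (1 - 2 * max (-(‖center y‖ - 1)) 0 / (‖emb (center y)‖ +
        |‖center y‖ - 1|)) + τ * (-1) = 0 := congrArg Prod.snd h
      have e0 : emb 0 = 0 := coords_eq_zero (coords_emb 0)
      rw [h4, e0] at h5
      norm_num at h5
      linarith
  refine ⟨fun τ y => extend g (P τ y), ?_, fun τ hτ y hy => extend_ne_zero hg _ (hPn τ hτ y hy),
    ?_, fun y hy => ?_, fun y hy => ?_⟩
  · exact (continuousOn_extend hg).comp (f := fun p : ℝ × (Fin 6 → ℝ) => P p.1 p.2)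
      hPc.continuousOn fun p hp => hPn _ hp.1 _ hp.2
  · intro τ hτ y hy i hi
    have h1 := norm_center_of_boundary hy hi
    have hn := hPn τ hτ y hy
    have h2 : ‖coords (P τ y).1‖ + (P τ y).2 = 1 - τ := by
      rw [hb y h1, coords_smul_emb, norm_smul, h1, Real.norm_of_nonneg hτ.1]; ring
    unfold extend
    split_ifs with h
    · exact extend_eq_base hg hn (le_antisymm h (by rw [h2]; linarith [hτ.2]))
    · rfl
  · simp only [P, sub_zero, one_smul, zero_smul, add_zero]
  · have h1 : P 1 y = (emb (center y), -1) := by simp [P]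
    have h2 := norm_center_le hy
    simp only [extend, h1]
    rw [coords_emb, if_pos (by linarith)]
    congr 1
    funext i
    simp [center]

end Degree

section Linking

variable {G : ℂ × ℂ → ℝ → (ℂ × ℝ) × ℝ}

theorem suspPt_hopf_mid (t : ℝ) (v : ℂ × ℂ) :
    (suspPt (1, 0) t (hopf v)).1.2 = (1 - |1 - 2 * t|) * ((‖v.1‖ ^ 2 - ‖v.2‖ ^ 2) / 2) := by
  simp [suspPt, hopf, Complex.normSq_eq_norm_sq]

theorem suspPt_mid_nonneg {t : ℝ} (ht : t ∈ Icc (0 : ℝ) 1) {v : ℂ × ℂ} (h : ‖v.2‖ ≤ ‖v.1‖) :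
    0 ≤ (suspPt (1, 0) t (hopf v)).1.2 := by
  have h2 : ‖v.2‖ ^ 2 ≤ ‖v.1‖ ^ 2 := by gcongr
  rw [suspPt_hopf_mid]
  exact mul_nonneg (sub_nonneg.2 (abs_coord_le ht)) (by linarith)

theorem suspPt_mid_nonpos {t : ℝ} (ht : t ∈ Icc (0 : ℝ) 1) {v : ℂ × ℂ} (h : ‖v.1‖ ≤ ‖v.2‖) :
    (suspPt (1, 0) t (hopf v)).1.2 ≤ 0 := by
  have h2 : ‖v.1‖ ^ 2 ≤ ‖v.2‖ ^ 2 := by gcongr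
  rw [suspPt_hopf_mid]
  exact mul_nonpos_of_nonneg_of_nonpos (sub_nonneg.2 (abs_coord_le ht)) (by linarith)

/-- The deformation of a point towards the constant six. -/
noncomputable def toSix (τ : ℝ) (a : ℂ) : ℂ := (1 - τ) • a + τ • 6

theorem norm_toSix_le {τ : ℝ} (hτ : τ ∈ Icc (0 : ℝ) 1) {a : ℂ} {r : ℝ} (ha : ‖a‖ ≤ r)
    (hr : 6 ≤ r) : ‖toSix τ a‖ ≤ r := by
  refine (norm_add_le _ _).trans ?_
  rw [norm_smul, norm_smul, Real.norm_of_nonneg hτ.1, Real.norm_of_nonneg (sub_nonneg.2 hτ.2)]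
  have h1 := mul_le_mul_of_nonneg_left ha (sub_nonneg.2 hτ.2)
  have h2 := mul_le_mul_of_nonneg_left hr hτ.1
  norm_num
  linarith

/-- The pairing of two points of the filling over different points. -/
noncomputable def crossPair (G : ℂ × ℂ → ℝ → (ℂ × ℝ) × ℝ) (τ : ℝ) (y : Fin 6 → ℝ) :
    ((ℂ × ℝ) × (ℂ × ℝ)) × ℝ :=
  pair (G (toSix τ (planePt y).1, (planePt y).2) (y 4))
    (G ((planePt y).1, toSix τ (planePt y).2) (y 5))

/-- The explicit end of the deformation that separates the two points. -/
noncomputable def linkPt (y : Fin 6 → ℝ) : ((ℂ × ℝ) × (ℂ × ℝ)) × ℝ :=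
  pair (suspPt (1, 0) (y 4) (hopf (6, (planePt y).2)))
    (suspPt (1, 0) (y 5) (hopf ((planePt y).1, 6)))

theorem IsFilling.crossPair_ne (hG : IsFilling G) (τ : ℝ) {y : Fin 6 → ℝ}
    (hy : y ∈ Icc (0 : Fin 6 → ℝ) 1) : crossPair G τ y ≠ 0 :=
  pair_ne_zero (hG.ne _ _ ⟨hy.1 4, hy.2 4⟩) (hG.ne _ _ ⟨hy.1 5, hy.2 5⟩)

theorem IsFilling.crossPair_nonneg (hG : IsFilling G) {τ : ℝ} (hτ : τ ∈ Icc (0 : ℝ) 1)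
    {y : Fin 6 → ℝ} (hy : y ∈ Icc (0 : Fin 6 → ℝ) 1) {i : Fin 6} (hi : y i = 0 ∨ y i = 1) :
    0 ≤ (crossPair G τ y).2 := by
  simp only [crossPair, pair]
  by_cases h4 : i = 4
  · subst h4
    refine le_max_of_le_left ?_
    rw [hG.bd _ _ hi]; simp
  by_cases h5 : i = 5
  · subst h5
    refine le_max_of_le_right ?_
    rw [hG.bd _ _ hi]
  have ho := norm_planePt_of_boundary hi h4 h5
  rcases le_total ‖(planePt y).1‖ ‖(planePt y).2‖ with h | h
  · have h6 : 6 ≤ ‖(planePt y).2‖ := ho.elim (fun h' => h'.trans h) id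
    refine le_max_of_le_left ?_
    rw [hG.out (toSix τ (planePt y).1, (planePt y).2) (Or.inr h6), neg_nonneg]
    exact suspPt_mid_nonpos ⟨hy.1 4, hy.2 4⟩ (norm_toSix_le hτ h h6)
  · have h6 : 6 ≤ ‖(planePt y).1‖ := ho.elim id fun h' => h'.trans h
    refine le_max_of_le_right ?_
    rw [hG.out ((planePt y).1, toSix τ (planePt y).2) (Or.inl h6)]
    exact suspPt_mid_nonneg ⟨hy.1 5, hy.2 5⟩ (norm_toSix_le hτ h h6)

theorem IsFilling.crossPair_one (hG : IsFilling G) (y : Fin 6 → ℝ) :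
    crossPair G 1 y = linkPt y := by
  simp only [crossPair, linkPt, toSix, sub_self, zero_smul, one_smul, zero_add]
  rw [hG.out _ (Or.inl (by norm_num)), hG.out _ (Or.inr (by norm_num))]

theorem IsFilling.isHtpy_cross (hG : IsFilling G) :
    ∃ H, IsHtpy baseW.1 (fiberLoop G) (fun y => pin (linkPt y)) H := by
  have hd1 : Continuous fun y => (planePt y).1 := continuous_fst.comp continuous_planePt
  have hd2 : Continuous fun y => (planePt y).2 := continuous_snd.comp continuous_planePt
  have hs : Continuous fun p : ℝ × ℂ => toSix p.1 p.2 := by unfold toSix; fun_prop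
  refine ⟨fun τ y => pin (crossPair G τ y), ?_, fun τ hτ y hy => pin_ne_zero _,
    fun τ hτ y hy i hi => pin_of_nonneg (hG.crossPair_nonneg hτ hy hi), fun y hy => ?_,
    fun y hy => by rw [hG.crossPair_one]⟩
  · refine continuousOn_pin.comp (f := fun p : ℝ × (Fin 6 → ℝ) => crossPair G p.1 p.2) ?_
      fun p hp => hG.crossPair_ne _ hp.2
    refine continuous_pair.comp_continuousOn (f := fun p : ℝ × (Fin 6 → ℝ) =>
      (G (toSix p.1 (planePt p.2).1, (planePt p.2).2) (p.2 4),
        G ((planePt p.2).1, toSix p.1 (planePt p.2).2) (p.2 5))) (ContinuousOn.prodMk ?_ ?_)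
    · refine hG.cont.comp (f := fun p : ℝ × (Fin 6 → ℝ) =>
        ((toSix p.1 (planePt p.2).1, (planePt p.2).2), p.2 4)) (Continuous.continuousOn ?_)
        fun p hp => ⟨mem_univ _, hp.2.1 4, hp.2.2 4⟩
      refine Continuous.prodMk (Continuous.prodMk ?_ (hd2.comp continuous_snd)) (by fun_prop)
      exact hs.comp (f := fun p : ℝ × (Fin 6 → ℝ) => (p.1, (planePt p.2).1))
        (continuous_fst.prodMk (hd1.comp continuous_snd))
    · refine hG.cont.comp (f := fun p : ℝ × (Fin 6 → ℝ) =>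
        (((planePt p.2).1, toSix p.1 (planePt p.2).2), p.2 5)) (Continuous.continuousOn ?_)
        fun p hp => ⟨mem_univ _, hp.2.1 5, hp.2.2 5⟩
      refine Continuous.prodMk (Continuous.prodMk (hd1.comp continuous_snd) ?_) (by fun_prop)
      exact hs.comp (f := fun p : ℝ × (Fin 6 → ℝ) => (p.1, (planePt p.2).2))
        (continuous_fst.prodMk (hd2.comp continuous_snd))
  · simp [crossPair, fiberLoop, fiberPair, rot_zero, toSix]

theorem continuous_linkPt : Continuous linkPt := by
  have hd1 : Continuous fun y => (planePt y).1 := continuous_fst.comp continuous_planePt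
  have hd2 : Continuous fun y => (planePt y).2 := continuous_snd.comp continuous_planePt
  refine continuous_pair.comp (f := fun y : Fin 6 → ℝ =>
    (suspPt ((1 : ℂ), (0 : ℝ)) (y 4) (hopf (6, (planePt y).2)),
      suspPt ((1 : ℂ), (0 : ℝ)) (y 5) (hopf ((planePt y).1, 6)))) (Continuous.prodMk ?_ ?_)
  · exact (continuous_suspPt ((1 : ℂ), (0 : ℝ))).comp
      (f := fun y : Fin 6 → ℝ => (y 4, hopf (6, (planePt y).2)))
      ((continuous_apply 4).prodMk (continuous_hopf.comp (continuous_const.prodMk hd2)))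
  · exact (continuous_suspPt ((1 : ℂ), (0 : ℝ))).comp
      (f := fun y : Fin 6 → ℝ => (y 5, hopf ((planePt y).1, 6)))
      ((continuous_apply 5).prodMk (continuous_hopf.comp (hd1.prodMk continuous_const)))

/-- A point on a segment between a suspension coordinate and a linear coordinate vanishes only at
the midpoint. -/
theorem eq_half_of_segment {τ t : ℝ} (hτ : τ ∈ Icc (0 : ℝ) 1) (hτ0 : τ ≠ 0)
    (ht : t ∈ Icc (0 : ℝ) 1) {v : ℂ × ℝ}
    (h : (1 - τ) * ((1 - |1 - 2 * t|) * (1 - 2 * t) * ‖v - (1, 0)‖) + τ * -(2 * t - 1) = 0) :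
    t = 1 / 2 := by
  have h1 : ((1 - τ) * ((1 - |1 - 2 * t|) * ‖v - (1, 0)‖) + τ) * (1 - 2 * t) = 0 := by
    linear_combination h
  have h2 : 0 ≤ (1 - τ) * ((1 - |1 - 2 * t|) * ‖v - (1, 0)‖) :=
    mul_nonneg (sub_nonneg.2 hτ.2)
      (mul_nonneg (sub_nonneg.2 (abs_coord_le ht)) (norm_nonneg _))
  have h3 : 0 < τ := lt_of_le_of_ne hτ.1 hτ0.symm
  rcases mul_eq_zero.1 h1 with h4 | h4 <;> linarith

theorem linkPt_ne_zero (y : Fin 6 → ℝ) : linkPt y ≠ 0 := by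
  have h6 : (6 : ℂ) ≠ 0 := by norm_num
  have h1 : ((1 : ℂ), (0 : ℝ)) ≠ 0 := fun h => one_ne_zero (congrArg Prod.fst h)
  exact pair_ne_zero
    (suspPt_ne_zero h1 (hopf_ne_zero fun h => h6 (congrArg Prod.fst h)))
    (suspPt_ne_zero h1 (hopf_ne_zero fun h => h6 (congrArg Prod.snd h)))

theorem segment_ne_zero {τ : ℝ} (hτ : τ ∈ Icc (0 : ℝ) 1) {y : Fin 6 → ℝ}
    (hy : y ∈ Icc (0 : Fin 6 → ℝ) 1) : (1 - τ) • linkPt y + τ • stdPt y ≠ 0 := fun h => by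
  rcases eq_or_ne τ 0 with rfl | hτ0
  · simp only [sub_zero, one_smul, zero_smul, add_zero] at h
    exact linkPt_ne_zero y h
  have hτp : 0 < τ := lt_of_le_of_ne hτ.1 hτ0.symm
  have h4 : y 4 = 1 / 2 := eq_half_of_segment hτ hτ0 ⟨hy.1 4, hy.2 4⟩
    (v := hopf (6, (planePt y).2)) (congrArg (fun w => w.1.1.2) h)
  have h5 : y 5 = 1 / 2 := eq_half_of_segment hτ hτ0 ⟨hy.1 5, hy.2 5⟩
    (v := hopf ((planePt y).1, 6)) (congrArg (fun w => w.1.2.2) h)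
  have hl : linkPt y = pair (hopf (6, (planePt y).2), 0) (hopf ((planePt y).1, 6), 0) := by
    rw [linkPt, h4, h5, suspPt_half, suspPt_half]
  rw [hl] at h
  have c2 := congrArg (fun w => w.1.1.1.re) h
  have c3 := congrArg (fun w => w.1.1.1.im) h
  have c0 := congrArg (fun w => w.1.2.1.re) h
  have c1 := congrArg (fun w => w.1.2.1.im) h
  have c := congrArg Prod.snd h
  simp [pair, drop, hopf, planePt, stdPt, emb, center] at c0 c1 c2 c3
  have key : ∀ u : ℝ, (1 - τ) * (36 * u) + τ * u = 0 → u = 0 := fun u hu => by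
    have : ((1 - τ) * 36 + τ) * u = 0 := by rw [← hu]; ring
    exact (mul_eq_zero.1 this).resolve_left (by nlinarith [hτ.2])
  have e0 := key (2 * y 0 - 1) (by rw [← c0]; ring)
  have e1 := key (2 * y 1 - 1) (by rw [← c1]; ring)
  have e2 := key (2 * y 2 - 1) (by rw [← c2]; ring)
  have e3 := key (2 * y 3 - 1) (by rw [← neg_eq_zero, ← c3]; ring)
  have hc : center y = 0 := by
    funext i
    fin_cases i <;> simp [center] <;> linarith
  have hp : planePt y = 0 := by
    refine Prod.ext (Complex.ext ?_ ?_) (Complex.ext ?_ ?_) <;> simp [planePt] <;> linarith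
  rw [hp] at c
  simp [pair, hopf, stdPt, hc] at c
  norm_num at c
  nlinarith [hτ.2]

theorem linkPt_nonneg {y : Fin 6 → ℝ} (hy : y ∈ Icc (0 : Fin 6 → ℝ) 1) {i : Fin 6}
    (hi : y i = 0 ∨ y i = 1) : 0 ≤ (linkPt y).2 := by
  simp only [linkPt, pair]
  by_cases h4 : i = 4
  · subst h4
    refine le_max_of_le_left ?_
    rcases hi with hi | hi <;> simp [hi, suspPt_zero, suspPt_one]
  by_cases h5 : i = 5
  · subst h5
    refine le_max_of_le_right ?_
    rcases hi with hi | hi <;> simp [hi, suspPt_zero, suspPt_one]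
  rcases norm_planePt_of_boundary hi h4 h5 with h | h
  · refine le_max_of_le_right (suspPt_mid_nonneg ⟨hy.1 5, hy.2 5⟩ ?_)
    simpa using h
  · refine le_max_of_le_left (neg_nonneg.2 (suspPt_mid_nonpos ⟨hy.1 4, hy.2 4⟩ ?_))
    simpa using h

theorem isHtpy_link :
    ∃ H, IsHtpy baseW.1 (fun y => pin (linkPt y)) (fun y => pin (stdPt y)) H := by
  have h1 := continuous_linkPt
  have h2 := continuous_stdPt
  refine ⟨fun τ y => pin ((1 - τ) • linkPt y + τ • stdPt y), ?_, fun τ hτ y hy => pin_ne_zero _,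
    fun τ hτ y hy i hi => pin_of_nonneg ?_, fun y hy => by simp, fun y hy => by simp⟩
  · exact continuousOn_pin.comp
      (f := fun p : ℝ × (Fin 6 → ℝ) => (1 - p.1) • linkPt p.2 + p.1 • stdPt p.2)
      (by fun_prop) fun p hp => segment_ne_zero hp.1 hp.2
  · have e : (stdPt y).2 = 0 := by simp [stdPt, norm_center_of_boundary hy hi]
    simp only [Prod.snd_add, Prod.smul_snd, smul_eq_mul, e, mul_zero, add_zero]
    exact mul_nonneg (sub_nonneg.2 hτ.2) (linkPt_nonneg hy hi)

theorem not_isFilling : ¬ IsFilling G := fun hG => by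
  obtain ⟨e⟩ := nonempty_PG_baseW
  obtain ⟨_, h1⟩ := hG.isHtpy_cross
  obtain ⟨_, h2⟩ := isHtpy_link
  have hM := h1.isLoop_left
  obtain ⟨a, ha⟩ := hG.exists_sq hM
  have hsq : ∀ b : PG 6 _ baseW, ∃ c, b = c ^ 2 := fun b => by
    obtain ⟨g, hg, rfl, -⟩ := exists_loop b
    obtain ⟨_, h3⟩ := isHtpy_extend hg
    have hS := h2.isLoop_right
    have e1 : hM.cls = hS.cls :=
      (h1.cls_eq hM h1.isLoop_right).trans (h2.cls_eq h1.isLoop_right hS)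
    let φ := pmap (k := 5) (x := baseW) (x' := baseW) (continuousOn_extend hg) (extend_ne_zero hg)
      (extend_base g)
    refine ⟨φ a, ?_⟩
    rw [← map_pow, ← ha, e1]
    exact (h3.cls_eq (hS.comp (continuousOn_extend hg) (extend_ne_zero hg) (extend_base g))
      hg).symm
  obtain ⟨c, hc⟩ := hsq (e.symm (Multiplicative.ofAdd 1))
  have h : (1 : ℤ) = 2 * Multiplicative.toAdd (e c) := by
    have h' := congrArg (fun z => Multiplicative.toAdd (e z)) hc
    beta_reduce at h'
    rwa [MulEquiv.apply_symm_apply, map_pow, toAdd_pow, toAdd_ofAdd, nsmul_eq_mul] at h'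
  omega

/-- The second stem group is nontrivial. -/
theorem nontrivial_stem : Nontrivial (PG 4 ((ℂ × ℝ) × ℝ) (suspBase (suspBase oneC))) := by
  by_contra hn
  rw [not_nontrivial_iff_subsingleton] at hn
  obtain ⟨G, h1, h2, h3, h4⟩ := exists_filling fun a => Subsingleton.elim a 1
  exact not_isFilling (G := G) ⟨h1, h2, h3, h4⟩

end Linking

end PontryaginStem

theorem pontryagin_pi_succ_sphere (n : ℕ) (hn : 3 ≤ n)
    (x : sphere (0 : EuclideanSpace ℝ (Fin (n + 1))) 1) :
    Nonempty ((π_ (n + 1) (sphere (0 : EuclideanSpace ℝ (Fin (n + 1))) 1) x) ≃*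
      Multiplicative (ZMod 2)) := by
  exact PontryaginStem.pontryagin_of_nontrivial PontryaginStem.nontrivial_stem n hn x
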